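/- Let L be a finite connected simplicial complex of dimension d with d ≠ 2. Then L embeds as a subcomplex of a contractible finite simplicial complex C of the same dimension d if and only if H^d(L; ℤ) = 0. -/

import Mathlib

/-- An abstract simplicial complex on a vertex type `V`. -/
structure ASC (V : Type) where
  faces : Set (Finset V)
  nonempty_of_mem : ∀ ⦃s⦄, s ∈ faces → s.Nonempty
  down_closed : ∀ ⦃s t⦄, s ∈ faces → t ⊆ s → t.Nonempty → t ∈ faces

/-- The order complex of a poset: simplices are finite nonempty chains. -/
def orderComplex (P : Type) [PartialOrder P] : ASC P where
  faces := {s | s.Nonempty ∧ IsChain (· ≤ ·) (↑s : Set P)}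
  nonempty_of_mem := fun _ h => h.1
  down_closed := fun _ _ hs hts ht => ⟨ht, hs.2.mono (Finset.coe_subset.2 hts)⟩

/-- A simplicial isomorphism between two abstract simplicial complexes. -/
def SimplicialIso {V W : Type} (K : ASC V) (K' : ASC W) : Prop :=
  ∃ e : V ≃ W, ∀ s : Finset V, s ∈ K.faces ↔ s.map e.toEmbedding ∈ K'.faces

/-- The geometric realization of an abstract simplicial complex, as a set of
barycentric-coordinate functions `V → ℝ`. -/
def realization {V : Type} (K : ASC V) : Set (V → ℝ) :=
  {f | ∃ s ∈ K.faces, (∀ v, 0 ≤ f v) ∧ (∀ v, v ∉ s → f v = 0) ∧ ∑ v ∈ s, f v = 1}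

/-- The barycentric subdivision: vertices are the simplices of `K`, and
simplices are chains of faces (under inclusion). -/
def barySub {V : Type} (K : ASC V) : ASC {s : Finset V // s ∈ K.faces} where
  faces := {S | S.Nonempty ∧ ∀ a ∈ S, ∀ b ∈ S, a.1 ⊆ b.1 ∨ b.1 ⊆ a.1}
  nonempty_of_mem := fun _ h => h.1
  down_closed := fun _ _ hs hts ht => ⟨ht, fun a ha b hb => hs.2 a (hts ha) b (hts hb)⟩

/-- The cone on a complex `K`: one new vertex (`none`) joined to every simplex. -/
def coneC {V : Type} [DecidableEq V] (K : ASC V) : ASC (Option V) where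
  faces := {s | s.Nonempty ∧
    (s.preimage some (Option.some_injective V).injOn = ∅ ∨
     s.preimage some (Option.some_injective V).injOn ∈ K.faces)}
  nonempty_of_mem := fun _ h => h.1
  down_closed := by
    intro s t hs hts ht
    refine ⟨ht, ?_⟩
    rcases hs.2 with h | h
    · left
      have : t.preimage some (Option.some_injective V).injOn ⊆
          s.preimage some (Option.some_injective V).injOn :=
        Finset.monotone_preimage (Option.some_injective V) hts
      rw [h] at this
      exact Finset.subset_empty.mp this
    · by_cases hne : (t.preimage some (Option.some_injective V).injOn).Nonempty
      · exact Or.inr (K.down_closed h (Finset.monotone_preimage (Option.some_injective V) hts) hne)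
      · exact Or.inl (Finset.not_nonempty_iff_eq_empty.mp hne)

open Classical in
/-- The simplicial coboundary of a `(d−1)`-cochain `f` (a function on the
`(d−1)`-simplices, i.e. faces of cardinality `d`), evaluated on a `d`-simplex
`t` (a face of cardinality `d + 1`): `(δf)(t) = Σ_{v ∈ t} (−1)^{ind(v)} f(t∖v)`,
with signs determined by the linear order on the vertices. -/
noncomputable def coboundary {V : Type} [LinearOrder V] (K : ASC V) (d : ℕ)
    (f : {s : Finset V // s ∈ K.faces ∧ s.card = d} → ℤ)
    (t : {s : Finset V // s ∈ K.faces ∧ s.card = d + 1}) : ℤ :=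
  ∑ v ∈ t.1.attach, (-1 : ℤ) ^ ((t.1.filter (fun w => w < v.1)).card) *
    (if h : t.1.erase v.1 ∈ K.faces ∧ (t.1.erase v.1).card = d then f ⟨_, h⟩ else 0)

/-- Vanishing of the top-dimensional (reduced) simplicial cohomology
`H^d(K; ℤ) = 0` of a `d`-dimensional complex `K`: every top cochain is a
coboundary (for `d = 0`, reduced cohomology: every `0`-cochain is constant). -/
noncomputable def topCohomVanishes {V : Type} [LinearOrder V] (K : ASC V)
    (d : ℕ) : Prop :=
  if d = 0 then
    ∀ g : {s : Finset V // s ∈ K.faces ∧ s.card = 1} → ℤ, ∃ c : ℤ, ∀ t, g t = c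
  else
    ∀ g : {s : Finset V // s ∈ K.faces ∧ s.card = d + 1} → ℤ,
      ∃ f : {s : Finset V // s ∈ K.faces ∧ s.card = d} → ℤ,
        ∀ t, g t = coboundary K d f t

/-- `K` embeds as a subcomplex of a finite contractible simplicial complex of
dimension (at most) `d`. -/
def EmbedsInContractible {V : Type} (K : ASC V) (d : ℕ) : Prop :=
  ∃ (W : Type) (C : ASC W) (f : V ↪ W),
    (∀ s ∈ C.faces, s.card ≤ d + 1) ∧
    C.faces.Finite ∧
    ContractibleSpace (realization C) ∧
    (∀ s : Finset V, s ∈ K.faces → s.map f ∈ C.faces)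

/-! ### Cochains on lists of points -/

/-- The alternating coboundary of a function on lists. -/
def dl {X : Type*} : (List X → ℤ) → List X → ℤ
  | _, [] => 0
  | G, x :: l => G l - dl (fun u => G (x :: u)) l

section ListCochains
variable {X Y : Type*}

@[simp] theorem dl_nil (G : List X → ℤ) : dl G [] = 0 := rfl

theorem dl_cons (G : List X → ℤ) (x : X) (l : List X) :
    dl G (x :: l) = G l - dl (fun u => G (x :: u)) l := rfl

theorem dl_sub (G G' : List X → ℤ) (l : List X) :
    dl (fun u => G u - G' u) l = dl G l - dl G' l := by
  induction l generalizing G G' with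
  | nil => simp
  | cons x l ih => simp only [dl_cons, ih]; ring

theorem dl_add (G G' : List X → ℤ) (l : List X) :
    dl (fun u => G u + G' u) l = dl G l + dl G' l := by
  induction l generalizing G G' with
  | nil => simp
  | cons x l ih => simp only [dl_cons, ih]; ring

theorem dl_zero (l : List X) : dl (fun _ => (0 : ℤ)) l = 0 := by
  induction l with
  | nil => simp
  | cons x l ih => simp only [dl_cons, ih]; ring

theorem dl_neg (G : List X → ℤ) (l : List X) : dl (fun u => -G u) l = -dl G l := by
  have := dl_sub (fun _ => 0) G l
  simpa [dl_zero] using this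

theorem dl_sum {ι : Type*} (s : Finset ι) (G : ι → List X → ℤ) (l : List X) :
    dl (fun u => ∑ i ∈ s, G i u) l = ∑ i ∈ s, dl (G i) l := by
  classical
  induction s using Finset.induction_on with
  | empty => simp [dl_zero]
  | insert a s ha ih => simp only [Finset.sum_insert ha, dl_add, ih]

theorem dl_dl (G : List X → ℤ) (l : List X) : dl (dl G) l = 0 := by
  induction l generalizing G with
  | nil => simp
  | cons x l ih => simp only [dl_cons, dl_sub, ih]; ring

theorem dl_map (G : List Y → ℤ) (f : X → Y) (l : List X) :
    dl (fun u => G (u.map f)) l = dl G (l.map f) := by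
  induction l generalizing G with
  | nil => simp
  | cons x l ih =>
    simp only [dl_cons, List.map_cons]
    rw [ih (fun u => G (f x :: u))]

theorem dl_congr {G G' : List X → ℤ} {l : List X}
    (h : ∀ u, u.Sublist l → u.length + 1 = l.length → G u = G' u) : dl G l = dl G' l := by
  induction l generalizing G G' with
  | nil => simp
  | cons x l ih =>
    rw [dl_cons, dl_cons, h l (List.sublist_cons_self x l) (by simp)]
    congr 1
    exact ih fun u hu hl => h _ (hu.cons_cons x) (by simp [hl])

/-- A function on lists changing sign under swapping adjacent entries. -/
def Antisym (G : List X → ℤ) : Prop :=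
  ∀ l₁ x y l₂, G (l₁ ++ x :: y :: l₂) = -G (l₁ ++ y :: x :: l₂)

theorem Antisym.cons {G : List X → ℤ} (h : Antisym G) (x : X) : Antisym fun u => G (x :: u) :=
  fun l₁ a b l₂ => h (x :: l₁) a b l₂

theorem Antisym.dl {G : List X → ℤ} (h : Antisym G) : Antisym (dl G) := by
  intro l₁
  induction l₁ generalizing G with
  | nil =>
    intro x y l
    simp only [List.nil_append, dl_cons]
    have : (fun u => G (x :: y :: u)) = fun u => -G (y :: x :: u) := funext fun u => h [] x y u
    rw [this, dl_neg]; ring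
  | cons z l₁ ih =>
    intro x y l
    simp only [List.cons_append, dl_cons]
    rw [ih (h.cons z), h l₁ x y l]; ring

theorem Antisym.perm {G : List X → ℤ} (h : Antisym G) {l l' : List X} (p : l.Perm l') :
    G l = G l' ∨ G l = -G l' := by
  induction p generalizing G with
  | nil => simp
  | cons x _ ih => exact ih (h.cons x)
  | swap x y l => exact Or.inr (h [] y x l)
  | trans _ _ ih₁ ih₂ => rcases ih₁ h with h1 | h1 <;> rcases ih₂ h with h2 | h2 <;> simp [h1, h2]

theorem Antisym.eq_zero {G : List X → ℤ} (h : Antisym G) {l : List X} (hl : ¬ l.Nodup) :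
    G l = 0 := by
  obtain ⟨x, hx⟩ := List.exists_duplicate_iff_not_nodup.2 hl
  obtain ⟨u, hu⟩ := (List.duplicate_iff_sublist.1 hx).exists_perm_append
  have h0 : G ([x, x] ++ u) = 0 := by
    have := h [] x x u
    simp only [List.nil_append] at this
    simp only [List.cons_append, List.nil_append]
    omega
  rcases h.perm hu with h1 | h1 <;> rw [h1, h0]
  rfl

/-- The prism operator between two maps. -/
def prism (p q : X → Y) : (List Y → ℤ) → List X → ℤ
  | _, [] => 0
  | G, x :: u => G (p x :: q x :: u.map q) - prism p q (fun l => G (p x :: l)) u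

theorem prism_sub (p q : X → Y) (G G' : List Y → ℤ) (l : List X) :
    prism p q (fun u => G u - G' u) l = prism p q G l - prism p q G' l := by
  induction l generalizing G G' with
  | nil => simp [prism]
  | cons x l ih => simp only [prism, ih]; ring

theorem prism_dl (p q : X → Y) (G : List Y → ℤ) (w : List X) :
    prism p q (dl G) w + dl (prism p q G) w = G (w.map q) - G (w.map p) := by
  induction w generalizing G with
  | nil => simp [prism]
  | cons x u ih =>
    have h1 := ih (fun l => G (p x :: l))
    simp only [prism, dl_cons, dl_sub, prism_sub, List.map_cons] at h1 ⊢
    rw [dl_map (fun u => G (p x :: q x :: u))]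
    linarith

theorem prism_eq_zero (p q : X → Y) {G : List Y → ℤ} {w : List X}
    (h : ∀ u : List Y, u.length = w.length + 1 →
      (∀ y ∈ u, ∃ x ∈ w, y = p x ∨ y = q x) → G u = 0) : prism p q G w = 0 := by
  induction w generalizing G with
  | nil => rfl
  | cons x w ih =>
    rw [prism, h, ih, sub_zero]
    · intro u hu hy
      refine h _ (by simp [hu]) ?_
      intro y hy'
      rcases List.mem_cons.1 hy' with rfl | hy'
      · exact ⟨x, by simp, Or.inl rfl⟩
      · obtain ⟨z, hz, hz'⟩ := hy y hy'
        exact ⟨z, by simp [hz], hz'⟩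
    · simp
    · intro y hy
      rcases List.mem_cons.1 hy with rfl | hy'
      · exact ⟨x, by simp, Or.inl rfl⟩
      rcases List.mem_cons.1 hy' with rfl | hy'
      · exact ⟨x, by simp, Or.inr rfl⟩
      obtain ⟨z, hz, rfl⟩ := List.mem_map.1 hy'
      exact ⟨z, by simp [hz], Or.inr rfl⟩

end ListCochains

/-! ### Barycentric subdivision -/

section Subdivision
variable {E : Type*} [NormedAddCommGroup E] [NormedSpace ℝ E]

/-- The barycenter of a list of points. -/
noncomputable def bary (w : List E) : E := (w.length : ℝ)⁻¹ • w.sum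

/-- Barycentric subdivision of a cochain, on lists of length `m`. -/
noncomputable def sdAux : ℕ → (List E → ℤ) → List E → ℤ
  | 0, G, w => G w
  | m + 1, G, w => dl (sdAux m (fun u => G (bary w :: u))) w

/-- Barycentric subdivision of a cochain. -/
noncomputable def sd (G : List E → ℤ) (w : List E) : ℤ := sdAux w.length G w

theorem sdAux_sub (m : ℕ) (G G' : List E → ℤ) (w : List E) :
    sdAux m (fun u => G u - G' u) w = sdAux m G w - sdAux m G' w := by
  induction m generalizing G G' w with
  | zero => rfl
  | succ m ih =>
    simp only [sdAux]
    rw [← dl_sub]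
    congr 1
    funext u
    exact ih _ _ _

theorem sdAux_dl (m : ℕ) (G : List E → ℤ) (w : List E) (hw : w.length = m + 1) :
    sdAux (m + 1) (dl G) w = dl (sdAux m G) w := by
  induction m generalizing G w with
  | zero =>
    obtain ⟨x, rfl⟩ := List.length_eq_one_iff.1 hw
    simp [sdAux, dl_cons]
  | succ m ih =>
    have h1 : (sdAux (m + 1) fun u => dl G (bary w :: u)) =
        fun v => sdAux (m + 1) G v - sdAux (m + 1) (dl fun u => G (bary w :: u)) v := by
      funext v
      rw [← sdAux_sub]
      rfl
    rw [sdAux, h1, dl_sub, sub_eq_self, ← dl_dl (sdAux m fun u => G (bary w :: u)) w]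
    exact dl_congr fun u _ hu => ih _ u (by omega)

theorem sd_dl (G : List E → ℤ) : sd (dl G) = dl (sd G) := by
  funext w
  rcases w with _ | ⟨x, w⟩
  · rfl
  · rw [sd, List.length_cons, sdAux_dl _ _ _ (by simp)]
    refine dl_congr fun u _ hu => ?_
    rw [sd]
    congr 1
    simpa using hu.symm

theorem bary_mem {K : Set E} (hK : Convex ℝ K) {w : List E} (hw : w ≠ [])
    (h : ∀ x ∈ w, x ∈ K) : bary w ∈ K := by
  have hn : (0 : ℝ) < w.length := by exact_mod_cast List.length_pos_iff.2 hw
  have : bary w = ∑ i : Fin w.length, (w.length : ℝ)⁻¹ • w.get i := by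
    rw [bary, ← Finset.smul_sum, ← Fin.sum_univ_getElem w]
    rfl
  rw [this]
  refine hK.sum_mem (fun _ _ => by positivity) ?_ (fun i _ => h _ (List.get_mem _ _))
  simp [hn.ne']

theorem dist_bary_le {N : ℕ} {D : ℝ} {w : List E} (hN : w.length ≤ N)
    (h : ∀ x ∈ w, ∀ y ∈ w, dist x y ≤ D) {y : E} (hy : y ∈ w) :
    dist (bary w) y ≤ (1 - (N : ℝ)⁻¹) * D := by
  have hD : 0 ≤ D := by simpa using h y hy y hy
  have hn : 0 < w.length := List.length_pos_of_mem hy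
  have hn' : (0 : ℝ) < w.length := by exact_mod_cast hn
  have hb : ∀ l : List E, (∀ x ∈ l, dist x y ≤ D) → ‖(l.map fun x => x - y).sum‖ ≤ l.length * D := by
    intro l
    induction l with
    | nil => simp
    | cons a l ih =>
      intro hl
      have h1 := ih fun x hx => hl x (by simp [hx])
      have h2 := hl a (by simp)
      rw [dist_eq_norm] at h2
      simp only [List.map_cons, List.sum_cons, List.length_cons, Nat.cast_add, Nat.cast_one]
      have := norm_add_le (a - y) (l.map fun x => x - y).sum
      linarith
  have hs : ∀ l : List E, (l.map fun x => x - y).sum = l.sum - (l.length : ℝ) • y := by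
    intro l
    induction l with
    | nil => simp
    | cons a l ih =>
      simp only [List.map_cons, List.sum_cons, List.length_cons, ih, Nat.cast_add, Nat.cast_one,
        add_smul, one_smul]
      abel
  obtain ⟨l₁, l₂, rfl⟩ := List.append_of_mem hy
  set w := l₁ ++ y :: l₂ with hw
  have hlen : (w.length : ℝ) = (l₁ ++ l₂).length + 1 := by simp [hw]; ring
  have h3 : bary w - y = (w.length : ℝ)⁻¹ • ((l₁ ++ l₂).map fun x => x - y).sum := by
    rw [hs, bary]
    have : w.sum = (l₁ ++ l₂).sum + y := by simp [hw]; abel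
    rw [this, smul_sub, smul_add, smul_smul]
    have h4 : ((w.length : ℝ)⁻¹ * ((l₁ ++ l₂).length : ℝ)) = 1 - (w.length : ℝ)⁻¹ := by
      field_simp; linarith
    rw [h4, sub_smul, one_smul]
    abel
  rw [dist_eq_norm, h3, norm_smul, norm_inv, Real.norm_natCast]
  have h5 := hb (l₁ ++ l₂) fun x hx => h x (by
    rw [hw]; rcases List.mem_append.1 hx with h | h <;> simp [h]) y hy
  have h6 : (N : ℝ)⁻¹ ≤ (w.length : ℝ)⁻¹ := by
    apply inv_anti₀ hn'
    exact_mod_cast hN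
  calc (w.length : ℝ)⁻¹ * ‖((l₁ ++ l₂).map fun x => x - y).sum‖
      ≤ (w.length : ℝ)⁻¹ * (((l₁ ++ l₂).length : ℝ) * D) := by gcongr
    _ = (1 - (w.length : ℝ)⁻¹) * D := by
      rw [← mul_assoc]; congr 1; field_simp; linarith
    _ ≤ _ := by gcongr

theorem sdAux_congr {N m : ℕ} {D : ℝ} {K : Set E} (hK : Convex ℝ K) {w : List E}
    (hm : w.length = m) (hN : m ≤ N) (hwK : ∀ x ∈ w, x ∈ K) (hwD : ∀ x ∈ w, ∀ y ∈ w, dist x y ≤ D)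
    {G G' : List E → ℤ} (h : ∀ u : List E, u.length = m → (∀ x ∈ u, x ∈ K) →
      (∀ x ∈ u, ∀ y ∈ u, dist x y ≤ (1 - (N : ℝ)⁻¹) * D) → G u = G' u) :
    sdAux m G w = sdAux m G' w := by
  induction m generalizing G G' w K with
  | zero =>
    obtain rfl := List.length_eq_zero_iff.1 hm
    exact h [] rfl (by simp) (by simp)
  | succ m ih =>
    have hw0 : w ≠ [] := by rintro rfl; simp at hm
    have hD : 0 ≤ D := by
      obtain ⟨x, hx⟩ := List.exists_mem_of_ne_nil w hw0
      simpa using hwD x hx x hx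
    simp only [sdAux]
    refine dl_congr fun u hu hul => ?_
    refine ih (convex_convexHull ℝ {x | x ∈ w}) (by omega) (by omega)
      (fun x hx => subset_convexHull ℝ _ (hu.subset hx))
      (fun x hx y hy => hwD x (hu.subset hx) y (hu.subset hy)) fun v hv hvK hvD => ?_
    have hsub : convexHull ℝ {x | x ∈ w} ⊆ K := convexHull_min (fun x hx => hwK x hx) hK
    have hr : 0 ≤ (1 - (N : ℝ)⁻¹) * D := by
      have : (N : ℝ)⁻¹ ≤ 1 := Nat.cast_inv_le_one N
      exact mul_nonneg (by linarith) hD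
    have hball : convexHull ℝ {x | x ∈ w} ⊆ Metric.closedBall (bary w) ((1 - (N : ℝ)⁻¹) * D) := by
      refine convexHull_min (fun x hx => ?_) (convex_closedBall _ _)
      rw [Metric.mem_closedBall, dist_comm]
      exact dist_bary_le (by omega) hwD hx
    refine h _ (by simp [hv]) ?_ ?_
    · intro x hx
      rcases List.mem_cons.1 hx with rfl | hx
      · exact bary_mem hK hw0 hwK
      · exact hsub (hvK x hx)
    · intro x hx y hy
      rcases List.mem_cons.1 hx with rfl | hx <;> rcases List.mem_cons.1 hy with rfl | hy
      · simpa using hr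
      · rw [dist_comm]; exact hball (hvK y hy)
      · exact hball (hvK x hx)
      · exact hvD x hx y hy

theorem sd_iterate_congr {N k : ℕ} {D : ℝ} {K : Set E} (hK : Convex ℝ K) {w : List E}
    (hN : w.length ≤ N) (hwK : ∀ x ∈ w, x ∈ K) (hwD : ∀ x ∈ w, ∀ y ∈ w, dist x y ≤ D)
    {G G' : List E → ℤ} (h : ∀ u : List E, u.length = w.length → (∀ x ∈ u, x ∈ K) →
      (∀ x ∈ u, ∀ y ∈ u, dist x y ≤ (1 - (N : ℝ)⁻¹) ^ k * D) → G u = G' u) :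
    sd^[k] G w = sd^[k] G' w := by
  induction k generalizing G G' with
  | zero => exact h w rfl hwK (by simpa using hwD)
  | succ k ih =>
    rw [Function.iterate_succ_apply, Function.iterate_succ_apply]
    refine ih fun u hu huK huD => ?_
    rw [sd, sd]
    refine sdAux_congr hK rfl (hu.trans_le hN) huK huD fun v hv hvK hvD => ?_
    refine h v (hv.trans hu) hvK fun x hx y hy => (hvD x hx y hy).trans_eq ?_
    rw [pow_succ]; ring

theorem sd_iterate_dl (k : ℕ) (G : List E → ℤ) : sd^[k] (dl G) = dl (sd^[k] G) := by
  induction k generalizing G with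
  | zero => rfl
  | succ k ih => rw [Function.iterate_succ_apply, Function.iterate_succ_apply, sd_dl, ih]

theorem sd_iterate_sub (k : ℕ) (G G' : List E → ℤ) :
    sd^[k] (fun u => G u - G' u) = fun u => sd^[k] G u - sd^[k] G' u := by
  induction k generalizing G G' with
  | zero => rfl
  | succ k ih =>
    simp only [Function.iterate_succ_apply]
    rw [← ih]
    congr 1
    funext u
    exact sdAux_sub _ _ _ _

end Subdivision

/-! ### The cone homotopy for cochain maps carried by simplices -/

section ConeHomotopy
variable {U : Type*}

/-- The homotopy between the identity and a cochain operator `T`, built by coning on the head. -/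
def coneHtpy (T : (List U → ℤ) → List U → ℤ) : ℕ → (List U → ℤ) → List U → ℤ
  | 0, _, _ => 0
  | _ + 1, _, [] => 0
  | m + 1, G, x :: l => G (x :: x :: l) - T (fun u => G (x :: u)) (x :: l) -
      dl (coneHtpy T m (fun u => G (x :: u))) (x :: l)

variable {T : (List U → ℤ) → List U → ℤ}

theorem coneHtpy_sub (hsub : ∀ G G' l, T (fun u => G u - G' u) l = T G l - T G' l) (m : ℕ)
    (G G' : List U → ℤ) (l : List U) :
    coneHtpy T m (fun u => G u - G' u) l = coneHtpy T m G l - coneHtpy T m G' l := by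
  induction m generalizing G G' l with
  | zero => simp [coneHtpy]
  | succ m ih =>
    rcases l with _ | ⟨x, l⟩
    · simp [coneHtpy]
    · simp only [coneHtpy, hsub]
      have : (coneHtpy T m fun u => G (x :: u) - G' (x :: u)) = fun v =>
          coneHtpy T m (fun u => G (x :: u)) v - coneHtpy T m (fun u => G' (x :: u)) v :=
        funext fun v => ih _ _ v
      rw [this, dl_sub]; ring

theorem coneHtpy_dl (hsub : ∀ G G' l, T (fun u => G u - G' u) l = T G l - T G' l)
    (hdl : ∀ G l, T (dl G) l = dl (T G) l) (hnil : ∀ G, T G [] = G []) (m : ℕ)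
    (G : List U → ℤ) (l : List U) (hl : l.length = m) :
    G l - T G l = dl (coneHtpy T (m - 1) G) l + coneHtpy T m (dl G) l := by
  induction m generalizing G l with
  | zero =>
    obtain rfl := List.length_eq_zero_iff.1 hl
    simp [hnil, coneHtpy]
  | succ m ih =>
    rcases l with _ | ⟨x, l⟩
    · simp at hl
    have h1 : (fun u => dl G (x :: u)) = fun u => G u - dl (fun v => G (x :: v)) u := rfl
    have h2 : (coneHtpy T m fun u => dl G (x :: u)) = fun v =>
        coneHtpy T m G v - coneHtpy T m (dl fun u => G (x :: u)) v :=
      funext fun v => coneHtpy_sub hsub m G _ v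
    have h3 : dl (fun v => (fun u => G (x :: u)) v - T (fun u => G (x :: u)) v -
        coneHtpy T m (dl fun u => G (x :: u)) v) (x :: l) = 0 := by
      rw [← dl_dl (coneHtpy T (m - 1) fun u => G (x :: u)) (x :: l)]
      refine dl_congr fun u _ hu => ?_
      have := ih (fun u => G (x :: u)) u (by simp at hl hu; omega)
      linarith
    rw [dl_sub, dl_sub] at h3
    rw [coneHtpy, h2, h1, hsub, dl_sub, hdl, dl_cons G, Nat.add_sub_cancel]
    linarith

theorem coneHtpy_eq_zero (hzero : ∀ l, T (fun _ => 0) l = 0)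
    (hT : ∀ G G' l, (∀ u : List U, u.length = l.length → u ⊆ l → G u = G' u) → T G l = T G' l)
    (m : ℕ) (G : List U → ℤ) (l : List U) (hl : l.length = m)
    (h : ∀ u : List U, u.length = m + 1 → u ⊆ l → G u = 0) : coneHtpy T m G l = 0 := by
  induction m generalizing G l with
  | zero => rfl
  | succ m ih =>
    rcases l with _ | ⟨x, l⟩
    · simp [coneHtpy]
    have h1 : T (fun u => G (x :: u)) (x :: l) = 0 := by
      rw [← hzero (x :: l)]
      exact hT _ _ _ fun u hu hul => h _ (by simp at hu hl ⊢; omega)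
        (List.cons_subset.2 ⟨by simp, hul⟩)
    have h2 : dl (coneHtpy T m fun u => G (x :: u)) (x :: l) = dl (fun _ => 0) (x :: l) := by
      refine dl_congr fun u hu hul => ?_
      have hul' : u.length = m := by simp at hul hl; omega
      refine ih _ u hul' fun v hv hvl => ?_
      exact h _ (by simp [hv]) (List.cons_subset.2 ⟨by simp, fun a ha => hu.subset (hvl ha)⟩)
    rw [coneHtpy, h1, h2, dl_zero, h _ (by simp at hl ⊢; omega)
      (List.cons_subset.2 ⟨by simp, fun a ha => ha⟩)]
    rfl

end ConeHomotopy

/-! ### Closed cells of a realization -/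

section Cells
variable {W : Type}

/-- The closed geometric simplex spanned by a finite set of vertices. -/
def cell (s : Finset W) : Set (W → ℝ) :=
  {f | (∀ v, 0 ≤ f v) ∧ (∀ v, v ∉ s → f v = 0) ∧ ∑ v ∈ s, f v = 1}

theorem mem_realization {C : ASC W} {f : W → ℝ} :
    f ∈ realization C ↔ ∃ s ∈ C.faces, f ∈ cell s := Iff.rfl

theorem realization_eq (C : ASC W) : realization C = ⋃ s ∈ C.faces, cell s := by
  ext f; simp [mem_realization]

theorem cell_subset_realization {C : ASC W} {s : Finset W} (hs : s ∈ C.faces) :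
    cell s ⊆ realization C := fun _ hf => ⟨s, hs, hf⟩

theorem cell_mono {s t : Finset W} (h : s ⊆ t) : cell s ⊆ cell t := fun f hf =>
  ⟨hf.1, fun v hv => hf.2.1 v fun hv' => hv (h hv'), by
    rw [← hf.2.2]
    exact (Finset.sum_subset h fun x _ hx => hf.2.1 x hx).symm⟩

theorem cell_le_one {s : Finset W} {f : W → ℝ} (hf : f ∈ cell s) (v : W) : f v ≤ 1 := by
  by_cases hv : v ∈ s
  · rw [← hf.2.2]; exact Finset.single_le_sum (fun i _ => hf.1 i) hv
  · rw [hf.2.1 v hv]; exact zero_le_one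

theorem cell_nonempty_finset {s : Finset W} {f : W → ℝ} (hf : f ∈ cell s) : s.Nonempty := by
  rw [Finset.nonempty_iff_ne_empty]
  rintro rfl
  simpa using hf.2.2

theorem isClosed_cell (s : Finset W) : IsClosed (cell s) := by
  have : cell s = (⋂ v, {f | 0 ≤ f v}) ∩ ((⋂ v, {f | v ∉ s → f v = 0}) ∩ {f | ∑ v ∈ s, f v = 1}) := by
    ext f; simp [cell]
  rw [this]
  refine (isClosed_iInter fun v => isClosed_le continuous_const (continuous_apply v)).inter
    ((isClosed_iInter fun v => ?_).inter
      (isClosed_eq (continuous_finsetSum _ fun v _ => continuous_apply v) continuous_const))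
  by_cases hv : v ∈ s
  · simp [hv]
  · simpa [hv] using isClosed_eq (continuous_apply v) continuous_const

theorem isCompact_cell (s : Finset W) : IsCompact (cell s) := by
  have h : IsCompact (Set.univ.pi fun _ : W => Set.Icc (0 : ℝ) 1) :=
    isCompact_univ_pi fun _ => isCompact_Icc
  exact h.of_isClosed_subset (isClosed_cell s) fun f hf v _ => ⟨hf.1 v, cell_le_one hf v⟩

theorem convex_cell (s : Finset W) : Convex ℝ (cell s) := by
  intro f hf g hg a b ha hb hab
  refine ⟨fun v => ?_, fun v hv => ?_, ?_⟩
  · have := hf.1 v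
    have := hg.1 v
    simp only [Pi.add_apply, Pi.smul_apply, smul_eq_mul]
    positivity
  · simp [hf.2.1 v hv, hg.2.1 v hv]
  · simp [Finset.sum_add_distrib, ← Finset.mul_sum, hf.2.2, hg.2.2, hab]

theorem cell_inter {s t : Finset W} [DecidableEq W] {f : W → ℝ} (hs : f ∈ cell s)
    (ht : f ∈ cell t) : f ∈ cell (s ∩ t) := by
  refine ⟨hs.1, fun v hv => ?_, ?_⟩
  · by_cases h : v ∈ s
    · exact ht.2.1 v fun h' => hv (Finset.mem_inter.2 ⟨h, h'⟩)
    · exact hs.2.1 v h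
  · rw [← hs.2.2]
    refine Finset.sum_subset Finset.inter_subset_left fun x hx hx' => ht.2.1 x fun h => ?_
    exact hx' (Finset.mem_inter.2 ⟨hx, h⟩)

theorem single_mem_cell [DecidableEq W] {s : Finset W} {v : W} (hv : v ∈ s) :
    (Pi.single v 1 : W → ℝ) ∈ cell s := by
  refine ⟨fun w => ?_, fun w hw => ?_, ?_⟩
  · by_cases h : w = v
    · subst h; simp
    · simp [Pi.single_eq_of_ne h]
  · refine Pi.single_eq_of_ne (fun h => hw ?_) _
    rw [h]; exact hv
  · simp [hv]

theorem isCompact_realization {C : ASC W} (hC : C.faces.Finite) : IsCompact (realization C) := by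
  rw [realization_eq]
  exact hC.isCompact_biUnion fun s _ => isCompact_cell s

end Cells

/-! ### Top cochains of a contractible complex are coboundaries -/

theorem Antisym.dl_eq_zero_of_face {U : Type} {C : ASC U} {d : ℕ} (hC : ∀ s ∈ C.faces, s.card ≤ d + 1)
    {G : List U → ℤ} (hG : Antisym G) {s : Finset U} (hs : s ∈ C.faces) {l : List U}
    (hl : l.length = d + 2) (h : ∀ x ∈ l, x ∈ s) : _root_.dl G l = 0 := by
  classical
  refine hG.dl.eq_zero fun hn => ?_
  have h1 : l.toFinset ⊆ s := fun x hx => h x (List.mem_toFinset.1 hx)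
  have h2 := Finset.card_le_card h1
  rw [List.toFinset_card_of_nodup hn] at h2
  have := hC s hs
  omega

section ContractibleCochains
variable {U : Type} [Fintype U]

/-- A vertex of maximal barycentric coordinate. -/
noncomputable def topVertex [Nonempty U] (x : U → ℝ) : U := (Finite.exists_max x).choose

theorem inv_card_le_topVertex [Nonempty U] {s : Finset U} {x : U → ℝ} (hx : x ∈ cell s) :
    (Fintype.card U : ℝ)⁻¹ ≤ x (topVertex x) := by
  have h := (Finite.exists_max x).choose_spec
  have hx' := cell_mono (Finset.subset_univ s) hx
  have h1 : ∑ v, x v ≤ ∑ _v : U, x (topVertex x) := Finset.sum_le_sum fun v _ => h v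
  rw [hx'.2.2, Finset.sum_const, nsmul_eq_mul, Finset.card_univ] at h1
  have : (0 : ℝ) < Fintype.card U := by exact_mod_cast Fintype.card_pos
  rwa [inv_le_iff_one_le_mul₀' this]

theorem topVertex_mem [Nonempty U] {s : Finset U} {x : U → ℝ} (hx : x ∈ cell s) :
    topVertex x ∈ s := by
  by_contra h
  have h1 := inv_card_le_topVertex hx
  rw [hx.2.1 _ h] at h1
  have : (0 : ℝ) < Fintype.card U := by exact_mod_cast Fintype.card_pos
  have := inv_pos.2 this
  linarith

theorem dist_le_one_of_mem_cell {s : Finset U} {x y : U → ℝ} (hx : x ∈ cell s) (hy : y ∈ cell s) :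
    dist x y ≤ 1 := by
  rw [dist_pi_le_iff zero_le_one]
  intro v
  rw [Real.dist_eq, abs_le]
  have := cell_le_one hx v
  have := cell_le_one hy v
  have := hx.1 v
  have := hy.1 v
  constructor <;> linarith

open Classical in
/-- A top cochain of a finite contractible complex is a coboundary. -/
theorem exists_dl_eq_of_contractible [Nonempty U] {C : ASC U} {d : ℕ} (hd : 1 ≤ d)
    (hC : ∀ s ∈ C.faces, s.card ≤ d + 1) (hcon : ContractibleSpace (realization C))
    {G : List U → ℤ} (hG : Antisym G) :
    ∃ h : List U → ℤ, ∀ l : List U, l.length = d + 1 → l.toFinset ∈ C.faces → G l = dl h l := by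
  have : CompactSpace (realization C) :=
    isCompact_iff_compactSpace.1 (isCompact_realization (Set.toFinite _))
  obtain ⟨y₀, ⟨H⟩⟩ := id_nullhomotopic (realization C)
  have hU : (0 : ℝ) < (Fintype.card U : ℝ)⁻¹ := by
    have : (0 : ℝ) < Fintype.card U := by exact_mod_cast Fintype.card_pos
    positivity
  obtain ⟨δ, hδ, hunif⟩ := Metric.uniformContinuous_iff.1
    (CompactSpace.uniformContinuous_of_continuous H.continuous) _ hU
  let P : unitInterval → (U → ℝ) → U := fun t x =>
    if hx : x ∈ realization C then topVertex (H (t, ⟨x, hx⟩) : U → ℝ) else topVertex x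
  have hP : ∀ t x (hx : x ∈ realization C), P t x = topVertex (H (t, ⟨x, hx⟩) : U → ℝ) :=
    fun t x hx => by simp [P, hx]
  have hP0 : ∀ x, x ∈ realization C → P 0 x = topVertex x := fun x hx => by
    rw [hP 0 x hx, H.apply_zero]; rfl
  have hP1 : ∀ x, x ∈ realization C → P 1 x = topVertex (y₀ : U → ℝ) := fun x hx => by
    rw [hP 1 x hx, H.apply_one]; rfl
  have key : ∀ t t' : unitInterval, dist t t' < δ → ∀ u : List (U → ℝ), u.length = d + 1 →
      (∀ x ∈ u, x ∈ realization C) → (∀ x ∈ u, ∀ y ∈ u, dist x y < δ) →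
      G (u.map (P t')) - G (u.map (P t)) = dl (prism (P t) (P t') G) u := by
    intro t t' htt u hu huC huδ
    rw [← prism_dl, add_eq_right]
    obtain ⟨x₀, hx₀⟩ := List.exists_mem_of_length_pos (l := u) (by omega)
    obtain ⟨s, hs, hz⟩ := (H (t, ⟨x₀, huC _ hx₀⟩)).2
    have aux : ∀ t'' : unitInterval, dist t t'' < δ → ∀ x ∈ u, P t'' x ∈ s := by
      intro t'' ht'' x hx
      by_contra hns
      have h1 := @hunif (t, ⟨x₀, huC _ hx₀⟩) (t'', ⟨x, huC _ hx⟩) (by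
        rw [Prod.dist_eq]
        exact max_lt ht'' (huδ _ hx₀ _ hx))
      rw [hP _ _ (huC x hx)] at hns
      obtain ⟨s', _, hs'⟩ := (H (t'', ⟨x, huC x hx⟩)).2
      have h2 := inv_card_le_topVertex hs'
      have h3 := (dist_le_pi_dist (H (t, ⟨x₀, huC _ hx₀⟩) : U → ℝ) (H (t'', ⟨x, huC x hx⟩) : U → ℝ)
        (topVertex (H (t'', ⟨x, huC x hx⟩) : U → ℝ))).trans_lt h1
      rw [hz.2.1 _ hns, Real.dist_eq, zero_sub, abs_neg] at h3
      exact (h3.trans_le (h2.trans (le_abs_self _))).false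
    refine prism_eq_zero _ _ fun v hv hvu => hG.dl_eq_zero_of_face hC hs (by omega) fun y hy => ?_
    obtain ⟨x, hx, rfl | rfl⟩ := hvu y hy
    · exact aux t (by simpa using hδ) x hx
    · exact aux t' htt x hx
  obtain ⟨M, hM⟩ := exists_nat_gt δ⁻¹
  have hM0 : (0 : ℝ) < M := (inv_pos.2 hδ).trans hM
  let τ : ℕ → unitInterval := fun j => Set.projIcc 0 1 zero_le_one (j / M : ℝ)
  have hτ : ∀ j, dist (τ j) (τ (j + 1)) < δ := by
    intro j
    refine ((LipschitzWith.projIcc (zero_le_one : (0 : ℝ) ≤ 1)).dist_le_mul _ _).trans_lt ?_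
    rw [Real.dist_eq, NNReal.coe_one, one_mul, ← sub_div, abs_div]
    have : |(j : ℝ) - ((j + 1 : ℕ) : ℝ)| = 1 := by push_cast; simp
    rw [this, abs_of_pos hM0, one_div]
    exact inv_lt_of_inv_lt₀ hδ hM
  have hτ0 : τ 0 = 0 := by simp [τ]
  have hτM : τ M = 1 := by simp [τ, div_self hM0.ne']
  let B : List (U → ℝ) → ℤ := fun u => -∑ j ∈ Finset.range M, prism (P (τ j)) (P (τ (j + 1))) G u
  have hB : ∀ u : List (U → ℝ), u.length = d + 1 →
      (∀ x ∈ u, x ∈ realization C) → (∀ x ∈ u, ∀ y ∈ u, dist x y < δ) →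
      G (u.map topVertex) = dl B u := by
    intro u hu huC huδ
    have h1 : dl B u = -∑ j ∈ Finset.range M, (G (u.map (P (τ (j + 1)))) - G (u.map (P (τ j)))) := by
      simp only [B]
      rw [dl_neg, dl_sum]
      congr 1
      exact Finset.sum_congr rfl fun j _ => (key _ _ (hτ j) u hu huC huδ).symm
    rw [h1, Finset.sum_range_sub (fun j => G (u.map (P (τ j)))), hτ0, hτM]
    have h2 : u.map (P 0) = u.map topVertex := List.map_congr_left fun x hx => hP0 x (huC x hx)
    have h3 : G (u.map (P 1)) = 0 := by
      refine hG.eq_zero ?_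
      rw [List.map_congr_left fun x hx => hP1 x (huC x hx)]
      rcases u with _ | ⟨a, _ | ⟨b, u⟩⟩
      · simp at hu
      · simp at hu; omega
      · simp
    rw [h2, h3]; ring
  obtain ⟨k, hk⟩ := exists_pow_lt_of_lt_one hδ
    (show (1 - ((d + 1 : ℕ) : ℝ)⁻¹) < 1 by rw [sub_lt_self_iff]; positivity)
  let e : U → U → ℝ := fun u => Pi.single u 1
  let T : (List U → ℤ) → List U → ℤ := fun G l => sd^[k] (fun u => G (u.map topVertex)) (l.map e)
  have hecell : ∀ l : List U, ∀ x ∈ l.map e, x ∈ cell l.toFinset := by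
    intro l x hx
    obtain ⟨v, hv, rfl⟩ := List.mem_map.1 hx
    exact single_mem_cell (List.mem_toFinset.2 hv)
  have hTsub : ∀ G G' l, T (fun u => G u - G' u) l = T G l - T G' l := by
    intro G G' l
    simp only [T]
    rw [sd_iterate_sub]
  have hTdl : ∀ G l, T (dl G) l = dl (T G) l := by
    intro G l
    simp only [T]
    rw [dl_map (sd^[k] fun u => G (u.map topVertex)) e, ← sd_iterate_dl]
    have : (fun u => dl G (u.map topVertex)) = dl fun u : List (U → ℝ) => G (u.map topVertex) :=
      funext fun u => (dl_map _ _ _).symm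
    rw [this]
  have hTnil : ∀ G, T G [] = G [] := by
    intro G
    have : ∀ k (G : List (U → ℝ) → ℤ), sd^[k] G [] = G [] := by
      intro k
      induction k with
      | zero => intro G; rfl
      | succ k ih => intro G; rw [Function.iterate_succ_apply, ih]; rfl
    exact this _ _
  have hTcongr : ∀ G G' l, (∀ u : List U, u.length = l.length → u ⊆ l → G u = G' u) →
      T G l = T G' l := by
    intro G G' l h
    refine sd_iterate_congr (convex_cell l.toFinset) le_rfl (hecell l)
      (fun x hx y hy => dist_le_one_of_mem_cell (hecell l x hx) (hecell l y hy)) fun u hu huK _ => ?_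
    refine h _ (by simpa using hu) fun v hv => ?_
    obtain ⟨x, hx, rfl⟩ := List.mem_map.1 hv
    exact List.mem_toFinset.1 (topVertex_mem (huK x hx))
  have hTzero : ∀ l, T (fun _ => 0) l = 0 := fun l => by
    have := hTsub (fun _ => 0) (fun _ => 0) l
    simpa using this
  refine ⟨fun u => sd^[k] B (u.map e) + coneHtpy T d G u, fun l hl hlC => ?_⟩
  have h1 := coneHtpy_dl hTsub hTdl hTnil (d + 1) G l hl
  have h2 : coneHtpy T (d + 1) (dl G) l = 0 :=
    coneHtpy_eq_zero hTzero hTcongr _ _ _ hl fun u hu hul =>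
      hG.dl_eq_zero_of_face hC hlC (by omega) fun x hx => List.mem_toFinset.2 (hul hx)
  have h3 : T G l = dl (fun u => sd^[k] B (u.map e)) l := by
    rw [dl_map (sd^[k] B) e, ← sd_iterate_dl]
    refine sd_iterate_congr (N := d + 1) (convex_cell l.toFinset) (by simp [hl]) (hecell l)
      (fun x hx y hy => dist_le_one_of_mem_cell (hecell l x hx) (hecell l y hy)) fun u hu huK huD => ?_
    refine hB u (by simpa [hl] using hu) (fun x hx => ⟨_, hlC, huK x hx⟩) fun x hx y hy => ?_
    exact (huD x hx y hy).trans_lt (by simpa using hk)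
  rw [dl_add]
  simp only [Nat.add_sub_cancel] at h1
  linarith

end ContractibleCochains

/-! ### Restriction to the vertices of a finite complex -/

section Restriction
variable {W : Type}

/-- The complex induced on a set of vertices. -/
def ASC.restrict (C : ASC W) (S : Finset W) : ASC {w // w ∈ S} where
  faces := {s | s.map (Function.Embedding.subtype _) ∈ C.faces}
  nonempty_of_mem := fun s hs => by simpa using C.nonempty_of_mem hs
  down_closed := fun s t hs hts ht =>
    C.down_closed hs (Finset.map_subset_map.2 hts) (by simpa using ht)

theorem cell_restrict {S : Finset W} {s : Finset {w // w ∈ S}} {x : W → ℝ}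
    (hx : x ∈ cell (s.map (Function.Embedding.subtype _))) :
    (fun w : {w // w ∈ S} => x w) ∈ cell s := by
  refine ⟨fun v => hx.1 v, fun v hv => hx.2.1 v (by simpa using hv), ?_⟩
  have := hx.2.2
  rwa [Finset.sum_map] at this

open Classical in
theorem cell_extend {S : Finset W} {s : Finset {w // w ∈ S}} {x : {w // w ∈ S} → ℝ}
    (hx : x ∈ cell s) :
    (fun w => if h : w ∈ S then x ⟨w, h⟩ else 0) ∈ cell (s.map (Function.Embedding.subtype _)) := by
  refine ⟨fun v => ?_, fun v hv => ?_, ?_⟩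
  · beta_reduce
    split_ifs with h
    · exact hx.1 _
    · exact le_rfl
  · beta_reduce
    split_ifs with h
    · exact hx.2.1 _ (by simpa [h] using hv)
    · rfl
  · rw [Finset.sum_map, ← hx.2.2]
    exact Finset.sum_congr rfl fun v _ => by simp

open Classical in
/-- Realization is unchanged when discarding vertices not in any face. -/
noncomputable def restrictHomeo (C : ASC W) (S : Finset W) (hS : ∀ s ∈ C.faces, s ⊆ S) :
    realization (C.restrict S) ≃ₜ realization C where
  toFun x := ⟨fun w => if h : w ∈ S then x.1 ⟨w, h⟩ else 0, by
    obtain ⟨s, hs, hx⟩ := x.2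
    exact ⟨_, hs, cell_extend hx⟩⟩
  invFun x := ⟨fun w => x.1 w, by
    obtain ⟨s, hs, hx⟩ := x.2
    have : (s.subtype (· ∈ S)).map (Function.Embedding.subtype _) = s := by
      rw [Finset.subtype_map]
      exact Finset.filter_true_of_mem fun w hw => hS s hs hw
    refine ⟨s.subtype (· ∈ S), ?_, cell_restrict ?_⟩
    · change _ ∈ C.faces
      rwa [this]
    · rwa [this]⟩
  left_inv x := by ext w; simp
  right_inv x := by
    obtain ⟨x, s, hs, hx⟩ := x
    ext w
    by_cases h : w ∈ S
    · simp [h]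
    · simpa [h] using (hx.2.1 w fun h' => h (hS s hs h')).symm
  continuous_toFun := by
    refine Continuous.subtype_mk (continuous_pi fun w => ?_) _
    by_cases h : w ∈ S
    · simp only [h, dite_true]
      exact (continuous_apply _).comp continuous_subtype_val
    · simpa [h] using continuous_const
  continuous_invFun := by
    refine Continuous.subtype_mk (continuous_pi fun w => ?_) _
    exact (continuous_apply _).comp continuous_subtype_val

end Restriction

/-! ### Alternating extension of ordered cochains -/

section Alternating
variable {V : Type} [LinearOrder V]

/-- The sign of a list, vanishing when it has repetitions. -/
def listSign : List V → ℤ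
  | [] => 1
  | x :: l => (l.map fun y => if x < y then 1 else if y < x then -1 else 0).prod * listSign l

theorem antisym_listSign_mul (g : Finset V → ℤ) :
    Antisym fun l : List V => listSign l * g l.toFinset := by
  have h : Antisym (listSign (V := V)) := by
    intro l₁
    induction l₁ with
    | nil =>
      intro x y l
      simp only [List.nil_append, listSign, List.map_cons, List.prod_cons]
      rcases lt_trichotomy x y with h | rfl | h
      · simp [h, h.asymm]; ring
      · simp
      · simp [h, h.asymm]; ring
    | cons z l₁ ih =>
      intro x y l
      simp only [List.cons_append, listSign, ih x y l]
      have := ((List.Perm.swap y x l).append_left l₁).map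
        (fun y => if z < y then (1 : ℤ) else if y < z then -1 else 0)
      rw [this.prod_eq]; ring
  intro l₁ x y l₂
  have : (l₁ ++ x :: y :: l₂).toFinset = (l₁ ++ y :: x :: l₂).toFinset := by
    ext a; simp; tauto
  simp only [this, h l₁ x y l₂]; ring

theorem listSign_of_pairwise {l : List V} (hl : l.Pairwise (· < ·)) : listSign l = 1 := by
  induction l with
  | nil => rfl
  | cons x l ih =>
    rw [List.pairwise_cons] at hl
    rw [listSign, ih hl.2, mul_one]
    refine List.prod_eq_one fun a ha => ?_
    obtain ⟨y, hy, rfl⟩ := List.mem_map.1 ha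
    simp [hl.1 y hy]

theorem dl_of_pairwise (F : List V → ℤ) {l : List V} (hl : l.Pairwise (· < ·)) :
    dl F l = ∑ v ∈ l.toFinset, (-1) ^ (l.toFinset.filter (· < v)).card *
      F ((l.toFinset.erase v).sort (· ≤ ·)) := by
  induction l generalizing F with
  | nil => simp
  | cons x l ih =>
    rw [List.pairwise_cons] at hl
    have hx : x ∉ l.toFinset := fun h => (hl.1 x (List.mem_toFinset.1 h)).false
    have hsort : ∀ {m : List V}, m.Pairwise (· < ·) → m.toFinset.sort (· ≤ ·) = m := by
      intro m hm
      refine List.Perm.eq_of_pairwise (le := (· ≤ ·)) (fun a b _ _ h h' => le_antisymm h h')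
        (Finset.pairwise_sort _ _) (hm.imp le_of_lt) ?_
      rw [List.perm_ext_iff_of_nodup (Finset.sort_nodup _ _) (hm.imp fun h => h.ne)]
      simp
    rw [dl_cons, ih _ hl.2, List.toFinset_cons, Finset.sum_insert hx, Finset.erase_insert hx,
      hsort hl.2]
    have h0 : (insert x l.toFinset).filter (· < x) = ∅ := by
      refine Finset.filter_eq_empty_iff.2 fun a ha => ?_
      rcases Finset.mem_insert.1 ha with rfl | ha
      · exact lt_irrefl _
      · exact (hl.1 a (List.mem_toFinset.1 ha)).asymm
    rw [h0, Finset.card_empty, pow_zero, one_mul, sub_eq_add_neg, ← Finset.sum_neg_distrib]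
    congr 1
    refine Finset.sum_congr rfl fun v hv => ?_
    have hxv := hl.1 v (List.mem_toFinset.1 hv)
    have h1 : (insert x l.toFinset).filter (· < v) = insert x (l.toFinset.filter (· < v)) := by
      rw [Finset.filter_insert, if_pos hxv]
    have h2 : (insert x l.toFinset).erase v = insert x (l.toFinset.erase v) := by
      rw [Finset.erase_insert_of_ne hxv.ne]
    have h3 : (insert x (l.toFinset.erase v)).sort (· ≤ ·) =
        x :: (l.toFinset.erase v).sort (· ≤ ·) := by
      refine Finset.sort_insert _ (fun b hb => ?_) (fun h => hx (Finset.mem_of_mem_erase h))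
      exact (hl.1 b (List.mem_toFinset.1 (Finset.mem_of_mem_erase hb))).le
    rw [h1, h2, h3, Finset.card_insert_of_notMem (fun h => hx (Finset.mem_of_mem_filter _ h)),
      pow_succ]
    ring

end Alternating

open Classical in
/-- Top cohomology vanishes for subcomplexes of contractible complexes of the same dimension. -/
theorem topCohomVanishes_of_embedsInContractible {V : Type} [LinearOrder V] {K : ASC V} {d : ℕ}
    (hd : d ≠ 0) (hne : K.faces.Nonempty) (h : EmbedsInContractible K d) :
    topCohomVanishes K d := by
  obtain ⟨W, C, f, hcard, hfin, hcon, hf⟩ := h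
  rw [topCohomVanishes, if_neg hd]
  intro g
  let S : Finset W := hfin.toFinset.biUnion id
  have hS : ∀ s ∈ C.faces, s ⊆ S := fun s hs =>
    Finset.subset_biUnion_of_mem id (hfin.mem_toFinset.2 hs)
  have hSf : ∀ s ∈ K.faces, ∀ v ∈ s, f v ∈ S := fun s hs v hv =>
    hS _ (hf s hs) (Finset.mem_map_of_mem f hv)
  obtain ⟨s₀, hs₀⟩ := hne
  obtain ⟨v₀, hv₀⟩ := K.nonempty_of_mem hs₀
  have : Nonempty V := ⟨v₀⟩
  let i : V → {w // w ∈ S} := fun v => if h : f v ∈ S then ⟨f v, h⟩ else ⟨f v₀, hSf _ hs₀ _ hv₀⟩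
  have hi : ∀ v, f v ∈ S → (i v : W) = f v := fun v hv => by simp [i, hv]
  let e : {w // w ∈ S} → V := fun w => Function.invFun f w
  have hei : ∀ v, f v ∈ S → e (i v) = v := fun v hv => by
    simp only [e, hi v hv]
    exact Function.leftInverse_invFun f.injective v
  have : Nonempty {w // w ∈ S} := ⟨i v₀⟩
  let g' : Finset V → ℤ := fun s => if h : s ∈ K.faces ∧ s.card = d + 1 then g ⟨s, h⟩ else 0
  let G : List {w // w ∈ S} → ℤ := fun l => listSign (l.map e) * g' (l.map e).toFinset
  have hG : Antisym G := by
    intro l₁ x y l₂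
    simp only [G, List.map_append, List.map_cons]
    exact antisym_listSign_mul g' _ _ _ _
  obtain ⟨h, hh⟩ := exists_dl_eq_of_contractible (C := C.restrict S) (Nat.one_le_iff_ne_zero.2 hd)
    (fun s hs => by simpa using hcard _ hs) ((restrictHomeo C S hS).contractibleSpace) hG
  refine ⟨fun s => h ((s.1.sort (· ≤ ·)).map i), fun t => ?_⟩
  obtain ⟨t, htK, htc⟩ := t
  set m := t.sort (· ≤ ·) with hm
  have hmt : m.toFinset = t := Finset.sort_toFinset _ _
  have hmS : ∀ v ∈ m, f v ∈ S := fun v hv => hSf t htK v (by rwa [← hmt, List.mem_toFinset])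
  have hmm : (m.map i).map e = m := by
    rw [List.map_map]
    conv_rhs => rw [← List.map_id m]
    exact List.map_congr_left fun v hv => hei v (hmS v hv)
  have hmp : m.Pairwise (· < ·) := (Finset.sortedLT_sort t).pairwise
  have h1 := hh (m.map i) (by simp [hm, htc]) (by
    change _ ∈ C.faces
    convert! hf t htK using 1
    ext w
    simp only [Finset.mem_map, List.mem_toFinset, List.mem_map, Function.Embedding.subtype_apply]
    constructor
    · rintro ⟨_, ⟨v, hv, rfl⟩, rfl⟩
      exact ⟨v, by rwa [← hmt, List.mem_toFinset], (hi v (hmS v hv)).symm⟩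
    · rintro ⟨v, hv, rfl⟩
      rw [← hmt, List.mem_toFinset] at hv
      exact ⟨_, ⟨v, hv, rfl⟩, hi v (hmS v hv)⟩)
  have h2 : G (m.map i) = g ⟨t, htK, htc⟩ := by
    simp only [G, hmm, listSign_of_pairwise hmp, hmt, one_mul, g']
    rw [dif_pos ⟨htK, htc⟩]
  rw [← h2, h1, ← dl_map, dl_of_pairwise _ hmp, hmt, coboundary, ← Finset.sum_attach]
  refine Finset.sum_congr rfl fun v _ => ?_
  have hv := v.2
  have hc : (t.erase v.1).card = d := by rw [Finset.card_erase_of_mem v.2, htc]; simp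
  have hne' : (t.erase v.1).Nonempty := by
    rw [← Finset.card_pos, hc]; omega
  rw [dif_pos ⟨K.down_closed htK (Finset.erase_subset _ _) hne', hc⟩]

/-! ### Total cochains -/

section Cob
variable {W : Type} [LinearOrder W] {π : Type*} [AddCommGroup π]

/-- The coboundary of a totally defined cochain. -/
def cob (a : Finset W → π) (τ : Finset W) : π :=
  ∑ v ∈ τ, (-1 : ℤ) ^ (τ.filter (· < v)).card • a (τ.erase v)

theorem cob_congr {a b : Finset W → π} {τ : Finset W} (h : ∀ v ∈ τ, a (τ.erase v) = b (τ.erase v)) :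
    cob a τ = cob b τ :=
  Finset.sum_congr rfl fun v hv => by rw [h v hv]

theorem cob_add (a b : Finset W → π) (τ : Finset W) :
    cob (fun s => a s + b s) τ = cob a τ + cob b τ := by
  simp [cob, Finset.sum_add_distrib]

theorem cob_sub (a b : Finset W → π) (τ : Finset W) :
    cob (fun s => a s - b s) τ = cob a τ - cob b τ := by
  simp [cob, smul_sub]

theorem cob_zero (τ : Finset W) : cob (fun _ => (0 : π)) τ = 0 := by simp [cob]

theorem exists_cob_of_topCohomVanishes {K : ASC W} {d : ℕ} (hd : d ≠ 0)
    (h : topCohomVanishes K d) (g : Finset W → ℤ) :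
    ∃ a : Finset W → ℤ, ∀ τ ∈ K.faces, τ.card = d + 1 → cob a τ = g τ := by
  classical
  rw [topCohomVanishes, if_neg hd] at h
  obtain ⟨f, hf⟩ := h fun t => g t.1
  refine ⟨fun s => if h : s ∈ K.faces ∧ s.card = d then f ⟨s, h⟩ else 0, fun τ hτ hc => ?_⟩
  have := hf ⟨τ, hτ, hc⟩
  simp only at this
  rw [this, coboundary, cob, ← Finset.sum_attach]
  refine Finset.sum_congr rfl fun v _ => ?_
  rw [smul_eq_mul]

end Cob

/-! ### Connected complexes and low dimensions -/

section Connected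
variable {V : Type}

/-- The finite set of vertices of a finite complex. -/
noncomputable def ASC.verts (K : ASC V) (hfin : K.faces.Finite) : Finset V := by
  classical exact hfin.toFinset.biUnion id

theorem ASC.mem_verts {K : ASC V} {hfin : K.faces.Finite} {v : V} :
    v ∈ K.verts hfin ↔ ∃ s ∈ K.faces, v ∈ s := by
  simp [ASC.verts]

theorem ASC.singleton_mem {K : ASC V} {s : Finset V} (hs : s ∈ K.faces) {v : V} (hv : v ∈ s) :
    {v} ∈ K.faces :=
  K.down_closed hs (Finset.singleton_subset_iff.2 hv) (Finset.singleton_nonempty v)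

open Classical in
theorem ASC.mem_iff_of_connected {K : ASC V} (hfin : K.faces.Finite)
    (hconn : ConnectedSpace (realization K)) (A : Set V)
    (hA : ∀ s ∈ K.faces, (∀ v ∈ s, v ∈ A) ∨ ∀ v ∈ s, v ∉ A)
    {s t : Finset V} (hs : s ∈ K.faces) (ht : t ∈ K.faces) {v w : V} (hv : v ∈ s) (hw : w ∈ t)
    (hvA : v ∈ A) : w ∈ A := by
  let g : realization K → ℝ := fun x => ∑ v ∈ (K.verts hfin).filter (· ∈ A), x.1 v
  have hg : Continuous g := continuous_finsetSum _ fun v _ =>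
    (continuous_apply v).comp continuous_subtype_val
  have hsub : ∀ s ∈ K.faces, s ⊆ K.verts hfin := fun s hs v hv => ASC.mem_verts.2 ⟨s, hs, hv⟩
  have h1 : ∀ x : realization K, ∀ s ∈ K.faces, x.1 ∈ cell s → (∀ v ∈ s, v ∈ A) → g x = 1 := by
    intro x s hs hx h
    rw [← hx.2.2]
    refine (Finset.sum_subset (fun v hv => ?_) fun v _ hv => hx.2.1 v hv).symm
    exact Finset.mem_filter.2 ⟨hsub s hs hv, h v hv⟩
  have h0 : ∀ x : realization K, ∀ s ∈ K.faces, x.1 ∈ cell s → (∀ v ∈ s, v ∉ A) → g x = 0 := by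
    intro x s hs hx h
    refine Finset.sum_eq_zero fun v hv => hx.2.1 v fun hvs => ?_
    exact h v hvs (Finset.mem_filter.1 hv).2
  have h01 : ∀ x, g x = 0 ∨ g x = 1 := by
    intro x
    obtain ⟨s, hs, hx⟩ := x.2
    rcases hA s hs with h | h
    · exact Or.inr (h1 x s hs hx h)
    · exact Or.inl (h0 x s hs hx h)
  have hclopen : IsClopen {x | g x = 1} := by
    refine ⟨isClosed_eq hg continuous_const, ?_⟩
    have : {x | g x = 1} = {x | 1 / 2 < g x} := by
      ext x
      rcases h01 x with h | h <;> simp only [Set.mem_ofPred_eq, h] <;> norm_num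
    rw [this]
    exact isOpen_lt continuous_const hg
  let p : ∀ {s : Finset V}, s ∈ K.faces → ∀ v ∈ s, realization K := fun hs v hv =>
    ⟨Pi.single v 1, _, K.singleton_mem hs hv, single_mem_cell (Finset.mem_singleton_self v)⟩
  have hpv : p hs v hv ∈ {x | g x = 1} :=
    h1 _ _ (K.singleton_mem hs hv) (single_mem_cell (Finset.mem_singleton_self v)) (by simpa using hvA)
  have huniv := hclopen.eq_univ ⟨_, hpv⟩
  by_contra hwA
  have hpw : p ht w hw ∈ {x | g x = 1} := by rw [huniv]; trivial
  have := h0 (p ht w hw) _ (K.singleton_mem ht hw) (single_mem_cell (Finset.mem_singleton_self w))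
    (by simpa using hwA)
  rw [Set.mem_ofPred_eq, this] at hpw
  exact zero_ne_one hpw

theorem contractible_of_faces_eq {K : ASC V} {v : V} (h : K.faces = {{v}}) :
    ContractibleSpace (realization K) := by
  classical
  have : Unique (realization K) :=
    { default := ⟨Pi.single v 1, {v}, by rw [h]; rfl, single_mem_cell (Finset.mem_singleton_self v)⟩
      uniq := by
        rintro ⟨x, s, hs, hx⟩
        rw [h] at hs
        obtain rfl : s = {v} := hs
        ext w
        by_cases hw : w = v
        · subst hw
          simpa using hx.2.2
        · simpa [hw] using hx.2.1 w (by simpa using hw) }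
  infer_instance

theorem ASC.faces_eq_of_isolated {K : ASC V} (hfin : K.faces.Finite)
    (hconn : ConnectedSpace (realization K)) {v : V} (hv : {v} ∈ K.faces)
    (h : ∀ s ∈ K.faces, v ∈ s → s = {v}) : K.faces = {{v}} := by
  ext s
  refine ⟨fun hs => ?_, fun hs => by rw [Set.mem_singleton_iff.1 hs]; exact hv⟩
  obtain ⟨w, hw⟩ := K.nonempty_of_mem hs
  have := ASC.mem_iff_of_connected hfin hconn {v} (fun t ht => by
    by_cases hvt : v ∈ t
    · left; rw [h t ht hvt]; simp
    · right
      rintro w hw rfl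
      exact hvt hw) hv hs (Finset.mem_singleton_self v) hw rfl
  obtain rfl : w = v := this
  exact h s hs hw

end Connected

/-! ### Collapsing a leaf -/

section Leaf
variable {V : Type}

/-- The complex obtained by deleting a vertex. -/
def ASC.delete (K : ASC V) (v : V) : ASC V where
  faces := {s | s ∈ K.faces ∧ v ∉ s}
  nonempty_of_mem := fun _ h => K.nonempty_of_mem h.1
  down_closed := fun _ _ hs hts ht => ⟨K.down_closed hs.1 hts ht, fun h => hs.2 (hts h)⟩

theorem delete_subset {K : ASC V} {v : V} (x : realization (K.delete v)) : x.1 ∈ realization K := by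
  obtain ⟨s, hs, hx⟩ := x.2
  exact ⟨s, hs.1, hx⟩

variable [DecidableEq V]

/-- Moving the weight of `v` to `u`. -/
def moveWeight (v u : V) (x : V → ℝ) : V → ℝ := fun w =>
  if w = v then 0 else if w = u then x u + x v else x w

theorem continuous_moveWeight (v u : V) : Continuous (moveWeight v u) := by
  refine continuous_pi fun w => ?_
  unfold moveWeight
  split_ifs
  · exact continuous_const
  · exact (continuous_apply u).add (continuous_apply v)
  · exact continuous_apply w

theorem moveWeight_of_eq_zero {v u : V} {x : V → ℝ} (h : x v = 0) : moveWeight v u x = x := by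
  ext w
  unfold moveWeight
  split_ifs with h1 h2
  · rw [h1, h]
  · rw [h2, h, add_zero]
  · rfl

variable {K : ASC V} {v u : V}

theorem moveWeight_mem_cell (huv : u ≠ v) {x : V → ℝ} (hx : x ∈ cell {u, v}) :
    moveWeight v u x ∈ cell {u} := by
  have h1 := hx.2.2
  rw [Finset.sum_pair huv] at h1
  refine ⟨fun w => ?_, fun w hw => ?_, ?_⟩
  · unfold moveWeight
    have := hx.1 u
    have := hx.1 v
    have := hx.1 w
    split_ifs <;> linarith
  · unfold moveWeight
    rw [Finset.mem_singleton] at hw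
    split_ifs with h2
    · rfl
    · exact hx.2.1 w (by simp [hw, h2])
  · simp [moveWeight, huv, h1]

theorem leaf_cases (huv : u ≠ v) (h : ∀ s ∈ K.faces, v ∈ s → s ⊆ {u, v})
    {x : V → ℝ} (hx : x ∈ realization K) :
    (x ∈ realization (K.delete v) ∧ moveWeight v u x = x) ∨
      (x ∈ cell {u, v} ∧ moveWeight v u x ∈ cell {u}) := by
  obtain ⟨s, hs, hx⟩ := hx
  by_cases hvs : v ∈ s
  · right
    have := cell_mono (h s hs hvs) hx
    exact ⟨this, moveWeight_mem_cell huv this⟩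
  · left
    exact ⟨⟨s, ⟨hs, hvs⟩, hx⟩, moveWeight_of_eq_zero (hx.2.1 v hvs)⟩

theorem moveWeight_mem (huv : u ≠ v) (hu : {u, v} ∈ K.faces)
    (h : ∀ s ∈ K.faces, v ∈ s → s ⊆ {u, v}) (x : realization K) :
    moveWeight v u x ∈ realization (K.delete v) := by
  rcases leaf_cases huv h x.2 with h1 | h1
  · rw [h1.2]; exact h1.1
  · exact ⟨{u}, ⟨K.singleton_mem hu (by simp), by simpa using huv.symm⟩, h1.2⟩

theorem moveWeight_segment_mem (huv : u ≠ v) (hu : {u, v} ∈ K.faces)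
    (h : ∀ s ∈ K.faces, v ∈ s → s ⊆ {u, v}) (p : unitInterval × realization K) :
    (1 - (p.1 : ℝ)) • moveWeight v u p.2 + (p.1 : ℝ) • p.2.1 ∈ realization K := by
  rcases leaf_cases huv h p.2.2 with h1 | h1
  · rw [h1.2, ← add_smul, sub_add_cancel, one_smul]; exact p.2.2
  · exact ⟨_, hu, convex_cell _ (cell_mono (by simp) h1.2) h1.1
      (by linarith [p.1.2.2]) p.1.2.1 (by ring)⟩

theorem moveWeight_delete (x : realization (K.delete v)) : moveWeight v u x = x := by
  obtain ⟨s, hs, hx⟩ := x.2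
  exact moveWeight_of_eq_zero (hx.2.1 v hs.2)

/-- Deleting a leaf is a homotopy equivalence. -/
noncomputable def leafEquiv (huv : u ≠ v) (hu : {u, v} ∈ K.faces)
    (h : ∀ s ∈ K.faces, v ∈ s → s ⊆ {u, v}) :
    ContinuousMap.HomotopyEquiv (realization K) (realization (K.delete v)) where
  toFun := ⟨fun x => ⟨moveWeight v u x, moveWeight_mem huv hu h x⟩,
    ((continuous_moveWeight v u).comp continuous_subtype_val).subtype_mk _⟩
  invFun := ⟨fun x => ⟨x.1, delete_subset x⟩, continuous_subtype_val.subtype_mk _⟩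
  left_inv := ⟨{
    toFun := fun p => ⟨_, moveWeight_segment_mem huv hu h p⟩
    continuous_toFun := by
      have h2 : Continuous fun p : unitInterval × realization K => (p.1 : ℝ) := by fun_prop
      have h3 : Continuous fun p : unitInterval × realization K => p.2.1 := by fun_prop
      exact (((continuous_const.sub h2).smul ((continuous_moveWeight v u).comp h3)).add
        (h2.smul h3)).subtype_mk _
    map_zero_left := fun x => by ext; simp
    map_one_left := fun x => by ext; simp }⟩
  right_inv := by
    convert! ContinuousMap.Homotopic.refl (ContinuousMap.id (realization (K.delete v))) using 1
    ext x w
    exact congrFun (moveWeight_delete x) w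

theorem connected_delete (huv : u ≠ v) (hu : {u, v} ∈ K.faces)
    (h : ∀ s ∈ K.faces, v ∈ s → s ⊆ {u, v}) (hconn : ConnectedSpace (realization K)) :
    ConnectedSpace (realization (K.delete v)) := by
  refine Function.Surjective.connectedSpace (f := (leafEquiv huv hu h).toFun) (fun x => ?_)
    (leafEquiv huv hu h).toFun.continuous
  exact ⟨⟨x.1, delete_subset x⟩, Subtype.ext (moveWeight_delete x)⟩

end Leaf

theorem card_edges_lt {E S : Type} [Fintype E] [Fintype S]
    (φ : (S → ℤ) →ₗ[ℤ] E → ℤ) (hφ : Function.Surjective φ) {c : S → ℤ} (hc : c ≠ 0) (h0 : φ c = 0) :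
    Fintype.card E < Fintype.card S := by
  by_contra! hle
  obtain ⟨i⟩ := Function.Embedding.nonempty_of_card_le hle
  let ψ : (E → ℤ) →ₗ[ℤ] S → ℤ := LinearMap.funLeft ℤ ℤ i
  have hψ : Function.Surjective ψ := LinearMap.funLeft_surjective_of_injective ℤ ℤ i i.injective
  have h1 := OrzechProperty.injective_of_surjective_endomorphism (ψ.comp φ) (hψ.comp hφ)
  exact hc (h1 (by simp [h0]))

open Classical in
theorem exists_leaf {V : Type} [LinearOrder V] {K : ASC V} (hfin : K.faces.Finite)
    (hne : K.faces.Nonempty)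
    (hcob : ∀ g : Finset V → ℤ, ∃ a : Finset V → ℤ, ∀ τ ∈ K.faces, τ.card = 2 → cob a τ = g τ) :
    ∃ v, {v} ∈ K.faces ∧ ((K.verts hfin).filter fun u => u ≠ v ∧ {u, v} ∈ K.faces).card ≤ 1 := by
  by_contra! hdeg
  set S := K.verts hfin with hS
  let E := hfin.toFinset.filter fun s => s.card = 2
  let φ : (S → ℤ) →ₗ[ℤ] E → ℤ :=
    { toFun := fun f e => cob (fun s => ∑ v : S, if s = {v.1} then f v else 0) e.1
      map_add' := fun f g => by
        funext e
        rw [Pi.add_apply, ← cob_add]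
        congr 1
        funext s
        rw [← Finset.sum_add_distrib]
        exact Finset.sum_congr rfl fun v _ => by split_ifs <;> rfl
      map_smul' := fun c f => by
        funext e
        change cob (fun s => ∑ v : S, if s = {v.1} then c * f v else 0) e.1 =
          c * cob (fun s => ∑ v : S, if s = {v.1} then f v else 0) e.1
        simp only [cob, smul_eq_mul, Finset.mul_sum]
        refine Finset.sum_congr rfl fun v _ => Finset.sum_congr rfl fun w _ => ?_
        split_ifs <;> ring }
  have hE : ∀ e : E, e.1 ∈ K.faces ∧ e.1.card = 2 := fun e => by
    have := Finset.mem_filter.1 e.2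
    exact ⟨hfin.mem_toFinset.1 this.1, this.2⟩
  have hsingle : ∀ (f : S → ℤ) (w : S), (∑ v : S, if ({w.1} : Finset V) = {v.1} then f v else 0) = f w := by
    intro f w
    simp
  have hφ : ∀ (a : Finset V → ℤ) (e : E), φ (fun v => a {v.1}) e = cob a e.1 := by
    intro a e
    refine Eq.trans (b := cob (fun s => ∑ v : S, if s = {v.1} then a {v.1} else 0) e.1) rfl
      (cob_congr fun v hv => ?_)
    have hc : (e.1.erase v).card = 1 := by rw [Finset.card_erase_of_mem hv, (hE e).2]
    obtain ⟨w, hw⟩ := Finset.card_eq_one.1 hc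
    have hwe : w ∈ e.1 := Finset.mem_of_mem_erase (by rw [hw]; simp : w ∈ e.1.erase v)
    rw [hw]
    exact hsingle _ ⟨w, ASC.mem_verts.2 ⟨_, (hE e).1, hwe⟩⟩
  have hlt := card_edges_lt φ (fun g => by
    obtain ⟨a, ha⟩ := hcob fun s => if h : s ∈ E then g ⟨s, h⟩ else 0
    refine ⟨fun v => a {v.1}, funext fun e => ?_⟩
    rw [hφ, ha _ (hE e).1 (hE e).2]
    simp) (c := fun _ => 1) (by
      obtain ⟨s, hs⟩ := hne
      obtain ⟨v, hv⟩ := K.nonempty_of_mem hs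
      intro h
      exact one_ne_zero (congrFun h ⟨v, ASC.mem_verts.2 ⟨s, hs, hv⟩⟩)) (by
      funext e
      rw [hφ (fun _ => 1)]
      obtain ⟨x, y, hxy, he⟩ := Finset.card_eq_two.1 (hE e).2
      rw [cob, he, Finset.sum_pair hxy]
      rcases hxy.lt_or_gt with h | h
      · simp [Finset.filter_insert, Finset.filter_singleton, h, h.asymm]
      · simp [Finset.filter_insert, Finset.filter_singleton, h, h.asymm])
  rw [Fintype.card_coe, Fintype.card_coe] at hlt
  have hcount := Finset.sum_card_bipartiteAbove_eq_sum_card_bipartiteBelow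
    (s := S) (t := E) (fun v e => v ∈ e)
  have h1 : ∑ e ∈ E, (Finset.bipartiteBelow (fun v e => v ∈ e) S e).card = ∑ e ∈ E, 2 := by
    refine Finset.sum_congr rfl fun e he => ?_
    have he' := hE ⟨e, he⟩
    rw [← he'.2]
    congr 1
    ext v
    simp only [Finset.mem_bipartiteBelow]
    exact ⟨fun h => h.2, fun h => ⟨ASC.mem_verts.2 ⟨_, he'.1, h⟩, h⟩⟩
  have h2 : ∑ v ∈ S, 2 ≤ ∑ v ∈ S, (Finset.bipartiteAbove (fun v e => v ∈ e) E v).card := by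
    refine Finset.sum_le_sum fun v hv => ?_
    obtain ⟨s, hs, hvs⟩ := ASC.mem_verts.1 hv
    refine (Nat.succ_le_of_lt (hdeg v (K.singleton_mem hs hvs))).trans (Finset.card_le_card_of_injOn (fun u => {u, v}) ?_ ?_)
    · intro u hu
      have hu' := (Finset.mem_filter.1 hu).2
      simp [E, hu'.2, Finset.card_pair hu'.1]
    · intro u hu u' hu' huu
      have h3 := (Finset.mem_filter.1 hu).2.1
      have h4 : u ∈ ({u', v} : Finset V) := by rw [← show ({u, v} : Finset V) = {u', v} from huu]; simp
      simpa [h3] using h4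
  simp only [Finset.sum_const, smul_eq_mul] at h1 h2
  omega

theorem contractible_of_graph {V : Type} [LinearOrder V] {K : ASC V} (hfin : K.faces.Finite)
    (hcard : ∀ s ∈ K.faces, s.card ≤ 2) (hconn : ConnectedSpace (realization K))
    (hcob : ∀ g : Finset V → ℤ, ∃ a : Finset V → ℤ, ∀ τ ∈ K.faces, τ.card = 2 → cob a τ = g τ) :
    ContractibleSpace (realization K) := by
  classical
  obtain ⟨n, hn⟩ : ∃ n, K.faces.ncard = n := ⟨_, rfl⟩
  induction n using Nat.strong_induction_on generalizing K with
  | _ n ih =>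
    have hne : K.faces.Nonempty := by
      obtain ⟨x, s, hs, _⟩ := hconn.toNonempty
      exact ⟨s, hs⟩
    obtain ⟨v, hv, hdeg⟩ := exists_leaf hfin hne hcob
    by_cases hiso : ∀ s ∈ K.faces, v ∈ s → s = {v}
    · exact contractible_of_faces_eq (ASC.faces_eq_of_isolated hfin hconn hv hiso)
    push Not at hiso
    have hform : ∀ s ∈ K.faces, v ∈ s → s ≠ {v} → ∃ u, u ≠ v ∧ s = {u, v} := by
      intro s hs hvs hsv
      obtain ⟨u, hu, huv⟩ : ∃ u ∈ s, u ≠ v := by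
        by_contra! hcon
        exact hsv (Finset.eq_singleton_iff_unique_mem.2 ⟨hvs, hcon⟩)
      refine ⟨u, huv, (Finset.eq_of_subset_of_card_le (by simp [Finset.insert_subset_iff, hu, hvs]) ?_).symm⟩
      rw [Finset.card_pair huv]
      exact hcard s hs
    obtain ⟨s, hs, hvs, hsv⟩ := hiso
    obtain ⟨u, huv, rfl⟩ := hform s hs hvs hsv
    have hmemS : ∀ u, {u, v} ∈ K.faces → u ∈ K.verts hfin := fun u hu =>
      ASC.mem_verts.2 ⟨_, hu, by simp⟩
    have hleaf : ∀ s ∈ K.faces, v ∈ s → s ⊆ {u, v} := by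
      intro s hs' hvs'
      by_cases hsv' : s = {v}
      · simp [hsv']
      obtain ⟨u', hu'v, rfl⟩ := hform s hs' hvs' hsv'
      have : u = u' := Finset.card_le_one.1 hdeg u
        (Finset.mem_filter.2 ⟨hmemS u hs, huv, hs⟩) u' (Finset.mem_filter.2 ⟨hmemS u' hs', hu'v, hs'⟩)
      rw [this]
    have hsub : (K.delete v).faces ⊆ K.faces := fun s hs => hs.1
    have := ih (K.delete v).faces.ncard (by
        rw [← hn]
        exact Set.ncard_lt_ncard ⟨hsub, fun h => (h hv).2 (by simp)⟩ hfin)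
      (hfin.subset hsub) (fun s hs => hcard s hs.1) (connected_delete huv hs hleaf hconn)
      (fun g => by
        obtain ⟨a, ha⟩ := hcob g
        exact ⟨a, fun τ hτ => ha τ hτ.1⟩) rfl
    exact (leafEquiv huv hs hleaf).contractibleSpace

theorem embeds_and_topCohomVanishes_of_dim_zero {V : Type} [LinearOrder V] (K : ASC V)
    (hfin : K.faces.Finite) (hconn : ConnectedSpace (realization K))
    (hdim : ∀ s ∈ K.faces, s.card ≤ 1) :
    EmbedsInContractible K 0 ∧ topCohomVanishes K 0 := by
  obtain ⟨x, s, hs, _⟩ := hconn.toNonempty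
  obtain ⟨v, hv⟩ := K.nonempty_of_mem hs
  have h := ASC.faces_eq_of_isolated hfin hconn (K.singleton_mem hs hv) (fun t ht hvt =>
    (Finset.eq_of_subset_of_card_le (Finset.singleton_subset_iff.2 hvt) (by simpa using hdim t ht)).symm)
  refine ⟨⟨V, K, Function.Embedding.refl V, hdim, hfin, contractible_of_faces_eq h, fun s hs => by simpa using hs⟩, ?_⟩
  rw [topCohomVanishes, if_pos rfl]
  refine fun g => ⟨g ⟨{v}, K.singleton_mem hs hv, by simp⟩, fun t => ?_⟩
  congr
  obtain ⟨t, ht, _⟩ := t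
  rw [h] at ht
  exact Subtype.ext ht

theorem embeds_of_dim_one {V : Type} [LinearOrder V] (K : ASC V)
    (hfin : K.faces.Finite) (hconn : ConnectedSpace (realization K))
    (hdim : ∀ s ∈ K.faces, s.card ≤ 2) (h : topCohomVanishes K 1) : EmbedsInContractible K 1 :=
  ⟨V, K, Function.Embedding.refl V, hdim, hfin,
    contractible_of_graph hfin hdim hconn (exists_cob_of_topCohomVanishes one_ne_zero h),
    fun s hs => by simpa using hs⟩

/-! ### Quaternary Kan relations -/

/-- A quaternary relation with fillers and degeneracies, closed under completing pentads. -/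
structure QuatKan {S : Type} (o : S) (Q : S → S → S → S → Prop) : Prop where
  fill₀ : ∀ b c d, ∃ a, Q a b c d
  fill₁ : ∀ a c d, ∃ b, Q a b c d
  fill₂ : ∀ a b d, ∃ c, Q a b c d
  fill₃ : ∀ a b c, ∃ d, Q a b c d
  degen₀ : ∀ a, Q a a o o
  degen₁ : ∀ a, Q o a a o
  degen₂ : ∀ a, Q o o a a
  tri₀ : ∀ {x01 x02 x03 x04 x12 x13 x14 x23 x24 x34},
    Q x01 x12 x13 x14 → Q x02 x12 x23 x24 → Q x03 x13 x23 x34 → Q x04 x14 x24 x34 →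
      Q x01 x02 x03 x04
  tri₁ : ∀ {x01 x02 x03 x04 x12 x13 x14 x23 x24 x34},
    Q x01 x02 x03 x04 → Q x02 x12 x23 x24 → Q x03 x13 x23 x34 → Q x04 x14 x24 x34 →
      Q x01 x12 x13 x14
  tri₂ : ∀ {x01 x02 x03 x04 x12 x13 x14 x23 x24 x34},
    Q x01 x02 x03 x04 → Q x01 x12 x13 x14 → Q x03 x13 x23 x34 → Q x04 x14 x24 x34 →
      Q x02 x12 x23 x24
  tri₃ : ∀ {x01 x02 x03 x04 x12 x13 x14 x23 x24 x34},
    Q x01 x02 x03 x04 → Q x01 x12 x13 x14 → Q x02 x12 x23 x24 → Q x04 x14 x24 x34 →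
      Q x03 x13 x23 x34

namespace QuatKan
variable {S : Type} {o : S} {Q : S → S → S → S → Prop}

theorem zero (h : QuatKan o Q) : Q o o o o := h.degen₀ o

theorem symm_aux (h : QuatKan o Q) {a b c : S} (hab : Q a b o o) (hac : Q a c o o) : Q b c o o :=
  h.tri₂ hab hac h.zero h.zero

theorem symm (h : QuatKan o Q) {a b : S} (hab : Q a b o o) : Q b a o o := h.symm_aux hab (h.degen₀ a)

theorem trans (h : QuatKan o Q) {a b c : S} (hab : Q a b o o) (hbc : Q b c o o) : Q a c o o :=
  h.symm_aux (h.symm hab) hbc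

theorem shift (h : QuatKan o Q) {a b : S} : Q o a b o ↔ Q a b o o :=
  ⟨fun hq => h.symm (h.tri₃ hq (h.degen₁ a) (h.degen₀ a) h.zero),
    fun hq => h.tri₀ (h.degen₁ a) (h.degen₀ a) (h.symm hq) h.zero⟩

theorem congr_mul (h : QuatKan o Q) {a a' b b' c c' : S} (ha : Q a a' o o) (hb : Q b b' o o) (hc : Q c c' o o)
    (hq : Q a b c o) : Q a' b' c' o :=
  h.tri₁ (h.tri₂ ha hq (h.shift.2 hc) h.zero) hb (h.degen₀ c') h.zero

theorem unique_mid (h : QuatKan o Q) {a b b' c : S} (hq : Q a b c o) (hq' : Q a b' c o) : Q b b' o o :=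
  h.tri₂ hq hq' (h.degen₀ c) h.zero

/-- A quaternary Kan relation is the vanishing of the alternating sum in an abelian group. -/
theorem exists_addCommGroup (h : QuatKan o Q) : ∃ (G : Type) (_ : AddCommGroup G) (φ : S → G),
    Function.Surjective φ ∧ φ o = 0 ∧
      ∀ a b c d, Q a b c d ↔ φ a - φ b + φ c - φ d = 0 := by
  let s : Setoid S := ⟨fun a b => Q a b o o, h.degen₀, h.symm, h.trans⟩
  let G := Quotient s
  let φ : S → G := Quotient.mk s
  have hφ : ∀ {a b}, φ a = φ b ↔ Q a b o o := Quotient.eq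
  have hsurj : Function.Surjective φ := Quotient.mk_surjective
  have hm : ∀ x y : G, ∃ z : G, ∀ a b c, φ a = x → φ c = y → (φ b = z ↔ Q a b c o) := by
    intro x y
    obtain ⟨a, rfl⟩ := hsurj x
    obtain ⟨c, rfl⟩ := hsurj y
    obtain ⟨b, hb⟩ := h.fill₁ a c o
    refine ⟨φ b, fun a' b' c' ha hc => ⟨fun hb' => ?_, fun hq => ?_⟩⟩
    · exact h.congr_mul (hφ.1 ha.symm) (hφ.1 hb'.symm) (hφ.1 hc.symm) hb
    · exact hφ.2 (h.unique_mid (h.congr_mul (hφ.1 ha) (h.degen₀ b') (hφ.1 hc) hq) hb)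
  choose m hm using hm
  have hmul : ∀ a b c, φ b = m (φ a) (φ c) ↔ Q a b c o := fun a b c => hm _ _ _ _ _ rfl rfl
  have hn : ∀ x : G, ∃ z : G, m z x = φ o := by
    intro x
    obtain ⟨c, rfl⟩ := hsurj x
    obtain ⟨a, ha⟩ := h.fill₀ o c o
    exact ⟨φ a, ((hmul _ _ _).2 ha).symm⟩
  choose n hn using hn
  let _ : Zero G := ⟨φ o⟩
  let _ : Add G := ⟨m⟩
  let _ : Neg G := ⟨n⟩
  let _ : AddGroup G := AddGroup.ofLeftAxioms
    (fun x y z => by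
      change m (m x y) z = m x (m y z)
      obtain ⟨a, rfl⟩ := hsurj x
      obtain ⟨b, rfl⟩ := hsurj y
      obtain ⟨c, rfl⟩ := hsurj z
      obtain ⟨d, hd⟩ := hsurj (m (φ a) (φ b))
      obtain ⟨e, he⟩ := hsurj (m (φ b) (φ c))
      obtain ⟨f, hf⟩ := hsurj (m (φ d) (φ c))
      rw [← hd, ← he, ← hf, hmul]
      exact h.tri₁ ((hmul _ _ _).1 hd) ((hmul _ _ _).1 hf) ((hmul _ _ _).1 he) h.zero)
    (fun x => by
      change m (φ o) x = x
      obtain ⟨a, rfl⟩ := hsurj x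
      exact ((hmul _ _ _).2 (h.degen₁ a)).symm)
    hn
  have hadd : ∀ {a b c}, φ b = φ a + φ c ↔ Q a b c o := fun {a b c} => hmul a b c
  have h0 : φ o = 0 := rfl
  have hT1 : ∀ a b c d e, φ e = φ b - φ c → (Q a b c d ↔ Q a e o d) := by
    intro a b c d e he
    obtain ⟨c', hc'⟩ := hsurj (-φ c)
    have h2 : Q b e c' o := hadd.1 (by rw [he, hc', sub_eq_add_neg])
    have h3 : Q c o c' o := hadd.1 (by rw [hc', h0, add_neg_cancel])
    exact ⟨fun hq => h.tri₁ hq h2 h3 (h.degen₀ d), fun hq => h.tri₀ hq h2 h3 (h.degen₀ d)⟩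
  have hT2 : ∀ a b c d e, φ e = φ a + φ c → (Q a b c d ↔ Q e b o d) := fun a b c d e he =>
    ⟨fun hq => h.tri₂ (hadd.1 he) hq (h.degen₀ c) (h.degen₁ d),
      fun hq => h.tri₁ (hadd.1 he) hq (h.degen₀ c) (h.degen₁ d)⟩
  have hT3 : ∀ a c y x d e f, φ e = φ a + φ c → φ f = φ a + φ y → (Q e f x d ↔ Q c y x d) :=
    fun a c y x d e f he hf =>
    ⟨fun hq => h.tri₃ (hadd.1 he) (hadd.1 hf) hq (h.degen₂ d),
      fun hq => h.tri₂ (hadd.1 he) (hadd.1 hf) hq (h.degen₂ d)⟩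
  have hN1 : ∀ a b c d u, φ u = -φ b + (φ a + φ c) → (Q a b c d ↔ Q u o o d) := by
    intro a b c d u hu
    obtain ⟨e, he⟩ := hsurj (φ a + φ c)
    rw [hT2 a b c d e he]
    refine hT3 b u o o d e b ?_ ?_
    · rw [he, hu, add_neg_cancel_left]
    · rw [h0, add_zero]
  have hN2 : ∀ a b c d u, φ u = φ c - φ b + φ a → (Q a b c d ↔ Q u o o d) := by
    intro a b c d u hu
    obtain ⟨e, he⟩ := hsurj (φ b - φ c)
    rw [hT1 a b c d e he]
    refine hT3 e u o o d a e ?_ ?_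
    · rw [he, hu, ← add_assoc, ← neg_sub (φ b) (φ c), add_neg_cancel, zero_add]
    · rw [h0, add_zero]
  have huniq : ∀ u u' d, Q u o o d → Q u' o o d → φ u = φ u' := fun u u' d hu hu' =>
    hφ.2 (h.tri₀ hu hu' h.zero (h.degen₁ d))
  have hcongr : ∀ u u' d, φ u = φ u' → Q u o o d → Q u' o o d := fun u u' d he hu =>
    h.tri₂ (hφ.1 he) hu h.zero (h.degen₁ d)
  have hdiag : ∀ d, Q d o o d := fun d =>
    (hN1 o o d d d (by rw [h0, neg_zero, zero_add, zero_add])).1 (h.degen₂ d)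
  have hcomm : ∀ x y : G, x + y = y + x := by
    intro x y
    obtain ⟨a, rfl⟩ := hsurj x
    obtain ⟨c, rfl⟩ := hsurj y
    obtain ⟨u, hu⟩ := hsurj (φ a + φ c)
    obtain ⟨u', hu'⟩ := hsurj (φ c + φ a)
    obtain ⟨d, hd⟩ := h.fill₃ a o c
    rw [← hu, ← hu']
    refine huniq u u' d ((hN1 a o c d u ?_).1 hd) ((hN2 a o c d u' ?_).1 hd)
    · rw [h0, neg_zero, zero_add, hu]
    · rw [h0, sub_zero, hu']
  let _ : AddCommGroup G := { (inferInstance : AddGroup G) with add_comm := hcomm }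
  refine ⟨G, inferInstance, φ, hsurj, h0, fun a b c d => ?_⟩
  obtain ⟨u, hu⟩ := hsurj (-φ b + (φ a + φ c))
  rw [hN1 a b c d u hu, show φ a - φ b + φ c - φ d = φ u - φ d by rw [hu]; abel, sub_eq_zero]
  exact ⟨fun hq => huniq _ _ _ hq (hdiag d), fun he => hcongr _ _ _ he.symm (hdiag d)⟩

end QuatKan

/-! ### Kan relations of higher arity -/

/-- The `i`-th face of a triangular array. -/
def triRow {S : Type} (X : ℕ → ℕ → S) (i j : ℕ) : S := if j < i then X j i else X i (j + 1)

/-- A relation on `(n+2)`-tuples (encoded as sequences) with fillers and degeneracies,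
closed under completing triangular arrays. -/
structure KanRel {S : Type} (n : ℕ) (o : S) (R : (ℕ → S) → Prop) : Prop where
  congr : ∀ {y y' : ℕ → S}, (∀ j ≤ n + 1, y j = y' j) → R y → R y'
  fill : ∀ (y : ℕ → S) (i : ℕ), i ≤ n + 1 → ∃ a, R (Function.update y i a)
  degen : ∀ (a : S) (i : ℕ), i ≤ n → R fun j => if j = i ∨ j = i + 1 then a else o
  tri : ∀ (X : ℕ → ℕ → S) (i : ℕ), i ≤ n + 2 →
    (∀ k ≤ n + 2, k ≠ i → R (triRow X k)) → R (triRow X i)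

/-- The sequence with entries `a b c d` from position `p` on, and `o` elsewhere. -/
def window {S : Type} (o : S) (p : ℕ) (a b c d : S) (j : ℕ) : S :=
  if j = p then a else if j = p + 1 then b else if j = p + 2 then c else if j = p + 3 then d else o

namespace KanRel
variable {S : Type} {n : ℕ} {o : S} {R : (ℕ → S) → Prop}

theorem zero (h : KanRel n o R) : R fun _ => o := h.congr (fun j _ => by simp) (h.degen o 0 (Nat.zero_le n))

theorem quat_tri (h : KanRel n o R) {p : ℕ} (hp : p + 2 ≤ n) {x01 x02 x03 x04 x12 x13 x14 x23 x24 x34 : S} (i : ℕ)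
    (hi : i ≤ 4)
    (h0 : i ≠ 0 → R (window o p x01 x02 x03 x04)) (h1 : i ≠ 1 → R (window o p x01 x12 x13 x14))
    (h2 : i ≠ 2 → R (window o p x02 x12 x23 x24)) (h3 : i ≠ 3 → R (window o p x03 x13 x23 x34))
    (h4 : i ≠ 4 → R (window o p x04 x14 x24 x34)) :
    R (window o p (if i = 0 then x01 else if i = 1 then x01 else if i = 2 then x02
        else if i = 3 then x03 else x04)
      (if i = 0 then x02 else if i = 1 then x12 else if i = 2 then x12
        else if i = 3 then x13 else x14)
      (if i = 0 then x03 else if i = 1 then x13 else if i = 2 then x23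
        else if i = 3 then x23 else x24)
      (if i = 0 then x04 else if i = 1 then x14 else if i = 2 then x24
        else if i = 3 then x34 else x34)) := by
  let X : ℕ → ℕ → S := fun a b =>
    if a = p then window o (p + 1) x01 x02 x03 x04 b
    else if a = p + 1 then window o (p + 2) x12 x13 x14 o b
    else if a = p + 2 then window o (p + 3) x23 x24 o o b
    else if a = p + 3 then window o (p + 4) x34 o o o b else o
  have r0 : triRow X p = window o p x01 x02 x03 x04 := by
    funext j; simp only [triRow, X, window]; grind
  have r1 : triRow X (p + 1) = window o p x01 x12 x13 x14 := by
    funext j; simp only [triRow, X, window]; grind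
  have r2 : triRow X (p + 2) = window o p x02 x12 x23 x24 := by
    funext j; simp only [triRow, X, window]; grind
  have r3 : triRow X (p + 3) = window o p x03 x13 x23 x34 := by
    funext j; simp only [triRow, X, window]; grind
  have r4 : triRow X (p + 4) = window o p x04 x14 x24 x34 := by
    funext j; simp only [triRow, X, window]; grind
  have ro : ∀ k, k < p ∨ p + 4 < k → triRow X k = fun _ => o := by
    intro k hk
    funext j; simp only [triRow, X, window]; grind
  have key := h.tri X (p + i) (by lia) fun k hk hki => by
    rcases lt_or_ge k p with hkp | hkp
    · rw [ro k (Or.inl hkp)]; exact h.zero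
    obtain ⟨l, rfl⟩ := Nat.exists_eq_add_of_le hkp
    have hl : l ≠ i := fun e => hki (by rw [e])
    rcases lt_or_ge 4 l with hl4 | hl4
    · rw [ro _ (Or.inr (by lia))]; exact h.zero
    interval_cases l
    · rw [add_zero, r0]; exact h0 hl.symm
    · rw [r1]; exact h1 hl.symm
    · rw [r2]; exact h2 hl.symm
    · rw [r3]; exact h3 hl.symm
    · rw [r4]; exact h4 hl.symm
  interval_cases i
  · simpa [r0] using key
  · simpa [r1] using key
  · simpa [r2] using key
  · simpa [r3] using key
  · simpa [r4] using key

theorem quatKan (h : KanRel n o R) {p : ℕ} (hp : p + 2 ≤ n) :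
    QuatKan o fun a b c d => R (window o p a b c d) where
  fill₀ b c d := by
    obtain ⟨a, ha⟩ := h.fill (window o p o b c d) p (by lia)
    exact ⟨a, by convert! ha using 1; funext j; simp only [window, Function.update_apply]; grind⟩
  fill₁ a c d := by
    obtain ⟨b, ha⟩ := h.fill (window o p a o c d) (p + 1) (by lia)
    exact ⟨b, by convert! ha using 1; funext j; simp only [window, Function.update_apply]; grind⟩
  fill₂ a b d := by
    obtain ⟨c, ha⟩ := h.fill (window o p a b o d) (p + 2) (by lia)
    exact ⟨c, by convert! ha using 1; funext j; simp only [window, Function.update_apply]; grind⟩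
  fill₃ a b c := by
    obtain ⟨d, ha⟩ := h.fill (window o p a b c o) (p + 3) (by lia)
    exact ⟨d, by convert! ha using 1; funext j; simp only [window, Function.update_apply]; grind⟩
  degen₀ a := by
    convert! h.degen a p (by lia) using 1; funext j; simp only [window]; grind
  degen₁ a := by
    convert! h.degen a (p + 1) (by lia) using 1; funext j; simp only [window]; grind
  degen₂ a := by
    convert! h.degen a (p + 2) (by lia) using 1; funext j; simp only [window]; grind
  tri₀ h1 h2 h3 h4 := by
    simpa using h.quat_tri hp 0 (by lia) (by simp) (fun _ => h1) (fun _ => h2) (fun _ => h3)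
      (fun _ => h4)
  tri₁ h1 h2 h3 h4 := by
    simpa using h.quat_tri hp 1 (by lia) (fun _ => h1) (by simp) (fun _ => h2) (fun _ => h3)
      (fun _ => h4)
  tri₂ h1 h2 h3 h4 := by
    simpa using h.quat_tri hp 2 (by lia) (fun _ => h1) (fun _ => h2) (by simp) (fun _ => h3)
      (fun _ => h4)
  tri₃ h1 h2 h3 h4 := by
    simpa using h.quat_tri hp 3 (by lia) (fun _ => h1) (fun _ => h2) (fun _ => h3) (by simp)
      (fun _ => h4)

theorem window_succ (h : KanRel n o R) {p : ℕ} (hp : p + 2 ≤ n) (a b c : S) :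
    R (window o (p + 1) a b c o) ↔ R (window o p a b c o) := by
  obtain ⟨G, _, φ, -, h0, hφ⟩ := (h.quatKan hp).exists_addCommGroup
  rw [hφ a b c o, show window o (p + 1) a b c o = window o p o a b c by
    funext j; simp only [window]; grind, hφ o a b c, h0, ← neg_eq_zero]
  rw [show -(0 - φ a + φ b - φ c) = φ a - φ b + φ c - 0 by abel]

theorem window_iff (h : KanRel n o R) {p : ℕ} (hp : p + 1 ≤ n) (a b c : S) :
    R (window o p a b c o) ↔ R (window o 0 a b c o) := by
  induction p with
  | zero => rfl
  | succ p ih => rw [h.window_succ (by lia), ih (by lia)]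

theorem transfer_mp (h : KanRel n o R) {p : ℕ} (hp : p + 1 ≤ n) {y y' : ℕ → S} {w : S}
    (hy : ∀ j, j ≠ p → j ≠ p + 1 → y j = y' j)
    (hw₀ : R (window o p w (y p) (y' p) o)) (hw₁ : R (window o p w (y (p + 1)) (y' (p + 1)) o)) :
    R y ↔ R y' := by
  let X : ℕ → ℕ → S := fun a b =>
    if b = p + 2 then y a
    else if b = p + 3 then (if a = p + 2 then y (p + 2) else y' a)
    else if a = p + 2 ∨ a = p + 3 then y (b - 1)
    else if a = p ∧ b = p + 1 then w else o
  have hrow : ∀ k ≤ n + 2, k ≠ p + 2 → k ≠ p + 3 → R (triRow X k) := by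
    intro k hk h2 h3
    rcases lt_trichotomy k p with hkp | rfl | hkp
    · convert! h.degen (y k) (p + 1) (by lia) using 1
      funext j; simp only [triRow, X]; grind
    · convert! hw₀ using 1
      funext j; simp only [triRow, X, window]; grind
    rcases (show p + 1 ≤ k by lia).eq_or_lt with rfl | hkp'
    · convert! hw₁ using 1
      funext j; simp only [triRow, X, window]; grind
    · convert! h.degen (y (k - 1)) (p + 2) (by lia) using 1
      funext j; simp only [triRow, X]; grind
  have r2 : triRow X (p + 2) = y := by
    funext j; simp only [triRow, X]; grind
  have r3 : triRow X (p + 3) = y' := by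
    funext j; simp only [triRow, X]; grind
  constructor
  · intro hR
    rw [← r3]
    refine h.tri X _ (by lia) fun k hk hne => ?_
    by_cases hk2 : k = p + 2
    · rw [hk2, r2]; exact hR
    · exact hrow k hk hk2 hne
  · intro hR
    rw [← r2]
    refine h.tri X _ (by lia) fun k hk hne => ?_
    by_cases hk2 : k = p + 3
    · rw [hk2, r3]; exact hR
    · exact hrow k hk hne hk2

theorem two_unique (h : KanRel n o R) (hn : 2 ≤ n) {u u' v : S} {y y' : ℕ → S}
    (hy : ∀ j ≤ n + 1, y j = if j = 0 then u else if j = n + 1 then v else o)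
    (hy' : ∀ j ≤ n + 1, y' j = if j = 0 then u' else if j = n + 1 then v else o) :
    (R y ∧ R y' → R (window o 0 u u' o o)) ∧ (R (window o 0 u u' o o) → R y → R y') := by
  let X : ℕ → ℕ → S := fun a b =>
    if a = 0 ∧ b = 1 then u else if a = 0 ∧ b = 2 then u'
    else if (a = 1 ∨ a = 2) ∧ b = n + 2 then v else o
  have r0 : triRow X 0 = window o 0 u u' o o := by
    funext j; simp only [triRow, X, window]; grind
  have r1 : ∀ j ≤ n + 1, triRow X 1 j = y j := by
    intro j hj; rw [hy j hj]; simp only [triRow, X]; grind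
  have r2 : ∀ j ≤ n + 1, triRow X 2 j = y' j := by
    intro j hj; rw [hy' j hj]; simp only [triRow, X]; grind
  have hrow : ∀ k ≤ n + 2, 2 < k → R (triRow X k) := by
    intro k hk h2
    rcases hk.eq_or_lt with rfl | hk
    · refine h.congr (fun j hj => ?_) (h.degen v 1 (by lia))
      simp only [triRow, X]; grind
    · convert! h.zero using 1
      funext j; simp only [triRow, X]; grind
  refine ⟨fun ⟨hR, hR'⟩ => r0 ▸ h.tri X 0 (by lia) fun k hk hne => ?_,
    fun hw hR => h.congr r2 (h.tri X 2 (by lia) fun k hk hne => ?_)⟩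
  · rcases lt_or_ge 2 k with h2 | h2
    · exact hrow k hk h2
    interval_cases k
    · exact (hne rfl).elim
    · exact h.congr (fun j hj => (r1 j hj).symm) hR
    · exact h.congr (fun j hj => (r2 j hj).symm) hR'
  · rcases lt_or_ge 2 k with h2 | h2
    · exact hrow k hk h2
    interval_cases k
    · rw [r0]; exact hw
    · exact h.congr (fun j hj => (r1 j hj).symm) hR
    · exact (hne rfl).elim

/-- A Kan relation of arity at least four is the vanishing of the alternating sum in an
abelian group. -/
theorem exists_addCommGroup (h : KanRel n o R) (hn : 2 ≤ n) : ∃ (G : Type) (_ : AddCommGroup G) (φ : S → G),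
    Function.Surjective φ ∧ φ o = 0 ∧
      ∀ y : ℕ → S, R y ↔ ∑ j ∈ Finset.range (n + 2), (-1 : ℤ) ^ j • φ (y j) = 0 := by
  obtain ⟨G, _, φ, hsurj, h0, hφ⟩ := (h.quatKan (p := 0) (by lia)).exists_addCommGroup
  refine ⟨G, inferInstance, φ, hsurj, h0, ?_⟩
  have kill : ∀ k ≤ n, ∀ y : ℕ → S, ∃ y' : ℕ → S, (R y ↔ R y') ∧
      ∑ j ∈ Finset.range (n + 2), (-1 : ℤ) ^ j • φ (y j) =
        ∑ j ∈ Finset.range (n + 2), (-1 : ℤ) ^ j • φ (y' j) ∧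
      y' (n + 1) = y (n + 1) ∧ ∀ j ≤ n, n - k < j → y' j = o := by
    intro k
    induction k with
    | zero => exact fun _ y => ⟨y, Iff.rfl, rfl, rfl, fun j hj hj' => by lia⟩
    | succ k ih =>
      intro hk y
      obtain ⟨y', hR, hsum, htop, ho⟩ := ih (by lia) y
      obtain ⟨p, hp⟩ : ∃ p, n - k = p + 1 := ⟨n - k - 1, by lia⟩
      obtain ⟨a, ha⟩ := hsurj (φ (y' p) - φ (y' (p + 1)))
      let y'' : ℕ → S := fun j => if j = p then a else if j = p + 1 then o else y' j
      have e0 : y'' p = a := by simp [y'']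
      have e1 : y'' (p + 1) = o := by simp [y'']
      have e2 : ∀ j, j ≠ p → j ≠ p + 1 → y' j = y'' j := fun j h1 h2 => by simp [y'', h1, h2]
      refine ⟨y'', hR.trans (h.transfer_mp (p := p) (w := y' (p + 1)) (by lia) e2 ?_ ?_),
        hsum.trans ?_, ?_, ?_⟩
      · rw [h.window_iff (by lia), hφ, e0, ha, h0]; abel
      · rw [h.window_iff (by lia), hφ, e1, h0]; abel
      · rw [← sub_eq_zero, ← Finset.sum_sub_distrib, Finset.sum_eq_add p (p + 1) (by lia)]
        · rw [e0, e1, ha, h0, pow_succ, ← smul_sub, ← smul_sub, mul_neg, mul_one, neg_smul]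
          simp
        · rintro j - ⟨h1, h2⟩
          rw [e2 j h1 h2, sub_self]
        · exact fun hm => (hm (Finset.mem_range.2 (by lia))).elim
        · exact fun hm => (hm (Finset.mem_range.2 (by lia))).elim
      · rw [← e2 _ (by lia) (by lia), htop]
      · intro j hj hj'
        by_cases h1 : j = p + 1
        · rw [h1, e1]
        · rw [← e2 j (by lia) h1, ho j hj (by lia)]
  have two : ∀ y : ℕ → S, (∀ j ≤ n, n - n < j → y j = o) →
      ∑ j ∈ Finset.range (n + 2), (-1 : ℤ) ^ j • φ (y j) =
        φ (y 0) + (-1 : ℤ) ^ (n + 1) • φ (y (n + 1)) := by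
    intro y hy
    rw [Finset.sum_eq_add 0 (n + 1) (by lia), pow_zero, one_smul]
    · intro j hj hne
      rw [Finset.mem_range] at hj
      rw [hy j (by lia) (by lia), h0, smul_zero]
    · exact fun hm => (hm (Finset.mem_range.2 (by lia))).elim
    · exact fun hm => (hm (Finset.mem_range.2 (by lia))).elim
  intro y
  obtain ⟨y', hR, hsum, htop, ho⟩ := kill n le_rfl y
  obtain ⟨z, hRz, hsz, htz, hoz⟩ := kill n le_rfl
    (fun j => if j = n ∨ j = n + 1 then y' (n + 1) else o)
  rw [hR, hsum, two y' ho]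
  have hz := hRz.1 (h.degen _ n le_rfl)
  simp only [or_true, if_true] at htz
  rw [two z hoz, htz, Finset.sum_eq_add n (n + 1) (by lia)] at hsz
  rotate_left
  · rintro j - ⟨h1, h2⟩
    rw [if_neg (by lia), h0, smul_zero]
  · exact fun hm => (hm (Finset.mem_range.2 (by lia))).elim
  · exact fun hm => (hm (Finset.mem_range.2 (by lia))).elim
  simp only [true_or, or_true, if_true] at hsz
  rw [pow_succ, mul_neg, mul_one, neg_smul, add_neg_cancel] at hsz
  have ey : ∀ j ≤ n + 1, y' j = if j = 0 then y' 0 else if j = n + 1 then y' (n + 1) else o := by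
    intro j hj
    split_ifs with h1 h2
    · rw [h1]
    · rw [h2]
    · exact ho j (by lia) (by lia)
  have ez : ∀ j ≤ n + 1, z j = if j = 0 then z 0 else if j = n + 1 then y' (n + 1) else o := by
    intro j hj
    split_ifs with h1 h2
    · rw [h1]
    · rw [h2, htz]
    · exact hoz j (by lia) (by lia)
  have hu : R (window o 0 (z 0) (y' 0) o o) ↔ φ (z 0) = φ (y' 0) := by
    rw [hφ, h0, sub_zero, add_zero, sub_eq_zero]
  rw [pow_succ, mul_neg, mul_one, neg_smul]
  constructor
  · intro hy
    rw [← hu.1 ((h.two_unique hn ez ey).1 ⟨hz, hy⟩), ← hsz]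
  · intro hs
    exact (h.two_unique hn ez ey).2 (hu.2 (add_right_cancel (hsz.symm.trans hs.symm))) hz

end KanRel

/-! ### Gluing continuous maps along finite closed covers -/

section Glue
variable {X Y ι : Type*}

theorem exists_glue [Nonempty Y] {I : Set ι} {A : ι → Set X} {g : ι → X → Y}
    (hg : ∀ i ∈ I, ∀ j ∈ I, ∀ x ∈ A i, x ∈ A j → g i x = g j x) :
    ∃ f : X → Y, ∀ i ∈ I, ∀ x ∈ A i, f x = g i x := by
  classical
  refine ⟨fun x => if h : ∃ i ∈ I, x ∈ A i then g h.choose x else Classical.arbitrary Y,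
    fun i hi x hx => ?_⟩
  have h : ∃ i ∈ I, x ∈ A i := ⟨i, hi, hx⟩
  beta_reduce
  rw [dif_pos h]
  exact hg _ h.choose_spec.1 i hi x h.choose_spec.2 hx

variable [TopologicalSpace X] [TopologicalSpace Y]

theorem continuousOn_of_finite_closed_cover {f : X → Y} {S : Set X} {I : Set ι} (hI : I.Finite)
    {A : ι → Set X} (hA : ∀ i ∈ I, IsClosed (A i)) (hf : ∀ i ∈ I, ContinuousOn f (A i))
    (hS : S ⊆ ⋃ i ∈ I, A i) : ContinuousOn f S := by
  have : Finite I := hI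
  refine ContinuousOn.mono ?_ hS
  rw [Set.biUnion_eq_iUnion]
  exact (locallyFinite_of_finite _).continuousOn_iUnion (fun i => hA i i.2) fun i => hf i i.2

theorem exists_continuousOn_glue [Nonempty Y] {I : Set ι} (hI : I.Finite) {A : ι → Set X}
    {g : ι → X → Y} (hA : ∀ i ∈ I, IsClosed (A i)) (hc : ∀ i ∈ I, ContinuousOn (g i) (A i))
    (hg : ∀ i ∈ I, ∀ j ∈ I, ∀ x ∈ A i, x ∈ A j → g i x = g j x) :
    ∃ f : X → Y, ContinuousOn f (⋃ i ∈ I, A i) ∧ ∀ i ∈ I, ∀ x ∈ A i, f x = g i x := by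
  obtain ⟨f, hf⟩ := exists_glue hg
  exact ⟨f, continuousOn_of_finite_closed_cover hI hA
    (fun i hi => (hc i hi).congr fun x hx => hf i hi x hx) subset_rfl, hf⟩

end Glue

/-! ### Standard simplices with coordinates indexed by natural numbers -/

/-- The standard `m`-simplex. -/
abbrev stdCell (m : ℕ) : Set (ℕ → ℝ) := cell (Finset.range (m + 1))

/-- Delete the `i`-th coordinate. -/
def delCoord (i : ℕ) (q : ℕ → ℝ) (j : ℕ) : ℝ := if j < i then q j else q (j + 1)

/-- Insert a zero `i`-th coordinate. -/
def insCoord (i : ℕ) (q : ℕ → ℝ) (j : ℕ) : ℝ :=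
  if j < i then q j else if j = i then 0 else q (j - 1)

theorem delCoord_insCoord (i : ℕ) (q : ℕ → ℝ) : delCoord i (insCoord i q) = q := by
  funext j; simp only [delCoord, insCoord]; grind

theorem insCoord_delCoord {i : ℕ} {q : ℕ → ℝ} (h : q i = 0) : insCoord i (delCoord i q) = q := by
  funext j; simp only [delCoord, insCoord]; grind

theorem delCoord_comm {k l : ℕ} (h : k < l) (q : ℕ → ℝ) :
    delCoord (l - 1) (delCoord k q) = delCoord k (delCoord l q) := by
  funext j; simp only [delCoord]; grind

theorem continuous_delCoord (i : ℕ) : Continuous (delCoord i) := by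
  refine continuous_pi fun j => ?_
  unfold delCoord
  split_ifs <;> fun_prop

theorem continuous_insCoord (i : ℕ) : Continuous (insCoord i) := by
  refine continuous_pi fun j => ?_
  unfold insCoord
  split_ifs <;> fun_prop

theorem sum_delCoord {m i : ℕ} (hi : i ≤ m) (q : ℕ → ℝ) :
    q i + ∑ j ∈ Finset.range m, delCoord i q j = ∑ j ∈ Finset.range (m + 1), q j := by
  rw [Finset.sum_range, Finset.sum_range, Fin.sum_univ_succAbove _ ⟨i, by lia⟩]
  congr 1
  refine Finset.sum_congr rfl fun j _ => ?_
  simp only [delCoord, Fin.succAbove, Fin.lt_def, Fin.val_castSucc]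
  split_ifs <;> rfl

theorem stdCell_eq_zero {m : ℕ} {q : ℕ → ℝ} (hq : q ∈ stdCell m) {j : ℕ} (hj : m < j) : q j = 0 :=
  hq.2.1 j (by simpa using hj)

theorem delCoord_mem {m i : ℕ} (hi : i ≤ m + 1) {q : ℕ → ℝ} (hq : q ∈ stdCell (m + 1))
    (h : q i = 0) : delCoord i q ∈ stdCell m := by
  refine ⟨fun j => ?_, fun j hj => ?_, ?_⟩
  · unfold delCoord; split_ifs <;> exact hq.1 _
  · rw [Finset.mem_range, not_lt] at hj
    unfold delCoord
    rw [if_neg (by lia)]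
    exact stdCell_eq_zero hq (by lia)
  · have := sum_delCoord hi q
    rw [h, zero_add] at this
    rw [this, hq.2.2]

theorem insCoord_mem {m i : ℕ} (hi : i ≤ m + 1) {q : ℕ → ℝ} (hq : q ∈ stdCell m) :
    insCoord i q ∈ stdCell (m + 1) := by
  refine ⟨fun j => ?_, fun j hj => ?_, ?_⟩
  · unfold insCoord; split_ifs
    exacts [hq.1 _, le_rfl, hq.1 _]
  · rw [Finset.mem_range, not_lt] at hj
    unfold insCoord
    rw [if_neg (by lia), if_neg (by lia)]
    exact stdCell_eq_zero hq (by lia)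
  · have := sum_delCoord hi (insCoord i q)
    rw [delCoord_insCoord, hq.2.2] at this
    rw [← this]; simp [insCoord]

/-- The retraction of a simplex onto the union of all facets but the `i`-th. -/
theorem exists_horn_retraction {m i : ℕ} (hi : i ≤ m + 1) : ∃ r : (ℕ → ℝ) → ℕ → ℝ,
    Continuous r ∧ (∀ q ∈ stdCell (m + 1), r q ∈ stdCell (m + 1) ∧
      ∃ k ≤ m + 1, k ≠ i ∧ r q k = 0) ∧
    ∀ q ∈ stdCell (m + 1), ∀ k ≤ m + 1, k ≠ i → q k = 0 → r q = q := by
  classical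
  let s : Finset ℕ := (Finset.range (m + 2)).erase i
  have hi' : i ∈ Finset.range (m + 2) := Finset.mem_range.2 (by lia)
  have hcard : s.card = m + 1 := by
    rw [Finset.card_erase_of_mem hi', Finset.card_range]; rfl
  have hs : s.Nonempty := Finset.card_pos.1 (by lia)
  have hmem : ∀ {k}, k ∈ s ↔ k ≠ i ∧ k ≤ m + 1 := fun {k} => by
    simp only [s, Finset.mem_erase, Finset.mem_range]; lia
  let μ : (ℕ → ℝ) → ℝ := fun q => s.inf' hs q
  have hμ : Continuous μ := Continuous.finset_inf'_apply hs fun k _ => continuous_apply k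
  have hμle : ∀ q, ∀ k ∈ s, μ q ≤ q k := fun q k hk => Finset.inf'_le _ hk
  have hμ0 : ∀ q ∈ stdCell (m + 1), 0 ≤ μ q := fun q hq =>
    Finset.le_inf' _ _ fun k _ => hq.1 k
  let r : (ℕ → ℝ) → ℕ → ℝ := fun q j =>
    if j = i then q i + (m + 1) * μ q else if j ∈ s then q j - μ q else q j
  have hr0 : ∀ q, μ q = 0 → r q = q := by
    intro q h
    funext j
    simp only [r, h]
    split_ifs with h1 <;> simp [h1]
  refine ⟨r, ?_, fun q hq => ⟨⟨fun j => ?_, fun j hj => ?_, ?_⟩, ?_⟩, fun q hq k hk hki h0 => ?_⟩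
  · refine continuous_pi fun j => ?_
    simp only [r]
    split_ifs <;> fun_prop
  · simp only [r]
    split_ifs with h1 h2
    · have := hq.1 i
      have := hμ0 q hq
      positivity
    · exact sub_nonneg.2 (hμle q j h2)
    · exact hq.1 j
  · simp only [Finset.mem_range, not_lt] at hj
    have h1 : j ≠ i := by lia
    have h2 : j ∉ s := fun h => by have := hmem.1 h; lia
    simp only [r, if_neg h1, if_neg h2]
    exact stdCell_eq_zero hq (by lia)
  · have h1 : ∑ j ∈ s, r q j = ∑ j ∈ s, q j - (m + 1) * μ q := by
      rw [Finset.sum_congr rfl (g := fun j => q j - μ q)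
        fun j hj => by simp only [r, if_neg (hmem.1 hj).1, if_pos hj]]
      rw [Finset.sum_sub_distrib, Finset.sum_const, hcard, nsmul_eq_mul]
      push_cast; ring
    have h2 := hq.2.2
    rw [← Finset.add_sum_erase _ _ hi'] at h2 ⊢
    change _ + ∑ j ∈ s, _ = _ at h2
    change _ + ∑ j ∈ s, _ = _
    rw [h1]
    simp only [r, if_true]
    linarith
  · obtain ⟨k, hk, hk'⟩ := Finset.exists_mem_eq_inf' hs q
    refine ⟨k, (hmem.1 hk).2, (hmem.1 hk).1, ?_⟩
    simp only [r, if_neg (hmem.1 hk).1, if_pos hk]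
    rw [← hk', sub_self]
  · exact hr0 q (le_antisymm (h0 ▸ hμle q k (hmem.2 ⟨hki, hk⟩)) (hμ0 q hq))

/-- Compatible maps on all facets of a simplex but one extend to the simplex. -/
theorem exists_horn_extension {Y : Type*} [TopologicalSpace Y] [Nonempty Y] {m i : ℕ}
    (hi : i ≤ m + 1) {g : ℕ → (ℕ → ℝ) → Y}
    (hg : ∀ k ≤ m + 1, k ≠ i → ContinuousOn (g k) (stdCell m))
    (hc : ∀ q ∈ stdCell (m + 1), ∀ k l, k < l → l ≤ m + 1 → k ≠ i → l ≠ i → q k = 0 → q l = 0 →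
      g k (delCoord k q) = g l (delCoord l q)) :
    ∃ G : (ℕ → ℝ) → Y, ContinuousOn G (stdCell (m + 1)) ∧
      ∀ q ∈ stdCell (m + 1), ∀ k ≤ m + 1, k ≠ i → q k = 0 → G q = g k (delCoord k q) := by
  obtain ⟨r, hrc, hr, hr'⟩ := exists_horn_retraction hi
  have hfin : {k | k ≤ m + 1 ∧ k ≠ i}.Finite := (Set.finite_Iic (m + 1)).subset fun k hk => hk.1
  obtain ⟨f, hf, hfg⟩ := exists_continuousOn_glue (Y := Y) hfin
    (A := fun k => stdCell (m + 1) ∩ {q | q k = 0}) (g := fun k q => g k (delCoord k q))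
    (fun k _ => (isClosed_cell _).inter (isClosed_eq (continuous_apply k) continuous_const))
    (fun k hk => (hg k hk.1 hk.2).comp (continuous_delCoord k).continuousOn
      fun q hq => delCoord_mem hk.1 hq.1 hq.2)
    (fun k hk l hl q hq hq' => by
      rcases lt_trichotomy k l with h | rfl | h
      · exact hc q hq.1 k l h hl.1 hk.2 hl.2 hq.2 hq'.2
      · rfl
      · exact (hc q hq.1 l k h hk.1 hl.2 hk.2 hq'.2 hq.2).symm)
  refine ⟨fun q => f (r q), hf.comp hrc.continuousOn fun q hq => ?_, fun q hq k hk hki h0 => ?_⟩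
  · obtain ⟨hrq, k, hk, hki, h0⟩ := hr q hq
    exact Set.mem_biUnion (show k ∈ {k | k ≤ m + 1 ∧ k ≠ i} from ⟨hk, hki⟩) ⟨hrq, h0⟩
  · change f (r q) = _
    rw [hr' q hq k hk hki h0]
    exact hfg k ⟨hk, hki⟩ q ⟨hq, h0⟩

/-! ### Spherical simplices and their Kan relation -/

/-- Maps of the standard `m`-simplex sending its boundary to the base point. -/
structure SphSimplex (Y : Type) [TopologicalSpace Y] (y₀ : Y) (m : ℕ) where
  toFun : (ℕ → ℝ) → Y
  continuousOn : ContinuousOn toFun (stdCell m)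
  boundary : ∀ q ∈ stdCell m, ∀ i ≤ m, q i = 0 → toFun q = y₀

namespace SphSimplex
variable {Y : Type} [TopologicalSpace Y] {y₀ : Y} {m : ℕ}

/-- The constant spherical simplex. -/
def const (Y : Type) [TopologicalSpace Y] (y₀ : Y) (m : ℕ) : SphSimplex Y y₀ m :=
  ⟨fun _ => y₀, continuousOn_const, fun _ _ _ _ _ => rfl⟩

/-- A tuple of spherical simplices bounds a simplex of one dimension more. -/
def Bounds (y : ℕ → SphSimplex Y y₀ m) : Prop :=
  ∃ g : (ℕ → ℝ) → Y, ContinuousOn g (stdCell (m + 1)) ∧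
    ∀ q ∈ stdCell (m + 1), ∀ i ≤ m + 1, q i = 0 → g q = (y i).toFun (delCoord i q)

theorem bounds_degen (a : SphSimplex Y y₀ m) {i : ℕ} (hi : i ≤ m) :
    Bounds fun j => if j = i ∨ j = i + 1 then a else const Y y₀ m := by
  let μ : (ℕ → ℝ) → ℕ → ℝ := fun q j =>
    if j < i then q j else if j = i then q i + q (i + 1) else q (j + 1)
  have hμ : ∀ q ∈ stdCell (m + 1), μ q ∈ stdCell m := by
    refine fun q hq => ⟨fun j => ?_, fun j hj => ?_, ?_⟩
    · simp only [μ]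
      split_ifs
      exacts [hq.1 _, add_nonneg (hq.1 _) (hq.1 _), hq.1 _]
    · simp only [Finset.mem_range, not_lt] at hj
      simp only [μ, if_neg (show ¬ j < i by lia), if_neg (show ¬ j = i by lia)]
      exact stdCell_eq_zero hq (by lia)
    · have h1 := sum_delCoord (m := m + 1) (i := i) (by lia) q
      rw [hq.2.2] at h1
      rw [← h1, ← Finset.add_sum_erase _ _ (Finset.mem_range.2 (show i < m + 1 by lia)),
        ← Finset.add_sum_erase _ (delCoord i q) (Finset.mem_range.2 (show i < m + 1 by lia))]
      rw [Finset.sum_congr rfl (g := delCoord i q) fun j hj => by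
        have := Finset.ne_of_mem_erase hj
        simp only [μ, delCoord, if_neg this]]
      simp only [μ, delCoord, lt_irrefl, if_false, if_true, add_assoc]
      rfl
  have hμc : Continuous μ := by
    refine continuous_pi fun j => ?_
    simp only [μ]
    split_ifs <;> fun_prop
  refine ⟨fun q => a.toFun (μ q), a.continuousOn.comp hμc.continuousOn hμ,
    fun q hq k hk h0 => ?_⟩
  by_cases h1 : k = i ∨ k = i + 1
  · simp only [if_pos h1]
    congr 1
    funext j
    simp only [μ, delCoord]
    rcases h1 with rfl | rfl <;> grind
  · simp only [if_neg h1]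
    change _ = y₀
    rcases lt_or_ge k i with h2 | h2
    · exact a.boundary _ (hμ q hq) k (by lia) (by simp [μ, h2, h0])
    · refine a.boundary _ (hμ q hq) (k - 1) (by lia) ?_
      simp only [μ]
      rw [if_neg (by lia), if_neg (by lia), Nat.sub_add_cancel (by lia), h0]

theorem insCoord_zero {q : ℕ → ℝ} {i j : ℕ} (h : q j = 0) :
    insCoord i q (if j < i then j else j + 1) = 0 := by
  unfold insCoord; grind

theorem bounds_fill (y : ℕ → SphSimplex Y y₀ m) {i : ℕ} (hi : i ≤ m + 1) :
    ∃ a, Bounds (Function.update y i a) := by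
  have : Nonempty Y := ⟨y₀⟩
  have hb : ∀ q ∈ stdCell (m + 1), ∀ k l, k ≠ l → k ≤ m + 1 → l ≤ m + 1 → q k = 0 → q l = 0 →
      (y k).toFun (delCoord k q) = y₀ := by
    intro q hq k l hkl hk hl h1 h2
    refine (y k).boundary _ (delCoord_mem hk hq h1) (if l < k then l else l - 1) (by grind) ?_
    unfold delCoord; grind
  obtain ⟨G, hG, hGy⟩ := exists_horn_extension hi (g := fun k => (y k).toFun)
    (fun k _ _ => (y k).continuousOn) (fun q hq k l hkl hl _ _ h1 h2 => by
      rw [hb q hq k l hkl.ne (by lia) hl h1 h2, hb q hq l k hkl.ne' hl (by lia) h2 h1])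
  refine ⟨⟨fun q => G (insCoord i q), hG.comp (continuous_insCoord i).continuousOn
    fun q hq => insCoord_mem hi hq, fun q hq j hj h0 => ?_⟩, G, hG, fun q hq k hk h0 => ?_⟩
  · have hq' := insCoord_mem hi hq
    have hz := insCoord_zero (i := i) h0
    rw [hGy _ hq' _ (by grind) (by grind) hz]
    exact hb _ hq' _ i (by grind) (by grind) hi hz (by simp [insCoord])
  · by_cases hki : k = i
    · subst hki
      simp only [Function.update_self]
      rw [insCoord_delCoord h0]
    · rw [Function.update_of_ne hki, hGy q hq k hk hki h0]

theorem bounds_tri (X : ℕ → ℕ → SphSimplex Y y₀ m) {i : ℕ} (hi : i ≤ m + 2)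
    (h : ∀ k ≤ m + 2, k ≠ i → Bounds (triRow X k)) : Bounds (triRow X i) := by
  have : Nonempty Y := ⟨y₀⟩
  have h' : ∀ k, ∃ g : (ℕ → ℝ) → Y, k ≤ m + 2 → k ≠ i → ContinuousOn g (stdCell (m + 1)) ∧
      ∀ q ∈ stdCell (m + 1), ∀ j ≤ m + 1, q j = 0 →
        g q = (triRow X k j).toFun (delCoord j q) := by
    intro k
    by_cases hk : k ≤ m + 2 ∧ k ≠ i
    · obtain ⟨g, hg⟩ := h k hk.1 hk.2
      exact ⟨g, fun _ _ => hg⟩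
    · exact ⟨fun _ => y₀, fun h1 h2 => (hk ⟨h1, h2⟩).elim⟩
  choose g hg using h'
  have hlow : ∀ q ∈ stdCell (m + 2), ∀ k l, k < l → l ≤ m + 2 → k ≠ i → q k = 0 → q l = 0 →
      g k (delCoord k q) = (X k l).toFun (delCoord k (delCoord l q)) := by
    intro q hq k l hkl hl hki h1 h2
    rw [(hg k (by lia) hki).2 _ (delCoord_mem (by lia) hq h1) (l - 1) (by lia)
      (by unfold delCoord; grind), delCoord_comm hkl]
    congr 1
    unfold triRow; grind
  have hhigh : ∀ q ∈ stdCell (m + 2), ∀ k l, k < l → l ≤ m + 2 → l ≠ i → q k = 0 → q l = 0 →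
      g l (delCoord l q) = (X k l).toFun (delCoord k (delCoord l q)) := by
    intro q hq k l hkl hl hli h1 h2
    rw [(hg l (by lia) hli).2 _ (delCoord_mem (by lia) hq h2) k (by lia)
      (by unfold delCoord; grind)]
    congr 1
    unfold triRow; grind
  obtain ⟨G, hG, hGg⟩ := exists_horn_extension (m := m + 1) hi (g := g)
    (fun k hk hki => (hg k hk hki).1) (fun q hq k l hkl hl hki hli h1 h2 => by
      rw [hlow q hq k l hkl hl hki h1 h2, hhigh q hq k l hkl hl hli h1 h2])
  refine ⟨fun q => G (insCoord i q), hG.comp (continuous_insCoord i).continuousOn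
    fun q hq => insCoord_mem hi hq, fun q hq j hj h0 => ?_⟩
  have hq' := insCoord_mem hi hq
  have hz := insCoord_zero (i := i) h0
  have hzi : insCoord i q i = 0 := by simp [insCoord]
  change G (insCoord i q) = _
  rw [hGg _ hq' _ (by grind) (by grind) hz]
  by_cases hji : j < i
  · simp only [if_pos hji] at hz ⊢
    rw [hlow _ hq' j i hji hi hji.ne hz hzi, delCoord_insCoord, triRow, if_pos hji]
  · simp only [if_neg hji] at hz ⊢
    rw [hhigh _ hq' i (j + 1) (by lia) (by lia) (by lia) hzi hz, ← delCoord_comm (by lia),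
      delCoord_insCoord, triRow, if_neg hji, Nat.add_sub_cancel]

theorem kanRel (Y : Type) [TopologicalSpace Y] (y₀ : Y) (m : ℕ) :
    KanRel m (const Y y₀ m) Bounds where
  congr := fun {y y'} h ⟨g, hg, hgy⟩ =>
    ⟨g, hg, fun q hq i hi h0 => by rw [hgy q hq i hi h0, h i hi]⟩
  fill y i hi := bounds_fill y hi
  degen a i hi := bounds_degen a hi
  tri X i hi h := bounds_tri X hi h

end SphSimplex

/-! ### Homotopy extension for pairs of finite complexes -/

section Cells
variable {W : Type}

theorem mem_cell_erase [DecidableEq W] {s : Finset W} {v : W} {p : W → ℝ} (hp : p ∈ cell s)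
    (h : p v = 0) : p ∈ cell (s.erase v) :=
  ⟨hp.1, fun w hw => by
    by_cases hwv : w = v
    · rw [hwv, h]
    · exact hp.2.1 w fun hws => hw (Finset.mem_erase.2 ⟨hwv, hws⟩), by
    rw [← hp.2.2]
    by_cases hv : v ∈ s
    · rw [← Finset.add_sum_erase _ _ hv, h, zero_add]
    · rw [Finset.erase_eq_of_notMem hv]⟩

theorem cell_erase_apply [DecidableEq W] {s : Finset W} {v : W} {p : W → ℝ}
    (hp : p ∈ cell (s.erase v)) : p v = 0 := hp.2.1 v (Finset.notMem_erase v s)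

/-- The retraction of a prism onto its bottom and sides. -/
theorem exists_cell_retraction {s : Finset W} (hs : s.Nonempty) :
    ∃ r : (W → ℝ) × ℝ → (W → ℝ) × ℝ, ContinuousOn r (cell s ×ˢ Set.Icc 0 1) ∧
      (∀ x ∈ cell s ×ˢ Set.Icc (0 : ℝ) 1, r x ∈ cell s ×ˢ Set.Icc (0 : ℝ) 1 ∧
        ((r x).2 = 0 ∨ ∃ v ∈ s, (r x).1 v = 0)) ∧
      ∀ x ∈ cell s ×ˢ Set.Icc (0 : ℝ) 1, (x.2 = 0 ∨ ∃ v ∈ s, x.1 v = 0) → r x = x := by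
  classical
  have hk : (0 : ℝ) < s.card := by exact_mod_cast hs.card_pos
  let μ : (W → ℝ) → ℝ := fun q => s.inf' hs q
  have hμ : Continuous μ := Continuous.finset_inf'_apply hs fun k _ => continuous_apply k
  have hμle : ∀ q, ∀ k ∈ s, μ q ≤ q k := fun q k hk => Finset.inf'_le _ hk
  have hμ0 : ∀ q ∈ cell s, 0 ≤ μ q := fun q hq => Finset.le_inf' _ _ fun k _ => hq.1 k
  let l : (W → ℝ) × ℝ → ℝ := fun x => min (x.2 / 2) (s.card * μ x.1)
  have hl : Continuous l := by fun_prop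
  have hl0 : ∀ x ∈ cell s ×ˢ Set.Icc (0 : ℝ) 1, 0 ≤ l x := fun x hx =>
    le_min (by linarith [hx.2.1]) (mul_nonneg hk.le (hμ0 _ hx.1))
  have hl1 : ∀ x ∈ cell s ×ˢ Set.Icc (0 : ℝ) 1, 0 < 1 - l x := fun x hx => by
    have := min_le_left (x.2 / 2) (s.card * μ x.1)
    have := hx.2.2
    simp only [l]; linarith
  let r : (W → ℝ) × ℝ → (W → ℝ) × ℝ := fun x =>
    (fun w => if w ∈ s then (x.1 w - l x / s.card) / (1 - l x) else x.1 w,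
      (x.2 - 2 * l x) / (1 - l x))
  refine ⟨r, ?_, fun x hx => ⟨⟨⟨fun w => ?_, fun w hw => ?_, ?_⟩, ?_, ?_⟩, ?_⟩, fun x hx h => ?_⟩
  · refine ContinuousOn.prodMk (continuousOn_pi.2 fun w => ?_) ?_
    · split_ifs
      · exact (((continuous_apply w).comp continuous_fst).sub (hl.div_const _)).continuousOn.div
          (continuous_const.sub hl).continuousOn fun x hx => (hl1 x hx).ne'
      · exact ((continuous_apply w).comp continuous_fst).continuousOn
    · exact (continuous_snd.sub (continuous_const.mul hl)).continuousOn.div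
        (continuous_const.sub hl).continuousOn fun x hx => (hl1 x hx).ne'
  · simp only [r]
    split_ifs with hw
    · refine div_nonneg ?_ (hl1 x hx).le
      have h1 : l x / s.card ≤ μ x.1 := by
        rw [div_le_iff₀ hk, mul_comm]; exact min_le_right _ _
      linarith [hμle x.1 w hw]
    · exact hx.1.1 w
  · simp only [r, if_neg hw]
    exact hx.1.2.1 w hw
  · have : ∀ w ∈ s, (r x).1 w = (x.1 w - l x / s.card) / (1 - l x) := fun w hw => by
      simp only [r, if_pos hw]
    rw [Finset.sum_congr rfl this, ← Finset.sum_div, Finset.sum_sub_distrib, hx.1.2.2,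
      Finset.sum_const, nsmul_eq_mul, mul_div_cancel₀ _ hk.ne', div_self (hl1 x hx).ne']
  · refine div_nonneg ?_ (hl1 x hx).le
    have := min_le_left (x.2 / 2) (s.card * μ x.1)
    simp only [l]; linarith
  · change (x.2 - 2 * l x) / (1 - l x) ≤ 1
    rw [div_le_one (hl1 x hx)]
    linarith [hl0 x hx, hx.2.2]
  · rcases min_choice (x.2 / 2) (s.card * μ x.1) with h | h
    · left
      change (x.2 - 2 * l x) / (1 - l x) = 0
      rw [show l x = x.2 / 2 from h, mul_div_cancel₀ _ two_ne_zero, sub_self, zero_div]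
    · right
      obtain ⟨v, hv, hv'⟩ := Finset.exists_mem_eq_inf' hs x.1
      refine ⟨v, hv, ?_⟩
      simp only [r, if_pos hv]
      rw [show l x = s.card * μ x.1 from h, mul_div_cancel_left₀ _ hk.ne',
        show x.1 v = μ x.1 from hv'.symm, sub_self, zero_div]
  · have h0 : l x = 0 := by
      refine le_antisymm ?_ (hl0 x hx)
      rcases h with h | ⟨v, hv, h⟩
      · exact (min_le_left _ _).trans (by rw [h, zero_div])
      · refine (min_le_right _ _).trans ?_
        rw [le_antisymm (h ▸ hμle x.1 v hv) (hμ0 _ hx.1), mul_zero]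
    refine Prod.ext (funext fun w => ?_) ?_
    · simp [r, h0]
    · simp [r, h0]

variable [DecidableEq W] {Y : Type*} [TopologicalSpace Y]

/-- Maps on prisms over the faces of a finite complex, compatible on facets, glue. -/
theorem exists_glue_cells [Nonempty Y] {C : ASC W} (hC : C.faces.Finite)
    {g : Finset W → (W → ℝ) × ℝ → Y}
    (hc : ∀ s ∈ C.faces, ContinuousOn (g s) (cell s ×ˢ Set.Icc 0 1))
    (hg : ∀ s ∈ C.faces, ∀ v ∈ s, s.erase v ∈ C.faces → ∀ p ∈ cell (s.erase v),
      ∀ t ∈ Set.Icc (0 : ℝ) 1, g s (p, t) = g (s.erase v) (p, t)) :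
    ∃ H : (W → ℝ) × ℝ → Y, ContinuousOn H (realization C ×ˢ Set.Icc 0 1) ∧
      ∀ s ∈ C.faces, ∀ p ∈ cell s, ∀ t ∈ Set.Icc (0 : ℝ) 1, H (p, t) = g s (p, t) := by
  have hsub : ∀ k, ∀ s ∈ C.faces, ∀ u ⊆ s, s.card = u.card + k → ∀ p ∈ cell u,
      ∀ t ∈ Set.Icc (0 : ℝ) 1, g s (p, t) = g u (p, t) := by
    intro k
    induction k with
    | zero =>
      intro s _ u hu hcard p _ t _
      rw [Finset.eq_of_subset_of_card_le hu hcard.le]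
    | succ k ih =>
      intro s hs u hu hcard p hp t ht
      obtain ⟨v, hv, hvu⟩ := Finset.exists_mem_notMem_of_card_lt_card (show u.card < s.card by lia)
      have hus : u ⊆ s.erase v := fun w hw =>
        Finset.mem_erase.2 ⟨fun h => hvu (h ▸ hw), hu hw⟩
      have hs' : s.erase v ∈ C.faces :=
        C.down_closed hs (Finset.erase_subset _ _) ((cell_nonempty_finset hp).mono hus)
      rw [hg s hs v hv hs' p (cell_mono hus hp) t ht]
      exact ih _ hs' u hus (by rw [Finset.card_erase_of_mem hv]; lia) p hp t ht
  obtain ⟨H, hH, hHg⟩ := exists_continuousOn_glue (Y := Y) hC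
    (A := fun s => cell s ×ˢ Set.Icc (0 : ℝ) 1)
    (fun s _ => (isClosed_cell s).prod isClosed_Icc) hc (fun s hs u hu x hx hx' => by
      have hp := cell_inter hx.1 hx'.1
      rw [hsub _ s hs (s ∩ u) Finset.inter_subset_left
          (Nat.add_sub_cancel' (Finset.card_le_card Finset.inter_subset_left)).symm _ hp _ hx.2,
        hsub _ u hu (s ∩ u) Finset.inter_subset_right
          (Nat.add_sub_cancel' (Finset.card_le_card Finset.inter_subset_right)).symm _ hp _ hx.2])
  refine ⟨H, hH.mono fun x hx => ?_, fun s hs p hp t ht => hHg s hs (p, t) ⟨hp, ht⟩⟩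
  obtain ⟨s, hs, hp⟩ := hx.1
  exact Set.mem_biUnion hs ⟨hp, hx.2⟩

/-- Homotopies extend over faces whose boundary lies in the subcomplex. -/
theorem exists_homotopy_extension [Nonempty Y] {C₀ C₁ : ASC W} (hC₁ : C₁.faces.Finite)
    (hsub : C₀.faces ⊆ C₁.faces)
    (hnew : ∀ s ∈ C₁.faces, s ∉ C₀.faces → ∀ v ∈ s, s.erase v ∈ C₀.faces)
    {f : (W → ℝ) → Y} (hf : ContinuousOn f (realization C₁))
    {H : (W → ℝ) × ℝ → Y} (hH : ContinuousOn H (realization C₀ ×ˢ Set.Icc 0 1))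
    (hH0 : ∀ p ∈ realization C₀, H (p, 0) = f p) :
    ∃ H' : (W → ℝ) × ℝ → Y, ContinuousOn H' (realization C₁ ×ˢ Set.Icc 0 1) ∧
      (∀ p ∈ realization C₁, H' (p, 0) = f p) ∧
      ∀ p ∈ realization C₀, ∀ t ∈ Set.Icc (0 : ℝ) 1, H' (p, t) = H (p, t) := by
  classical
  let B : (W → ℝ) × ℝ → Y := fun x => if x.2 = 0 then f x.1 else H x
  have hBH : ∀ x ∈ realization C₀ ×ˢ Set.Icc (0 : ℝ) 1, B x = H x := fun x hx => by
    simp only [B]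
    split_ifs with h
    · rw [← hH0 _ hx.1, ← h]
    · rfl
  have hB : ContinuousOn B (realization C₀ ×ˢ Set.Icc 0 1 ∪ realization C₁ ×ˢ {0}) := by
    refine ContinuousOn.union_of_isClosed (hH.congr hBH) ?_
      ((isCompact_realization (hC₁.subset hsub)).isClosed.prod isClosed_Icc)
      ((isCompact_realization hC₁).isClosed.prod isClosed_singleton)
    refine (hf.comp continuousOn_fst fun x hx => hx.1).congr fun x hx => ?_
    simp only [B, if_pos (show x.2 = 0 from hx.2)]; rfl
  have hr : ∀ s : Finset W, ∃ r : (W → ℝ) × ℝ → (W → ℝ) × ℝ, s.Nonempty →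
      ContinuousOn r (cell s ×ˢ Set.Icc 0 1) ∧
      (∀ x ∈ cell s ×ˢ Set.Icc (0 : ℝ) 1, r x ∈ cell s ×ˢ Set.Icc (0 : ℝ) 1 ∧
        ((r x).2 = 0 ∨ ∃ v ∈ s, (r x).1 v = 0)) ∧
      ∀ x ∈ cell s ×ˢ Set.Icc (0 : ℝ) 1, (x.2 = 0 ∨ ∃ v ∈ s, x.1 v = 0) → r x = x := by
    intro s
    by_cases hs : s.Nonempty
    · obtain ⟨r, h⟩ := exists_cell_retraction hs
      exact ⟨r, fun _ => h⟩
    · exact ⟨id, fun h => (hs h).elim⟩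
  choose r hr using hr
  let g : Finset W → (W → ℝ) × ℝ → Y := fun s => if s ∈ C₀.faces then H else fun x => B (r s x)
  have hg0 : ∀ s ∈ C₀.faces, g s = H := fun s hs => if_pos hs
  have hg1 : ∀ s ∉ C₀.faces, g s = fun x => B (r s x) := fun s hs => if_neg hs
  obtain ⟨H', hH', hH'g⟩ := exists_glue_cells (Y := Y) hC₁ (g := g) (fun s hs => by
      by_cases hs0 : s ∈ C₀.faces
      · rw [hg0 s hs0]
        exact hH.mono (Set.prod_mono_left (cell_subset_realization hs0))
      · rw [hg1 s hs0]
        obtain ⟨h1, h2, -⟩ := hr s (C₁.nonempty_of_mem hs)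
        refine hB.comp h1 fun x hx => ?_
        obtain ⟨hx1, h | ⟨v, hv, h⟩⟩ := h2 x hx
        · exact Or.inr ⟨⟨s, hs, hx1.1⟩, h⟩
        · exact Or.inl ⟨⟨_, hnew s hs hs0 v hv, mem_cell_erase hx1.1 h⟩, hx1.2⟩)
    (fun s hs v hv hsv p hp t ht => by
      by_cases hs0 : s ∈ C₀.faces
      · rw [hg0 s hs0, hg0 _ (C₀.down_closed hs0 (Finset.erase_subset _ _)
          (C₁.nonempty_of_mem hsv))]
      · have hv0 := hnew s hs hs0 v hv
        rw [hg1 s hs0, hg0 _ hv0]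
        have hp' : (p, t) ∈ cell s ×ˢ Set.Icc (0 : ℝ) 1 :=
          ⟨cell_mono (Finset.erase_subset _ _) hp, ht⟩
        beta_reduce
        rw [(hr s (C₁.nonempty_of_mem hs)).2.2 _ hp' (Or.inr ⟨v, hv, cell_erase_apply hp⟩)]
        exact hBH _ ⟨⟨_, hv0, hp⟩, ht⟩)
  refine ⟨H', hH', ?_, ?_⟩
  · rintro p ⟨s, hs, hp⟩
    have h0 : (0 : ℝ) ∈ Set.Icc (0 : ℝ) 1 := ⟨le_rfl, zero_le_one⟩
    rw [hH'g s hs p hp 0 h0]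
    by_cases hs0 : s ∈ C₀.faces
    · rw [hg0 s hs0, hH0 p ⟨s, hs0, hp⟩]
    · rw [hg1 s hs0]
      beta_reduce
      rw [(hr s (C₁.nonempty_of_mem hs)).2.2 (p, 0) ⟨hp, h0⟩ (Or.inl rfl)]
      exact if_pos rfl
  · rintro p ⟨s, hs, hp⟩ t ht
    rw [hH'g s (hsub hs) p hp t ht, hg0 s hs]

end Cells

/-! ### Ordered simplices -/

section Ordered
variable {W : Type} [LinearOrder W]

/-- The number of elements of `τ` below `w`. -/
def rankIn (τ : Finset W) (w : W) : ℕ := (τ.filter (· < w)).card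

theorem rankIn_lt_rankIn {τ : Finset W} {v w : W} (hv : v ∈ τ) (h : v < w) :
    rankIn τ v < rankIn τ w := by
  refine Finset.card_lt_card (Finset.ssubset_iff_of_subset (fun x hx => ?_) |>.2 ⟨v, ?_, ?_⟩)
  · rw [Finset.mem_filter] at hx ⊢
    exact ⟨hx.1, hx.2.trans h⟩
  · simp [hv, h]
  · simp

theorem rankIn_lt_card {τ : Finset W} {w : W} (hw : w ∈ τ) : rankIn τ w < τ.card := by
  refine Finset.card_lt_card (Finset.ssubset_iff_of_subset (Finset.filter_subset _ _) |>.2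
    ⟨w, hw, ?_⟩)
  simp

theorem rankIn_injOn (τ : Finset W) : Set.InjOn (rankIn τ) τ := by
  intro v hv w hw h
  rcases lt_trichotomy v w with h' | h' | h'
  · exact absurd h (rankIn_lt_rankIn hv h').ne
  · exact h'
  · exact absurd h (rankIn_lt_rankIn hw h').ne'

theorem image_rankIn (τ : Finset W) : τ.image (rankIn τ) = Finset.range τ.card := by
  refine Finset.eq_of_subset_of_card_le (fun j hj => ?_) ?_
  · obtain ⟨w, hw, rfl⟩ := Finset.mem_image.1 hj
    exact Finset.mem_range.2 (rankIn_lt_card hw)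
  · rw [Finset.card_image_of_injOn (rankIn_injOn τ), Finset.card_range]

theorem exists_rankIn_eq {τ : Finset W} {j : ℕ} (hj : j < τ.card) : ∃ w ∈ τ, rankIn τ w = j := by
  rw [← Finset.mem_range, ← image_rankIn] at hj
  simpa using hj

theorem sum_range_card {M : Type*} [AddCommMonoid M] (τ : Finset W) (f : ℕ → M) :
    ∑ j ∈ Finset.range τ.card, f j = ∑ w ∈ τ, f (rankIn τ w) := by
  rw [← image_rankIn, Finset.sum_image (rankIn_injOn τ)]

theorem rankIn_erase_of_lt {τ : Finset W} {v w : W} (h : w ≤ v) :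
    rankIn (τ.erase v) w = rankIn τ w := by
  unfold rankIn
  congr 1
  ext x
  simp only [Finset.mem_filter, Finset.mem_erase]
  exact ⟨fun hx => ⟨hx.1.2, hx.2⟩, fun hx => ⟨⟨(hx.2.trans_le h).ne, hx.1⟩, hx.2⟩⟩

theorem rankIn_erase_of_gt {τ : Finset W} {v w : W} (hv : v ∈ τ) (h : v < w) :
    rankIn (τ.erase v) w + 1 = rankIn τ w := by
  unfold rankIn
  rw [Finset.filter_erase, Finset.card_erase_add_one (by simp [hv, h])]

/-- The order-preserving parametrization of a simplex. -/
def cellMap (τ : Finset W) (q : ℕ → ℝ) (w : W) : ℝ := if w ∈ τ then q (rankIn τ w) else 0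

/-- The barycentric coordinates in increasing order of the vertices. -/
def cellCoord (τ : Finset W) (p : W → ℝ) (j : ℕ) : ℝ :=
  ∑ w ∈ τ with rankIn τ w = j, p w

theorem cellCoord_rankIn {τ : Finset W} {w : W} (hw : w ∈ τ) (p : W → ℝ) :
    cellCoord τ p (rankIn τ w) = p w := by
  unfold cellCoord
  rw [Finset.sum_eq_single w]
  · intro v hv hne
    rw [Finset.mem_filter] at hv
    exact (hne (rankIn_injOn τ hv.1 hw hv.2)).elim
  · intro h
    simp [hw] at h

theorem cellCoord_eq_zero {τ : Finset W} {j : ℕ} (hj : τ.card ≤ j) (p : W → ℝ) :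
    cellCoord τ p j = 0 := by
  unfold cellCoord
  rw [Finset.filter_eq_empty_iff.2, Finset.sum_empty]
  intro w hw h
  have := rankIn_lt_card hw
  lia

theorem continuous_cellMap (τ : Finset W) : Continuous (cellMap τ) := by
  refine continuous_pi fun w => ?_
  unfold cellMap
  split_ifs <;> fun_prop

theorem continuous_cellCoord (τ : Finset W) : Continuous (cellCoord τ) :=
  continuous_pi fun _ => continuous_finsetSum _ fun w _ => continuous_apply w

theorem cellMap_cellCoord {τ : Finset W} {p : W → ℝ} (hp : p ∈ cell τ) :
    cellMap τ (cellCoord τ p) = p := by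
  funext w
  unfold cellMap
  split_ifs with hw
  · exact cellCoord_rankIn hw p
  · exact (hp.2.1 w hw).symm

theorem cellCoord_cellMap {m : ℕ} {τ : Finset W} (hτ : τ.card = m + 1) {q : ℕ → ℝ}
    (hq : q ∈ stdCell m) : cellCoord τ (cellMap τ q) = q := by
  funext j
  rcases lt_or_ge j τ.card with hj | hj
  · obtain ⟨w, hw, rfl⟩ := exists_rankIn_eq hj
    rw [cellCoord_rankIn hw, cellMap, if_pos hw]
  · rw [cellCoord_eq_zero hj, stdCell_eq_zero hq (by lia)]

theorem cellMap_mem {m : ℕ} {τ : Finset W} (hτ : τ.card = m + 1) {q : ℕ → ℝ}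
    (hq : q ∈ stdCell m) : cellMap τ q ∈ cell τ := by
  refine ⟨fun w => ?_, fun w hw => if_neg hw, ?_⟩
  · unfold cellMap; split_ifs
    exacts [hq.1 _, le_rfl]
  · rw [← hq.2.2, ← hτ, sum_range_card]
    exact Finset.sum_congr rfl fun w hw => if_pos hw

theorem cellCoord_mem {m : ℕ} {τ : Finset W} (hτ : τ.card = m + 1) {p : W → ℝ}
    (hp : p ∈ cell τ) : cellCoord τ p ∈ stdCell m := by
  refine ⟨fun j => Finset.sum_nonneg fun w _ => hp.1 w, fun j hj => ?_, ?_⟩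
  · exact cellCoord_eq_zero (by simpa [hτ] using hj) p
  · rw [← hp.2.2, ← hτ, sum_range_card]
    exact Finset.sum_congr rfl fun w hw => cellCoord_rankIn hw p

theorem cellMap_erase {τ : Finset W} {v : W} (hv : v ∈ τ) {q : ℕ → ℝ} (h : q (rankIn τ v) = 0) :
    cellMap (τ.erase v) (delCoord (rankIn τ v) q) = cellMap τ q := by
  funext w
  unfold cellMap delCoord
  rcases lt_trichotomy w v with hw | rfl | hw
  · simp only [Finset.mem_erase, hw.ne, ne_eq, not_false_eq_true, true_and,
      rankIn_erase_of_lt hw.le]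
    split_ifs with h1 h2
    · rfl
    · exact absurd (rankIn_lt_rankIn h1 hw) h2
    · rfl
  · simp [h]
  · simp only [Finset.mem_erase, hw.ne', ne_eq, not_false_eq_true, true_and]
    have h2 := rankIn_erase_of_gt hv hw
    have h3 := rankIn_lt_rankIn hv hw
    split_ifs with h1 h4
    · lia
    · rw [h2]
    · rfl

theorem cellCoord_erase {m : ℕ} {τ : Finset W} (hτ : τ.card = m + 2) {v : W} (hv : v ∈ τ)
    {p : W → ℝ} (hp : p ∈ cell (τ.erase v)) :
    delCoord (rankIn τ v) (cellCoord τ p) = cellCoord (τ.erase v) p := by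
  have hp' : p ∈ cell τ := cell_mono (Finset.erase_subset _ _) hp
  have h0 : cellCoord τ p (rankIn τ v) = 0 := by
    rw [cellCoord_rankIn hv, cell_erase_apply hp]
  have hlt := rankIn_lt_card hv
  have h1 : delCoord (rankIn τ v) (cellCoord τ p) ∈ stdCell m :=
    delCoord_mem (by lia) (cellCoord_mem hτ hp') h0
  rw [← cellCoord_cellMap (τ := τ.erase v) (by rw [Finset.card_erase_of_mem hv]; lia) h1,
    cellMap_erase hv h0, cellMap_cellCoord hp']

open Classical in
/-- The sequence of values of `x` on the facets of `τ`. -/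
noncomputable def faceSeq {S : Type*} (o : S) (x : Finset W → S) (τ : Finset W) (j : ℕ) : S :=
  if h : ∃ w ∈ τ, rankIn τ w = j then x (τ.erase h.choose) else o

theorem faceSeq_rankIn {S : Type*} (o : S) (x : Finset W → S) {τ : Finset W} {w : W} (hw : w ∈ τ) :
    faceSeq o x τ (rankIn τ w) = x (τ.erase w) := by
  have h : ∃ v ∈ τ, rankIn τ v = rankIn τ w := ⟨w, hw, rfl⟩
  rw [faceSeq, dif_pos h, rankIn_injOn τ h.choose_spec.1 hw h.choose_spec.2]

theorem sum_faceSeq {S G : Type*} [AddCommGroup G] (o : S) (x : Finset W → S) (φ : S → G)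
    (τ : Finset W) :
    ∑ j ∈ Finset.range τ.card, (-1 : ℤ) ^ j • φ (faceSeq o x τ j) = cob (fun s => φ (x s)) τ := by
  rw [sum_range_card]
  exact Finset.sum_congr rfl fun w hw => by rw [faceSeq_rankIn o x hw]; rfl

end Ordered

/-- Points of a cone, by height and position in the base. -/
def coneCoord (t : ℝ) (q : ℕ → ℝ) : ℕ → ℝ
  | 0 => t
  | j + 1 => (1 - t) * q j

theorem continuous_coneCoord : Continuous fun x : (ℕ → ℝ) × ℝ => coneCoord x.2 x.1 := by
  refine continuous_pi fun j => ?_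
  cases j with
  | zero => exact continuous_snd
  | succ j => simp only [coneCoord]; fun_prop

theorem coneCoord_mem {m : ℕ} {q : ℕ → ℝ} (hq : q ∈ stdCell m) {t : ℝ} (ht : t ∈ Set.Icc (0 : ℝ) 1) :
    coneCoord t q ∈ stdCell (m + 1) := by
  refine ⟨fun j => ?_, fun j hj => ?_, ?_⟩
  · cases j with
    | zero => exact ht.1
    | succ j => exact mul_nonneg (by linarith [ht.2]) (hq.1 j)
  · cases j with
    | zero => simp at hj
    | succ j =>
      rw [Finset.mem_range] at hj
      rw [coneCoord, stdCell_eq_zero hq (by lia), mul_zero]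
  · rw [Finset.sum_range_succ']
    simp only [coneCoord]
    rw [← Finset.mul_sum, hq.2.2]; ring

theorem delCoord_zero_coneCoord (q : ℕ → ℝ) : delCoord 0 (coneCoord 0 q) = q := by
  funext j; simp [delCoord, coneCoord]

theorem delCoord_succ_coneCoord (i : ℕ) (t : ℝ) (q : ℕ → ℝ) :
    delCoord (i + 1) (coneCoord t q) = coneCoord t (delCoord i q) := by
  funext j
  cases j with
  | zero => simp [delCoord, coneCoord]
  | succ j => simp only [delCoord, coneCoord, Nat.add_lt_add_iff_right]; split_ifs <;> rfl

/-! ### Complexes with two uniquely solvable top layers -/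

section TwoLayer
variable {W : Type} [LinearOrder W]

/-- `C` is obtained from `A` by attaching `n`-simplices (giving `B`) and then `(n+1)`-simplices,
in such a way that the relative coboundary operator is bijective for all coefficients. -/
structure TwoLayer (A B C : ASC W) (n : ℕ) : Prop where
  finite : C.faces.Finite
  sub₁ : A.faces ⊆ B.faces
  sub₂ : B.faces ⊆ C.faces
  card₁ : ∀ σ ∈ B.faces, σ ∉ A.faces → σ.card = n + 1
  card₂ : ∀ τ ∈ C.faces, τ ∉ B.faces → τ.card = n + 2
  bd₁ : ∀ σ ∈ B.faces, σ ∉ A.faces → ∀ v ∈ σ, σ.erase v ∈ A.faces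
  bd₂ : ∀ τ ∈ C.faces, τ ∉ B.faces → ∀ v ∈ τ, τ.erase v ∈ B.faces
  unique : ∀ (π : Type) [AddCommGroup π] (a : Finset W → π),
    (∀ σ, ¬ (σ ∈ B.faces ∧ σ ∉ A.faces) → a σ = 0) →
    (∀ τ ∈ C.faces, τ ∉ B.faces → cob a τ = 0) → ∀ σ, a σ = 0
  exist : ∀ (π : Type) [AddCommGroup π] (b : Finset W → π), ∃ a : Finset W → π,
    (∀ σ, ¬ (σ ∈ B.faces ∧ σ ∉ A.faces) → a σ = 0) ∧
    ∀ τ ∈ C.faces, τ ∉ B.faces → cob a τ = b τ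

/-- Two maps are homotopic on a set. -/
def HtpyOn {X Y : Type*} [TopologicalSpace X] [TopologicalSpace Y] (P : Set X) (f g : X → Y) :
    Prop :=
  ∃ H : X × ℝ → Y, ContinuousOn H (P ×ˢ Set.Icc 0 1) ∧ (∀ p ∈ P, H (p, 0) = f p) ∧
    ∀ p ∈ P, H (p, 1) = g p

variable {Y : Type} [TopologicalSpace Y] {y₀ : Y}

open Classical in
/-- The restriction of `f` to a simplex whose boundary is sent to the base point. -/
noncomputable def restrictSimplex (y₀ : Y) (m : ℕ) (f : (W → ℝ) → Y) (σ : Finset W) :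
    SphSimplex Y y₀ m :=
  if h : ContinuousOn (fun q => f (cellMap σ q)) (stdCell m) ∧
      ∀ q ∈ stdCell m, ∀ i ≤ m, q i = 0 → f (cellMap σ q) = y₀ then
    ⟨fun q => f (cellMap σ q), h.1, h.2⟩
  else SphSimplex.const Y y₀ m

theorem restrictSimplex_apply {m : ℕ} {f : (W → ℝ) → Y} {σ : Finset W} (hσ : σ.card = m + 1)
    (hf : ContinuousOn f (cell σ)) (hb : ∀ v ∈ σ, ∀ p ∈ cell (σ.erase v), f p = y₀) (q : ℕ → ℝ) :
    (restrictSimplex y₀ m f σ).toFun q = f (cellMap σ q) := by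
  rw [restrictSimplex, dif_pos]
  refine ⟨hf.comp (continuous_cellMap σ).continuousOn fun q hq => cellMap_mem hσ hq,
    fun q hq i hi h0 => ?_⟩
  obtain ⟨v, hv, rfl⟩ := exists_rankIn_eq (τ := σ) (j := i) (by lia)
  exact hb v hv _ (mem_cell_erase (cellMap_mem hσ hq) (by rw [cellMap, if_pos hv, h0]))

theorem continuousOn_comp_cone {m : ℕ} {σ : Finset W} (hσ : σ.card = m + 1) {g : (ℕ → ℝ) → Y}
    (hg : ContinuousOn g (stdCell (m + 1))) :
    ContinuousOn (fun x : (W → ℝ) × ℝ => g (coneCoord x.2 (cellCoord σ x.1)))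
      (cell σ ×ˢ Set.Icc 0 1) := by
  refine hg.comp (Continuous.continuousOn ?_)
    fun x hx => coneCoord_mem (cellCoord_mem hσ hx.1) hx.2
  exact continuous_coneCoord.comp
    (((continuous_cellCoord σ).comp continuous_fst).prodMk continuous_snd)

namespace TwoLayer
variable {A B C : ASC W} {n : ℕ}

theorem exists_homotopy_first (h : TwoLayer A B C n) (hn : 2 ≤ n) {f : (W → ℝ) → Y}
    (hf : ContinuousOn f (realization C)) (hfA : ∀ p ∈ realization A, f p = y₀) :
    ∃ f' : (W → ℝ) → Y, ContinuousOn f' (realization C) ∧ HtpyOn (realization C) f f' ∧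
      ∀ p ∈ realization B, f' p = y₀ := by
  classical
  have : Nonempty Y := ⟨y₀⟩
  obtain ⟨G, _, φ, hsurj, h0, hφ⟩ := (SphSimplex.kanRel Y y₀ n).exists_addCommGroup hn
  let o := SphSimplex.const Y y₀ n
  let x : Finset W → SphSimplex Y y₀ n := fun σ =>
    if σ ∈ B.faces ∧ σ ∉ A.faces then restrictSimplex y₀ n f σ else o
  have hx : ∀ σ ∈ B.faces, σ ∉ A.faces → ∀ q, (x σ).toFun q = f (cellMap σ q) := by
    intro σ hσ hσ' q
    simp only [x, if_pos (And.intro hσ hσ')]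
    exact restrictSimplex_apply (h.card₁ σ hσ hσ')
      (hf.mono (cell_subset_realization (h.sub₂ hσ)))
      (fun v hv p hp => hfA p ⟨_, h.bd₁ σ hσ hσ' v hv, hp⟩) q
  have hxo : ∀ σ, ¬ (σ ∈ B.faces ∧ σ ∉ A.faces) → x σ = o := fun σ hσ => if_neg hσ
  have hxcob : ∀ τ ∈ C.faces, τ ∉ B.faces → cob (fun s => φ (x s)) τ = 0 := by
    intro τ hτ hτ'
    have hc := h.card₂ τ hτ hτ'
    rw [← sum_faceSeq o x φ τ, hc, ← hφ]
    refine ⟨fun q => f (cellMap τ q), (hf.mono (cell_subset_realization hτ)).comp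
      (continuous_cellMap τ).continuousOn fun q hq => cellMap_mem hc hq, fun q hq i hi hi0 => ?_⟩
    obtain ⟨v, hv, rfl⟩ := exists_rankIn_eq (τ := τ) (j := i) (by lia)
    beta_reduce
    rw [faceSeq_rankIn o x hv, ← cellMap_erase hv hi0]
    have hB := h.bd₂ τ hτ hτ' v hv
    by_cases hA : τ.erase v ∈ A.faces
    · rw [hxo _ fun hh => hh.2 hA]
      have hcv : (τ.erase v).card = n + 1 := by rw [Finset.card_erase_of_mem hv, hc]; rfl
      exact hfA _ ⟨_, hA, cellMap_mem hcv (delCoord_mem (by lia) hq hi0)⟩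
    · exact (hx _ hB hA _).symm
  have hx0 : ∀ σ, φ (x σ) = 0 := h.unique G (fun s => φ (x s))
    (fun σ hσ => by rw [hxo σ hσ, h0]) hxcob
  have hg : ∀ σ, ∃ g : (ℕ → ℝ) → Y, ContinuousOn g (stdCell (n + 1)) ∧
      (∀ q ∈ stdCell (n + 1), q 0 = 0 → g q = (x σ).toFun (delCoord 0 q)) ∧
      ∀ q ∈ stdCell (n + 1), ∀ i ≤ n, q (i + 1) = 0 → g q = y₀ := by
    intro σ
    obtain ⟨g, hg, hgb⟩ := (hφ fun j => if j = 0 then x σ else o).2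
      (Finset.sum_eq_zero fun j _ => by split_ifs <;> simp [hx0, o, h0])
    exact ⟨g, hg, fun q hq hq0 => by simpa using hgb q hq 0 (by lia) hq0,
      fun q hq i hi hq0 => by
        have := hgb q hq (i + 1) (by lia) hq0
        simpa [o, SphSimplex.const] using this⟩
  choose g hgc hg0 hg1 using hg
  let k : Finset W → (W → ℝ) × ℝ → Y := fun σ =>
    if σ ∈ A.faces then fun _ => y₀ else fun x => g σ (coneCoord x.2 (cellCoord σ x.1))
  have hkA : ∀ σ ∈ A.faces, k σ = fun _ => y₀ := fun σ hσ => if_pos hσ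
  have hkB : ∀ σ ∉ A.faces, k σ = fun x => g σ (coneCoord x.2 (cellCoord σ x.1)) :=
    fun σ hσ => if_neg hσ
  obtain ⟨H, hH, hHk⟩ := exists_glue_cells (Y := Y) (h.finite.subset h.sub₂) (g := k)
    (fun s hs => by
      by_cases hA : s ∈ A.faces
      · rw [hkA s hA]; exact continuousOn_const
      · rw [hkB s hA]; exact continuousOn_comp_cone (h.card₁ s hs hA) (hgc s))
    (fun s hs v hv hvB p hp t ht => by
      by_cases hA : s ∈ A.faces
      · rw [hkA s hA, hkA _ (A.down_closed hA (Finset.erase_subset _ _)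
          (B.nonempty_of_mem hvB))]
      · rw [hkB s hA, hkA _ (h.bd₁ s hs hA v hv)]
        have hp' : p ∈ cell s := cell_mono (Finset.erase_subset _ _) hp
        have hr := rankIn_lt_card hv
        rw [h.card₁ s hs hA] at hr
        refine hg1 s _ (coneCoord_mem (cellCoord_mem (h.card₁ s hs hA) hp') ht) (rankIn s v)
          (by lia) ?_
        change (1 - t) * cellCoord s p (rankIn s v) = 0
        rw [cellCoord_rankIn hv, cell_erase_apply hp, mul_zero])
  have hI0 : (0 : ℝ) ∈ Set.Icc (0 : ℝ) 1 := ⟨le_rfl, zero_le_one⟩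
  have hI1 : (1 : ℝ) ∈ Set.Icc (0 : ℝ) 1 := ⟨zero_le_one, le_rfl⟩
  obtain ⟨H', hH', hH'0, hH'H⟩ := exists_homotopy_extension h.finite h.sub₂ h.bd₂ hf hH (by
    rintro p ⟨s, hs, hp⟩
    rw [hHk s hs p hp 0 hI0]
    by_cases hA : s ∈ A.faces
    · rw [hkA s hA, hfA p ⟨s, hA, hp⟩]
    · have hq := cellCoord_mem (h.card₁ s hs hA) hp
      rw [hkB s hA]
      beta_reduce
      rw [hg0 s _ (coneCoord_mem hq hI0) rfl, delCoord_zero_coneCoord, hx s hs hA,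
        cellMap_cellCoord hp])
  refine ⟨fun p => H' (p, 1), hH'.comp (by fun_prop) fun p hp => ⟨hp, hI1⟩,
    ⟨H', hH', hH'0, fun p _ => rfl⟩, ?_⟩
  rintro p ⟨s, hs, hp⟩
  beta_reduce
  rw [hH'H p ⟨s, hs, hp⟩ 1 hI1, hHk s hs p hp 1 hI1]
  by_cases hA : s ∈ A.faces
  · rw [hkA s hA]
  · rw [hkB s hA]
    exact hg1 s _ (coneCoord_mem (cellCoord_mem (h.card₁ s hs hA) hp) hI1) 0 (by lia)
      (by simp [coneCoord])

theorem homotopic_const_of_eqOn (h : TwoLayer A B C n) (hn : 1 ≤ n) {f : (W → ℝ) → Y}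
    (hf : ContinuousOn f (realization C)) (hfB : ∀ p ∈ realization B, f p = y₀) :
    HtpyOn (realization C) f fun _ => y₀ := by
  classical
  have : Nonempty Y := ⟨y₀⟩
  obtain ⟨G, _, φ, hsurj, h0, hφ⟩ :=
    (SphSimplex.kanRel Y y₀ (n + 1)).exists_addCommGroup (by lia)
  let o := SphSimplex.const Y y₀ (n + 1)
  let x : Finset W → SphSimplex Y y₀ (n + 1) := restrictSimplex y₀ (n + 1) f
  have hx : ∀ τ ∈ C.faces, τ ∉ B.faces → ∀ q, (x τ).toFun q = f (cellMap τ q) :=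
    fun τ hτ hτ' => restrictSimplex_apply (h.card₂ τ hτ hτ')
      (hf.mono (cell_subset_realization hτ))
      (fun v hv p hp => hfB p ⟨_, h.bd₂ τ hτ hτ' v hv, hp⟩)
  obtain ⟨a, ha, hab⟩ := h.exist G fun τ => φ (x τ)
  have hc : ∀ σ, ∃ c, φ c = a σ ∧ (¬ (σ ∈ B.faces ∧ σ ∉ A.faces) → c = o) := by
    intro σ
    by_cases hσ : σ ∈ B.faces ∧ σ ∉ A.faces
    · obtain ⟨c, hc⟩ := hsurj (a σ)
      exact ⟨c, hc, fun hh => (hh hσ).elim⟩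
    · exact ⟨o, by rw [ha σ hσ, h0], fun _ => rfl⟩
  choose c hca hco using hc
  have hg : ∀ τ, ∃ g : (ℕ → ℝ) → Y, τ ∈ C.faces → τ ∉ B.faces →
      ContinuousOn g (stdCell (n + 2)) ∧
      (∀ q ∈ stdCell (n + 2), q 0 = 0 → g q = (x τ).toFun (delCoord 0 q)) ∧
      ∀ q ∈ stdCell (n + 2), ∀ v ∈ τ, q (rankIn τ v + 1) = 0 →
        g q = (c (τ.erase v)).toFun (delCoord (rankIn τ v + 1) q) := by
    intro τ
    by_cases hτ : τ ∈ C.faces ∧ τ ∉ B.faces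
    · have hcard := h.card₂ τ hτ.1 hτ.2
      obtain ⟨g, hg, hgb⟩ := (hφ fun j => Nat.casesOn j (x τ) (faceSeq o c τ)).2 (by
        have h1 := sum_faceSeq o c φ τ
        rw [hcard] at h1
        have h2 : cob (fun s => φ (c s)) τ = φ (x τ) := by
          rw [← hab τ hτ.1 hτ.2]
          exact cob_congr fun v _ => hca _
        rw [Finset.sum_range_succ', pow_zero, one_smul]
        change ∑ j ∈ Finset.range (n + 2), (-1 : ℤ) ^ (j + 1) • φ (faceSeq o c τ j) + φ (x τ) = 0
        rw [← h2, ← h1, ← sub_neg_eq_add, sub_eq_zero, ← Finset.sum_neg_distrib]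
        exact Finset.sum_congr rfl fun j _ => by rw [pow_succ, mul_neg, mul_one, neg_smul])
      refine ⟨g, fun _ _ => ⟨hg, fun q hq hq0 => hgb q hq 0 (by lia) hq0,
        fun q hq v hv hq0 => ?_⟩⟩
      have hr := rankIn_lt_card hv
      rw [hgb q hq _ (by lia) hq0]
      beta_reduce
      rw [← faceSeq_rankIn o c hv]
    · exact ⟨fun _ => y₀, fun h1 h2 => (hτ ⟨h1, h2⟩).elim⟩
  choose g hg using hg
  let k : Finset W → (W → ℝ) × ℝ → Y := fun σ =>
    if σ ∈ A.faces then fun _ => y₀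
    else if σ ∈ B.faces then fun x => (c σ).toFun (coneCoord x.2 (cellCoord σ x.1))
    else fun x => g σ (coneCoord x.2 (cellCoord σ x.1))
  have hkA : ∀ σ ∈ A.faces, k σ = fun _ => y₀ := fun σ hσ => if_pos hσ
  have hkB : ∀ σ ∈ B.faces, σ ∉ A.faces →
      k σ = fun x => (c σ).toFun (coneCoord x.2 (cellCoord σ x.1)) :=
    fun σ hσ hσ' => by simp only [k, if_neg hσ', if_pos hσ]
  have hkC : ∀ σ ∉ B.faces, k σ = fun x => g σ (coneCoord x.2 (cellCoord σ x.1)) :=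
    fun σ hσ => by simp only [k, if_neg fun hh => hσ (h.sub₁ hh), if_neg hσ]
  obtain ⟨H, hH, hHk⟩ := exists_glue_cells (Y := Y) h.finite (g := k)
    (fun s hs => by
      by_cases hA : s ∈ A.faces
      · rw [hkA s hA]; exact continuousOn_const
      by_cases hB : s ∈ B.faces
      · rw [hkB s hB hA]; exact continuousOn_comp_cone (h.card₁ s hB hA) (c s).continuousOn
      · rw [hkC s hB]; exact continuousOn_comp_cone (h.card₂ s hs hB) (hg s hs hB).1)
    (fun s hs v hv hvC p hp t ht => by
      have hp' : p ∈ cell s := cell_mono (Finset.erase_subset _ _) hp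
      have hr := rankIn_lt_card hv
      have hcz : coneCoord t (cellCoord s p) (rankIn s v + 1) = 0 := by
        change (1 - t) * cellCoord s p (rankIn s v) = 0
        rw [cellCoord_rankIn hv, cell_erase_apply hp, mul_zero]
      by_cases hA : s ∈ A.faces
      · rw [hkA s hA, hkA _ (A.down_closed hA (Finset.erase_subset _ _)
          (C.nonempty_of_mem hvC))]
      by_cases hB : s ∈ B.faces
      · rw [hkB s hB hA, hkA _ (h.bd₁ s hB hA v hv)]
        have hcs := h.card₁ s hB hA
        exact (c s).boundary _ (coneCoord_mem (cellCoord_mem hcs hp') ht) (rankIn s v + 1)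
          (by lia) hcz
      · have hcs := h.card₂ s hs hB
        have hvB := h.bd₂ s hs hB v hv
        rw [hkC s hB]
        beta_reduce
        rw [(hg s hs hB).2.2 _ (coneCoord_mem (cellCoord_mem hcs hp') ht) v hv hcz,
          delCoord_succ_coneCoord, cellCoord_erase hcs hv hp]
        by_cases hvA : s.erase v ∈ A.faces
        · rw [hkA _ hvA, hco _ fun hh => hh.2 hvA]; rfl
        · rw [hkB _ hvB hvA])
  have hI0 : (0 : ℝ) ∈ Set.Icc (0 : ℝ) 1 := ⟨le_rfl, zero_le_one⟩
  have hI1 : (1 : ℝ) ∈ Set.Icc (0 : ℝ) 1 := ⟨zero_le_one, le_rfl⟩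
  refine ⟨H, hH, ?_, ?_⟩
  · rintro p ⟨s, hs, hp⟩
    rw [hHk s hs p hp 0 hI0]
    by_cases hA : s ∈ A.faces
    · rw [hkA s hA, hfB p ⟨s, h.sub₁ hA, hp⟩]
    by_cases hB : s ∈ B.faces
    · rw [hkB s hB hA, hfB p ⟨s, hB, hp⟩]
      exact (c s).boundary _ (coneCoord_mem (cellCoord_mem (h.card₁ s hB hA) hp) hI0) 0
        (by lia) rfl
    · rw [hkC s hB]
      beta_reduce
      rw [(hg s hs hB).2.1 _ (coneCoord_mem (cellCoord_mem (h.card₂ s hs hB) hp) hI0) rfl,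
        delCoord_zero_coneCoord, hx s hs hB, cellMap_cellCoord hp]
  · rintro p ⟨s, hs, hp⟩
    rw [hHk s hs p hp 1 hI1]
    by_cases hA : s ∈ A.faces
    · rw [hkA s hA]
    by_cases hB : s ∈ B.faces
    · rw [hkB s hB hA]
      exact (c s).boundary _ (coneCoord_mem (cellCoord_mem (h.card₁ s hB hA) hp) hI1) 1
        (by lia) (by simp [coneCoord])
    · have hcs := h.card₂ s hs hB
      have hm := coneCoord_mem (cellCoord_mem hcs hp) hI1
      obtain ⟨v, hv, hv0⟩ := exists_rankIn_eq (τ := s) (j := 0) (by lia)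
      rw [hkC s hB]
      beta_reduce
      have hz : coneCoord 1 (cellCoord s p) (rankIn s v + 1) = 0 := by simp [coneCoord]
      rw [(hg s hs hB).2.2 _ hm v hv hz]
      exact (c _).boundary _ (delCoord_mem (by lia) hm hz) 1 (by lia)
        (by rw [hv0]; simp [delCoord, coneCoord])

end TwoLayer
end TwoLayer

section Contractible
variable {W : Type} [LinearOrder W]

theorem HtpyOn.homotopic {X Y : Type*} [TopologicalSpace X] [TopologicalSpace Y] {P : Set X}
    {f g : X → Y} (h : HtpyOn P f g) (F G : C(P, Y)) (hF : ∀ p : P, F p = f p)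
    (hG : ∀ p : P, G p = g p) : F.Homotopic G := by
  obtain ⟨H, hH, h0, h1⟩ := h
  refine ⟨⟨⟨fun x => H (x.2, x.1), ?_⟩, fun p => ?_, fun p => ?_⟩⟩
  · exact hH.comp_continuous (by fun_prop) fun x => ⟨x.2.2, x.1.2⟩
  · exact (h0 p p.2).trans (hF p).symm
  · exact (h1 p p.2).trans (hG p).symm

/-- Contracting a cone towards its apex stays within the cone. -/
theorem cone_contraction_mem {A : ASC W} {e : W} (hcone : ∀ s ∈ A.faces, insert e s ∈ A.faces)
    {p : W → ℝ} (hp : p ∈ realization A) {t : ℝ} (ht : t ∈ Set.Icc (0 : ℝ) 1) :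
    (1 - t) • p + t • Pi.single e 1 ∈ realization A := by
  obtain ⟨s, hs, hp⟩ := hp
  exact ⟨insert e s, hcone s hs, convex_cell _ (cell_mono (Finset.subset_insert e s) hp)
    (single_mem_cell (Finset.mem_insert_self e s)) (sub_nonneg.2 ht.2) ht.1 (by ring)⟩

theorem TwoLayer.contractibleSpace {A B C : ASC W} {n : ℕ} (h : TwoLayer A B C n) (hn : 2 ≤ n)
    {e : W} (he : {e} ∈ A.faces) (hcone : ∀ s ∈ A.faces, insert e s ∈ A.faces) :
    ContractibleSpace (realization C) := by
  classical
  have hAC : realization A ⊆ realization C := by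
    rintro p ⟨s, hs, hp⟩
    exact ⟨s, h.sub₂ (h.sub₁ hs), hp⟩
  have hy : Pi.single e 1 ∈ realization C :=
    hAC ⟨{e}, he, single_mem_cell (Finset.mem_singleton_self e)⟩
  let y₀ : realization C := ⟨Pi.single e 1, hy⟩
  have : Nonempty (realization C) := ⟨y₀⟩
  let f₀ : (W → ℝ) → realization C := fun p => if hp : p ∈ realization C then ⟨p, hp⟩ else y₀
  have hf₀ : ∀ p (hp : p ∈ realization C), f₀ p = ⟨p, hp⟩ := fun p hp => dif_pos hp
  have hf₀c : ContinuousOn f₀ (realization C) := by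
    rw [continuousOn_iff_continuous_domRestrict]
    convert! continuous_id (X := realization C) using 1
    ext1 p
    exact hf₀ p p.2
  obtain ⟨H₁, hH₁, h₁0, h₁H⟩ := exists_homotopy_extension (h.finite.subset h.sub₂) h.sub₁ h.bd₁
    (hf₀c.mono fun p ⟨s, hs, hp⟩ => ⟨s, h.sub₂ hs, hp⟩)
    (H := fun x => f₀ ((1 - x.2) • x.1 + x.2 • Pi.single e 1))
    (hf₀c.comp (by fun_prop) fun x hx => hAC (cone_contraction_mem hcone hx.1 hx.2))
    (fun p _ => by simp)
  obtain ⟨H₂, hH₂, h₂0, h₂H⟩ := exists_homotopy_extension h.finite h.sub₂ h.bd₂ hf₀c hH₁ h₁0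
  have hI1 : (1 : ℝ) ∈ Set.Icc (0 : ℝ) 1 := ⟨zero_le_one, le_rfl⟩
  have hc₁ : ContinuousOn (fun p => H₂ (p, 1)) (realization C) :=
    hH₂.comp (by fun_prop) fun p hp => ⟨hp, hI1⟩
  obtain ⟨f₂, hc₂, h12, hf₂⟩ := h.exists_homotopy_first hn (y₀ := y₀) hc₁ (by
    rintro p ⟨s, hs, hp⟩
    rw [h₂H p ⟨s, h.sub₁ hs, hp⟩ 1 hI1, h₁H p ⟨s, hs, hp⟩ 1 hI1]
    simpa using hf₀ _ hy)
  have h23 := h.homotopic_const_of_eqOn (by lia) hc₂ hf₂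
  rw [contractible_iff_id_nullhomotopic]
  let F₁ : C(realization C, realization C) := ⟨_, continuousOn_iff_continuous_domRestrict.1 hc₁⟩
  let F₂ : C(realization C, realization C) := ⟨_, continuousOn_iff_continuous_domRestrict.1 hc₂⟩
  have h01 : HtpyOn (realization C) f₀ fun p => H₂ (p, 1) := ⟨H₂, hH₂, h₂0, fun _ _ => rfl⟩
  exact ⟨y₀, ((h01.homotopic (ContinuousMap.id _) F₁ (fun p => (hf₀ p p.2).symm)
    fun _ => rfl).trans (h12.homotopic F₁ F₂ (fun _ => rfl) fun _ => rfl)).trans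
    (h23.homotopic F₂ _ (fun _ => rfl) fun _ => rfl)⟩

end Contractible

/-! ### Extending two-layer systems of simplices by uniquely solvable equations -/

section SolvExt
variable {W : Type} [LinearOrder W]

theorem cob_eq_pair {π : Type*} [AddCommGroup π] {a : Finset W → π} {τ : Finset W} {v w : W}
    (hv : v ∈ τ) (hw : w ∈ τ) (hvw : v ≠ w)
    (h : ∀ u ∈ τ, u ≠ v → u ≠ w → a (τ.erase u) = 0) :
    cob a τ = (-1 : ℤ) ^ rankIn τ v • a (τ.erase v) + (-1 : ℤ) ^ rankIn τ w • a (τ.erase w) := by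
  rw [cob, ← Finset.sum_subset (s₁ := {v, w}) (by simp [Finset.insert_subset_iff, hv, hw]) ?_,
    Finset.sum_pair hvw]
  · rfl
  · intro u hu hu'
    simp only [Finset.mem_insert, Finset.mem_singleton, not_or] at hu'
    rw [h u hu hu'.1 hu'.2, smul_zero]

theorem cob_single {π : Type*} [AddCommGroup π] {τ : Finset W} {v : W} (hv : v ∈ τ) (c : π) :
    cob (Pi.single (τ.erase v) c) τ = (-1 : ℤ) ^ rankIn τ v • c := by
  rw [cob, Finset.sum_eq_single_of_mem v hv, Pi.single_eq_same, rankIn]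
  intro u hu huv
  rw [Pi.single_eq_of_ne fun h => huv (Finset.erase_injOn τ hu hv h), smul_zero]

theorem neg_one_pow_smul_smul {π : Type*} [AddCommGroup π] (k : ℕ) (c : π) :
    (-1 : ℤ) ^ k • (-1 : ℤ) ^ k • c = c := by
  rw [← mul_smul, ← mul_pow]; simp

theorem cob_sum_smul {ι π : Type*} [AddCommGroup π] (T : Finset ι) (f : ι → Finset W → ℤ)
    (c : ι → π) (τ : Finset W) :
    cob (fun σ => ∑ i ∈ T, f i σ • c i) τ = ∑ i ∈ T, cob (f i) τ • c i := by
  simp only [cob, Finset.smul_sum, Finset.sum_smul, smul_assoc]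
  exact Finset.sum_comm

/-- `D ⊆ D'` are the simplices giving equations and `F ⊆ F'` the simplices carrying unknowns;
values of the unknowns in `F` extend uniquely to a solution of the equations in `D' \ D`. -/
structure SolvExt (D F D' F' : Finset (Finset W)) : Prop where
  subD : D ⊆ D'
  subF : F ⊆ F'
  facet : ∀ τ ∈ D, ∀ v ∈ τ, τ.erase v ∈ F' → τ.erase v ∈ F
  unique : ∀ (π : Type) [AddCommGroup π] (a : Finset W → π), (∀ σ ∉ F', a σ = 0) →
    (∀ σ ∈ F, a σ = 0) → (∀ τ ∈ D', τ ∉ D → cob a τ = 0) → ∀ σ, a σ = 0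
  exist : ∀ (π : Type) [AddCommGroup π] (a b : Finset W → π), ∃ a' : Finset W → π,
    (∀ σ ∉ F', a' σ = 0) ∧ (∀ σ ∈ F, a' σ = a σ) ∧ ∀ τ ∈ D', τ ∉ D → cob a' τ = b τ

/-- A sequence of simplices `τ k`, each bringing a new facet opposite to `v k`. -/
structure AttachSeq (D F : Finset (Finset W)) (τ : ℕ → Finset W) (v : ℕ → W) (N : ℕ) : Prop where
  mem : ∀ k < N, v k ∈ τ k
  notMem : ∀ k < N, (τ k).erase (v k) ∉ F
  not_subset : ∀ k < N, ∀ ρ ∈ D, ¬ (τ k).erase (v k) ⊆ ρ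
  not_subset_prev : ∀ k < N, ∀ j < k, ¬ (τ k).erase (v k) ⊆ τ j

/-- The simplices of an attaching sequence, together with old ones. -/
def attachD (D : Finset (Finset W)) (τ : ℕ → Finset W) (N : ℕ) : Finset (Finset W) :=
  D ∪ (Finset.range N).image τ

/-- The new facets of an attaching sequence, together with old ones. -/
def attachF (F : Finset (Finset W)) (τ : ℕ → Finset W) (v : ℕ → W) (N : ℕ) :
    Finset (Finset W) :=
  F ∪ (Finset.range N).image fun k => (τ k).erase (v k)

theorem mem_attachD {D : Finset (Finset W)} {τ : ℕ → Finset W} {N : ℕ} {ρ : Finset W} :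
    ρ ∈ attachD D τ N ↔ ρ ∈ D ∨ ∃ k < N, τ k = ρ := by
  simp [attachD]

theorem mem_attachF {F : Finset (Finset W)} {τ : ℕ → Finset W} {v : ℕ → W} {N : ℕ}
    {σ : Finset W} : σ ∈ attachF F τ v N ↔ σ ∈ F ∨ ∃ k < N, (τ k).erase (v k) = σ := by
  simp [attachF]

namespace SolvExt
variable {D F D' F' D'' F'' : Finset (Finset W)}

theorem refl (D F : Finset (Finset W)) : SolvExt D F D F where
  subD := subset_rfl
  subF := subset_rfl
  facet _ _ _ _ h := h
  unique π _ a h0 h1 _ σ := by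
    by_cases h : σ ∈ F
    · exact h1 σ h
    · exact h0 σ h
  exist π _ a b := ⟨fun σ => if σ ∈ F then a σ else 0, fun σ h => if_neg h, fun σ h => if_pos h,
    fun τ h1 h2 => (h2 h1).elim⟩

theorem cob_eq (h : SolvExt D F D' F') {π : Type} [AddCommGroup π] {a a' : Finset W → π}
    (ha : ∀ σ ∉ F, a σ = 0) (ha' : ∀ σ ∉ F', a' σ = 0) (haa : ∀ σ ∈ F, a' σ = a σ)
    {τ : Finset W} (hτ : τ ∈ D) : cob a' τ = cob a τ := by
  refine cob_congr fun v hv => ?_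
  by_cases hF : τ.erase v ∈ F
  · exact haa _ hF
  · rw [ha _ hF, ha' _ fun hF' => hF (h.facet τ hτ v hv hF')]

theorem exists_restrict (h : SolvExt D F D' F') {π : Type} [AddCommGroup π] {a' : Finset W → π}
    (ha' : ∀ σ ∉ F', a' σ = 0) : ∃ a : Finset W → π, (∀ σ ∉ F, a σ = 0) ∧
      (∀ σ ∈ F, a σ = a' σ) ∧ ∀ τ ∈ D, cob a τ = cob a' τ := by
  refine ⟨fun σ => if σ ∈ F then a' σ else 0, fun σ h => if_neg h, fun σ h => if_pos h,
    fun τ hτ => (h.cob_eq (fun σ h => if_neg h) ha' (fun σ h => (if_pos h).symm) hτ).symm⟩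

theorem trans (h : SolvExt D F D' F') (h' : SolvExt D' F' D'' F'') : SolvExt D F D'' F'' where
  subD := h.subD.trans h'.subD
  subF := h.subF.trans h'.subF
  facet τ hτ v hv hF := h.facet τ hτ v hv (h'.facet τ (h.subD hτ) v hv hF)
  unique π _ a h0 h1 h2 := by
    obtain ⟨a', ha0, haa, hac⟩ := h'.exists_restrict h0
    have ha' := h.unique π a' ha0 (fun σ hσ => by rw [haa σ (h.subF hσ), h1 σ hσ])
      (fun τ hτ hτ' => by rw [hac τ hτ, h2 τ (h'.subD hτ) hτ'])
    exact h'.unique π a h0 (fun σ hσ => by rw [← haa σ hσ, ha'])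
      fun τ hτ hτ' => h2 τ hτ fun hD => hτ' (h.subD hD)
  exist π _ a b := by
    obtain ⟨a₁, h0, h1, h2⟩ := h.exist π a b
    obtain ⟨a₂, k0, k1, k2⟩ := h'.exist π a₁ b
    refine ⟨a₂, k0, fun σ hσ => by rw [k1 σ (h.subF hσ), h1 σ hσ], fun τ hτ hτ' => ?_⟩
    by_cases hD : τ ∈ D'
    · rw [h'.cob_eq h0 k0 k1 hD, h2 τ hD hτ']
    · exact k2 τ hτ hD

theorem step {τ : Finset W} {v : W} (hv : v ∈ τ) (hF : τ.erase v ∉ F)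
    (hD : ∀ ρ ∈ D, ¬ τ.erase v ⊆ ρ) : SolvExt D F (insert τ D) (insert (τ.erase v) F) := by
  have hτ : τ ∉ D := fun h => hD τ h (Finset.erase_subset v τ)
  refine ⟨Finset.subset_insert _ _, Finset.subset_insert _ _, fun ρ hρ u hu h => ?_,
    fun π _ a h0 h1 h2 => ?_, fun π _ a b => ?_⟩
  · refine (Finset.mem_insert.1 h).resolve_left fun h => hD ρ hρ ?_
    rw [← h]
    exact Finset.erase_subset u ρ
  · have ha : a = Pi.single (τ.erase v) (a (τ.erase v)) := by
      ext σ
      by_cases hσ : σ = τ.erase v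
      · rw [hσ, Pi.single_eq_same]
      · rw [Pi.single_eq_of_ne hσ]
        by_cases hσF : σ ∈ F
        · exact h1 σ hσF
        · exact h0 σ fun h => (Finset.mem_insert.1 h).elim hσ hσF
    have h := h2 τ (Finset.mem_insert_self _ _) hτ
    rw [ha, cob_single hv] at h
    have h' : a (τ.erase v) = 0 := by
      rw [← neg_one_pow_smul_smul (rankIn τ v) (a _), h, smul_zero]
    rw [ha, h', Pi.single_zero]
    exact fun _ => rfl
  · let a₀ : Finset W → π := fun σ => if σ ∈ F then a σ else 0
    let a₁ : Finset W → π :=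
      Pi.single (τ.erase v) ((-1 : ℤ) ^ rankIn τ v • (b τ - cob a₀ τ))
    refine ⟨fun σ => a₀ σ + a₁ σ, fun σ hσ => ?_, fun σ hσ => ?_, fun ρ hρ hρ' => ?_⟩
    · rw [Finset.mem_insert, not_or] at hσ
      simp only [a₀, a₁, if_neg hσ.2, Pi.single_eq_of_ne hσ.1, add_zero]
    · have : σ ≠ τ.erase v := fun h => hF (h ▸ hσ)
      simp only [a₀, a₁, if_pos hσ, Pi.single_eq_of_ne this, add_zero]
    · obtain rfl := (Finset.mem_insert.1 hρ).resolve_right hρ'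
      rw [cob_add, cob_single hv, neg_one_pow_smul_smul, add_sub_cancel]

end SolvExt

namespace AttachSeq
variable {D F : Finset (Finset W)} {τ : ℕ → Finset W} {v : ℕ → W} {N : ℕ}

theorem solvExt (h : AttachSeq D F τ v N) : SolvExt D F (attachD D τ N) (attachF F τ v N) := by
  induction N with
  | zero => simpa [attachD, attachF] using SolvExt.refl D F
  | succ N ih =>
    have h₁ := ih ⟨fun k hk => h.mem k (by lia), fun k hk => h.notMem k (by lia),
      fun k hk => h.not_subset k (by lia), fun k hk => h.not_subset_prev k (by lia)⟩
    have h₂ := SolvExt.step (D := attachD D τ N) (F := attachF F τ v N) (h.mem N (by lia))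
      (fun hm => by
        obtain hm | ⟨j, hj, hm⟩ := mem_attachF.1 hm
        · exact h.notMem N (by lia) hm
        · exact h.not_subset_prev N (by lia) j hj (hm ▸ Finset.erase_subset _ _))
      (fun ρ hρ hs => by
        obtain hρ | ⟨j, hj, rfl⟩ := mem_attachD.1 hρ
        · exact h.not_subset N (by lia) ρ hρ hs
        · exact h.not_subset_prev N (by lia) j hj hs)
    have hD : attachD D τ (N + 1) = insert (τ N) (attachD D τ N) := by
      rw [attachD, Finset.range_add_one, Finset.image_insert, Finset.union_insert, attachD]
    have hF : attachF F τ v (N + 1) = insert ((τ N).erase (v N)) (attachF F τ v N) := by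
      rw [attachF, Finset.range_add_one, Finset.image_insert, Finset.union_insert, attachF]
    rw [hD, hF]
    exact h₁.trans h₂

theorem relation (h : AttachSeq D F τ v N) {π : Type} [AddCommGroup π] {a : Finset W → π}
    (ha : ∀ σ ∉ attachF F τ v N, a σ = 0)
    (hc : ∀ ρ ∈ attachD D τ N, ρ ∉ D → cob a ρ = 0) {k : ℕ} (hk : k < N) {w : W}
    (hw : w ∈ τ k) (hvw : v k ≠ w)
    (hF : ∀ u ∈ τ k, u ≠ v k → u ≠ w → (τ k).erase u ∉ F)
    (hprev : ∀ j < k, ∀ u ∈ τ k, u ≠ v k → u ≠ w → (τ k).erase u ≠ (τ j).erase (v j)) :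
    (-1 : ℤ) ^ rankIn (τ k) (v k) • a ((τ k).erase (v k)) +
      (-1 : ℤ) ^ rankIn (τ k) w • a ((τ k).erase w) = 0 := by
  rw [← cob_eq_pair (h.mem k hk) hw hvw]
  · exact hc _ (mem_attachD.2 (Or.inr ⟨k, hk, rfl⟩))
      fun hm => h.not_subset k hk _ hm (Finset.erase_subset _ _)
  · intro u hu huv huw
    refine ha _ fun hm => ?_
    obtain hm | ⟨j, hj, hm⟩ := mem_attachF.1 hm
    · exact hF u hu huv huw hm
    · obtain hjk | rfl | hkj := lt_trichotomy j k
      · exact hprev j hjk u hu huv huw hm.symm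
      · exact huv (Finset.erase_injOn _ hu (h.mem j hj) hm.symm)
      · exact h.not_subset_prev j hj k hkj (hm.subset.trans (Finset.erase_subset _ _))

end AttachSeq
end SolvExt

/-! ### Ribbons of simplices -/

section Ribbon
variable {W : Type} [LinearOrder W]

/-- The set of `m` consecutive terms of a sequence, starting at index `k`. -/
def seqWindow (e : ℕ → W) (k m : ℕ) : Finset W := (Finset.Ico k (k + m)).image e

theorem mem_seqWindow {e : ℕ → W} {k m : ℕ} {v : W} :
    v ∈ seqWindow e k m ↔ ∃ i, k ≤ i ∧ i < k + m ∧ e i = v := by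
  simp [seqWindow, and_assoc]

theorem StrictMono.apply_mem_seqWindow {e : ℕ → W} (he : StrictMono e) {i k m : ℕ} :
    e i ∈ seqWindow e k m ↔ k ≤ i ∧ i < k + m := by
  rw [mem_seqWindow]
  constructor
  · rintro ⟨j, h1, h2, h3⟩
    rw [← he.injective h3]
    exact ⟨h1, h2⟩
  · exact fun h => ⟨i, h.1, h.2, rfl⟩

theorem card_seqWindow {e : ℕ → W} (he : StrictMono e) (k m : ℕ) : (seqWindow e k m).card = m := by
  rw [seqWindow, Finset.card_image_of_injective _ he.injective]
  simp

theorem rankIn_seqWindow {e : ℕ → W} (he : StrictMono e) {i k m : ℕ} (hi : i ≤ k + m) :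
    rankIn (seqWindow e k m) (e i) = i - k := by
  have : (seqWindow e k m).filter (· < e i) = (Finset.Ico k i).image e := by
    ext w
    simp only [Finset.mem_filter, mem_seqWindow, Finset.mem_image, Finset.mem_Ico]
    constructor
    · rintro ⟨⟨j, h1, h2, rfl⟩, h⟩
      exact ⟨j, ⟨h1, he.lt_iff_lt.1 h⟩, rfl⟩
    · rintro ⟨j, h, rfl⟩
      exact ⟨⟨j, h.1, by lia, rfl⟩, he h.2⟩
  rw [rankIn, this, Finset.card_image_of_injective _ he.injective, Nat.card_Ico]

theorem seqWindow_erase_first {e : ℕ → W} (he : StrictMono e) (k m : ℕ) :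
    (seqWindow e k (m + 1)).erase (e k) = seqWindow e (k + 1) m := by
  ext w
  simp only [Finset.mem_erase, mem_seqWindow]
  constructor
  · rintro ⟨h, j, h1, h2, rfl⟩
    have : j ≠ k := fun hh => h (hh ▸ rfl)
    exact ⟨j, by lia, by lia, rfl⟩
  · rintro ⟨j, h1, h2, rfl⟩
    exact ⟨fun h => by have := he.injective h; lia, j, by lia, by lia, rfl⟩

theorem seqWindow_erase_last {e : ℕ → W} (he : StrictMono e) (k m : ℕ) :
    (seqWindow e k (m + 1)).erase (e (k + m)) = seqWindow e k m := by
  ext w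
  simp only [Finset.mem_erase, mem_seqWindow]
  constructor
  · rintro ⟨h, j, h1, h2, rfl⟩
    have : j ≠ k + m := fun hh => h (hh ▸ rfl)
    exact ⟨j, by lia, by lia, rfl⟩
  · rintro ⟨j, h1, h2, rfl⟩
    exact ⟨fun h => by have := he.injective h; lia, j, by lia, by lia, rfl⟩

theorem seqWindow_congr {e e' : ℕ → W} {k k' m : ℕ} (h : ∀ i < m, e (k + i) = e' (k' + i)) :
    seqWindow e k m = seqWindow e' k' m := by
  ext w
  simp only [mem_seqWindow]
  constructor
  · rintro ⟨j, h1, h2, rfl⟩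
    exact ⟨k' + (j - k), by lia, by lia, by rw [← h _ (by lia)]; congr 1; lia⟩
  · rintro ⟨j, h1, h2, rfl⟩
    exact ⟨k + (j - k'), by lia, by lia, by rw [h _ (by lia)]; congr 1; lia⟩

/-- A finite set can be continued to an increasing sequence by a given one. -/
theorem exists_seqWindow_eq {φ : Finset W} {m : ℕ} (hφ : φ.card = m) {x : ℕ → W}
    (hx : StrictMono x) (hlt : ∀ v ∈ φ, v < x 0) :
    ∃ e : ℕ → W, StrictMono e ∧ seqWindow e 0 m = φ ∧ ∀ j, e (m + j) = x j := by
  let e : ℕ → W := fun i => if h : i < m then φ.orderEmbOfFin hφ ⟨i, h⟩ else x (i - m)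
  have h1 : ∀ i (h : i < m), e i = φ.orderEmbOfFin hφ ⟨i, h⟩ := fun i h => dif_pos h
  have h2 : ∀ j, e (m + j) = x j := fun j => by
    simp only [e]
    rw [dif_neg (by lia), Nat.add_sub_cancel_left]
  refine ⟨e, fun i j hij => ?_, ?_, h2⟩
  · by_cases hj : j < m
    · rw [h1 i (by lia), h1 j hj]
      exact (φ.orderEmbOfFin hφ).strictMono hij
    · obtain ⟨j, rfl⟩ := Nat.exists_eq_add_of_le (not_lt.1 hj)
      rw [h2]
      by_cases hi : i < m
      · rw [h1 i hi]
        exact (hlt _ (Finset.orderEmbOfFin_mem φ hφ _)).trans_le (hx.monotone (Nat.zero_le j))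
      · obtain ⟨i, rfl⟩ := Nat.exists_eq_add_of_le (not_lt.1 hi)
        rw [h2]
        exact hx (by lia)
  · rw [← Finset.coe_inj, ← Finset.range_orderEmbOfFin φ hφ]
    ext w
    simp only [Finset.mem_coe, mem_seqWindow, Set.mem_range]
    constructor
    · rintro ⟨i, -, hi, rfl⟩
      exact ⟨⟨i, by lia⟩, (h1 i _).symm⟩
    · rintro ⟨i, rfl⟩
      exact ⟨i, by lia, by lia, h1 i i.2⟩

theorem eq_neg_one_pow_smul_of_relation {π : Type*} [AddCommGroup π] {N k : ℕ} {b : ℕ → π} {p : ℕ}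
    (h : ∀ j < N, b (j + 1) + (-1 : ℤ) ^ (p + 1) • b j = 0) (hk : k ≤ N) :
    b k = (-1 : ℤ) ^ (p * k) • b 0 := by
  induction k with
  | zero => simp
  | succ k ih =>
    rw [eq_neg_of_add_eq_zero_left (h k (by lia)), ih (by lia), ← mul_smul, ← neg_smul]
    congr 1
    ring

variable {D F : Finset (Finset W)} {n : ℕ}

theorem attachSeq_upper {e : ℕ → W} (he : StrictMono e)
    (hDF : ∀ s, s ∈ D ∨ s ∈ F → ∀ j, e (n + 1 + j) ∉ s) :
    AttachSeq D F (fun k => seqWindow e k (n + 2)) e (n + 1) := by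
  have hmem : ∀ k, e (n + 1 + k) ∈ (seqWindow e k (n + 2)).erase (e k) := fun k => by
    rw [seqWindow_erase_first he, he.apply_mem_seqWindow]; lia
  refine ⟨fun k _ => ?_, fun k _ h => ?_, fun k _ ρ hρ h => ?_, fun k _ j hj h => ?_⟩
  · rw [he.apply_mem_seqWindow]; lia
  · exact hDF _ (Or.inr h) k (hmem k)
  · exact hDF _ (Or.inl hρ) k (h (hmem k))
  · have := (he.apply_mem_seqWindow).1 (h (hmem k))
    lia

theorem attachSeq_upper_relation {e : ℕ → W} (he : StrictMono e)
    (hDF : ∀ s, s ∈ D ∨ s ∈ F → ∀ j, e (n + 1 + j) ∉ s)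
    {π : Type} [AddCommGroup π] {a : Finset W → π}
    (ha : ∀ σ ∉ attachF F (fun k => seqWindow e k (n + 2)) e (n + 1), a σ = 0)
    (hc : ∀ ρ ∈ attachD D (fun k => seqWindow e k (n + 2)) (n + 1), ρ ∉ D → cob a ρ = 0) :
    a (seqWindow e (n + 1) (n + 1)) = a (seqWindow e 0 (n + 1)) := by
  have hmem : ∀ k, e (n + 1 + k) ∈ seqWindow e k (n + 2) := fun k => by
    rw [he.apply_mem_seqWindow]; lia
  have key := eq_neg_one_pow_smul_of_relation (N := n + 1) (k := n + 1) (p := n)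
    (b := fun k => a (seqWindow e k (n + 1))) (fun k hk => by
      have h := (attachSeq_upper he hDF).relation ha hc hk (w := e (n + 1 + k)) (hmem k)
        (fun h => by have := he.injective h; lia)
        (fun u hu _ huw h => hDF _ (Or.inr h) k (Finset.mem_erase.2 ⟨Ne.symm huw, hmem k⟩))
        (fun j hj u hu _ huw h => by
          have h1 : e (n + 1 + k) ∈ (seqWindow e k (n + 2)).erase u :=
            Finset.mem_erase.2 ⟨Ne.symm huw, hmem k⟩
          rw [h] at h1
          have := (he.apply_mem_seqWindow).1 (Finset.mem_of_mem_erase h1)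
          lia)
      rw [rankIn_seqWindow he (by lia), rankIn_seqWindow he (by lia), seqWindow_erase_first he,
        show n + 1 + k = k + (n + 1) by lia, seqWindow_erase_last he] at h
      simpa using h) le_rfl
  beta_reduce at key
  rw [key, (Nat.even_mul_succ_self n).neg_one_pow, one_smul]

theorem rankIn_insert_of_le {s : Finset W} {y u : W} (h : u ≤ y) :
    rankIn (insert y s) u = rankIn s u := by
  rw [rankIn, rankIn, Finset.filter_insert, if_neg h.not_gt]

theorem rankIn_eq_card {s : Finset W} {y : W} (h : ∀ u ∈ s, u < y) : rankIn s y = s.card := by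
  rw [rankIn, Finset.filter_true_of_mem h]

section Lower
variable {f : ℕ → W} {y : W}

theorem lower_erase_first (hf : StrictMono f) (hy : ∀ i ≤ n + n, f i < y) {k : ℕ} (hk : k ≤ n) :
    (insert y (seqWindow f k (n + 1))).erase (f k) = insert y (seqWindow f (k + 1) n) := by
  rw [Finset.erase_insert_of_ne (hy k (by lia)).ne', seqWindow_erase_first hf]

theorem attachSeq_lower (hf : StrictMono f) (hy : ∀ i ≤ n + n, f i < y)
    (hDF : ∀ s, s ∈ D ∨ s ∈ F → y ∉ s) :
    AttachSeq D F (fun k => insert y (seqWindow f k (n + 1))) f (n + 1) := by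
  refine ⟨fun k _ => ?_, fun k hk h => ?_, fun k hk ρ hρ h => ?_, fun k hk j hj h => ?_⟩
  · exact Finset.mem_insert_of_mem (hf.apply_mem_seqWindow.2 (by lia))
  · rw [lower_erase_first hf hy (by lia)] at h
    exact hDF _ (Or.inr h) (Finset.mem_insert_self _ _)
  · rw [lower_erase_first hf hy (by lia)] at h
    exact hDF _ (Or.inl hρ) (h (Finset.mem_insert_self _ _))
  · rw [lower_erase_first hf hy (by lia)] at h
    have h1 : f (k + n) ∈ seqWindow f (k + 1) n := by rw [hf.apply_mem_seqWindow]; lia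
    have h2 := h (Finset.mem_insert_of_mem h1)
    rw [Finset.mem_insert, hf.apply_mem_seqWindow] at h2
    exact h2.elim (hy _ (by lia)).ne (by lia)

theorem attachSeq_lower_relation (hn : 1 ≤ n) (hf : StrictMono f) (hy : ∀ i ≤ n + n, f i < y)
    (hDF : ∀ s, s ∈ D ∨ s ∈ F → y ∉ s)
    (hF : ∀ k, 1 ≤ k → k ≤ n → seqWindow f k (n + 1) ∉ F)
    {π : Type} [AddCommGroup π] {a : Finset W → π}
    (ha : ∀ σ ∉ attachF F (fun k => insert y (seqWindow f k (n + 1))) f (n + 1), a σ = 0)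
    (hc : ∀ ρ ∈ attachD D (fun k => insert y (seqWindow f k (n + 1))) (n + 1), ρ ∉ D →
      cob a ρ = 0) :
    a (insert y (seqWindow f (n + 1) n)) = (-1 : ℤ) ^ n • a (seqWindow f 0 (n + 1)) := by
  have h := attachSeq_lower hf hy hDF
  have hlt : ∀ k ≤ n, ∀ u ∈ seqWindow f k (n + 1), u < y := by
    intro k hk u hu
    obtain ⟨i, -, hi, rfl⟩ := mem_seqWindow.1 hu
    exact hy i (by lia)
  have hmem : ∀ k, f (k + n) ∈ insert y (seqWindow f k (n + 1)) := fun k =>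
    Finset.mem_insert_of_mem (hf.apply_mem_seqWindow.2 (by lia))
  have hyn : ∀ k ≤ n, y ∉ seqWindow f k (n + 1) := fun k hk h => (hlt k hk y h).false
  have hy_mem : ∀ {k : ℕ} {u : W}, u ≠ y → y ∈ (insert y (seqWindow f k (n + 1))).erase u :=
    fun hu => Finset.mem_erase.2 ⟨hu.symm, Finset.mem_insert_self _ _⟩
  have h0 : a (insert y (seqWindow f 1 n)) = (-1 : ℤ) ^ n • a (seqWindow f 0 (n + 1)) := by
    have h1 := h.relation ha hc (k := 0) (by lia) (w := y) (Finset.mem_insert_self _ _)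
      (hy 0 (by lia)).ne (fun u hu _ huw hs => hDF _ (Or.inr hs) (hy_mem huw))
      (fun j hj => by lia)
    rw [lower_erase_first hf hy (by lia), rankIn_insert_of_le (hy 0 (by lia)).le,
      rankIn_seqWindow hf (by lia), rankIn_insert_of_le le_rfl, rankIn_eq_card (hlt 0 (by lia)),
      card_seqWindow hf, Finset.erase_insert (hyn 0 (by lia)), pow_succ] at h1
    simpa [add_neg_eq_zero] using h1
  have key := eq_neg_one_pow_smul_of_relation (N := n) (k := n) (p := n - 1)
    (b := fun k => a (insert y (seqWindow f (k + 1) n))) (fun k hk => by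
      have h1 := h.relation ha hc (k := k + 1) (by lia) (w := f (k + 1 + n)) (hmem _)
        (fun h => by have := hf.injective h; lia)
        (fun u hu _ huw hs => by
          by_cases huy : u = y
          · rw [huy, Finset.erase_insert (hyn _ (by lia))] at hs
            exact hF (k + 1) (by lia) (by lia) hs
          · exact hDF _ (Or.inr hs) (hy_mem huy))
        (fun j hj u hu _ huw hs => by
          have h2 : f (k + 1 + n) ∈ (insert y (seqWindow f (k + 1) (n + 1))).erase u :=
            Finset.mem_erase.2 ⟨Ne.symm huw, hmem _⟩
          rw [hs] at h2
          have h3 := Finset.mem_of_mem_erase h2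
          rw [Finset.mem_insert, hf.apply_mem_seqWindow] at h3
          exact h3.elim (hy _ (by lia)).ne (by lia))
      have hyk := hy (k + 1 + n) (by lia)
      rw [lower_erase_first hf hy (by lia), rankIn_insert_of_le (hy _ (by lia)).le,
        rankIn_seqWindow hf (by lia), rankIn_insert_of_le hyk.le, rankIn_seqWindow hf (by lia),
        Finset.erase_insert_of_ne hyk.ne', seqWindow_erase_last hf] at h1
      rw [Nat.sub_add_cancel hn]
      simpa using h1) le_rfl
  beta_reduce at key
  obtain ⟨m, rfl⟩ := Nat.exists_eq_add_of_le' hn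
  rw [key, Nat.add_sub_cancel, (Nat.even_mul_succ_self m).neg_one_pow, one_smul, zero_add, h0]

end Lower

end Ribbon

section Difference
variable {W : Type} [LinearOrder W] {D F : Finset (Finset W)} {n : ℕ}

/-- The equations live on `(n+1)`-simplices and the unknowns on `n`-simplices. -/
def Graded (D F : Finset (Finset W)) (n : ℕ) : Prop :=
  (∀ τ ∈ D, τ.card = n + 2) ∧ ∀ σ ∈ F, σ.card = n + 1

theorem Graded.insert (h : Graded D F n) {τ : Finset W} {v : W} (hv : v ∈ τ)
    (hτ : τ.card = n + 2) : Graded (insert τ D) (insert (τ.erase v) F) n := by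
  refine ⟨fun ρ hρ => ?_, fun σ hσ => ?_⟩
  · obtain rfl | hρ := Finset.mem_insert.1 hρ
    exacts [hτ, h.1 ρ hρ]
  · obtain rfl | hσ := Finset.mem_insert.1 hσ
    · rw [Finset.card_erase_of_mem hv, hτ]; rfl
    · exact h.2 σ hσ

theorem AttachSeq.graded {τ : ℕ → Finset W} {v : ℕ → W} {N : ℕ} (h : AttachSeq D F τ v N)
    (hDF : Graded D F n) (hτ : ∀ k < N, (τ k).card = n + 2) :
    Graded (attachD D τ N) (attachF F τ v N) n := by
  refine ⟨fun ρ hρ => ?_, fun σ hσ => ?_⟩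
  · obtain hρ | ⟨k, hk, rfl⟩ := mem_attachD.1 hρ
    exacts [hDF.1 ρ hρ, hτ k hk]
  · obtain hσ | ⟨k, hk, rfl⟩ := mem_attachF.1 hσ
    · exact hDF.2 σ hσ
    · rw [Finset.card_erase_of_mem (h.mem k hk), hτ k hk]; rfl

theorem exists_seq_above [NoMaxOrder W] [Nonempty W] (U : Finset W) :
    ∃ x : ℕ → W, StrictMono x ∧ ∀ u ∈ U, ∀ j, u < x j := by
  obtain ⟨M, hM⟩ := U.exists_le
  obtain ⟨M', hM'⟩ := exists_gt M
  obtain ⟨x, hx, rfl⟩ := Nat.exists_strictMono' M'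
  exact ⟨x, hx, fun u hu j => (hM u hu).trans_lt (hM'.trans_le (hx.monotone (Nat.zero_le j)))⟩

theorem exists_signed_difference [NoMaxOrder W] [Nonempty W] (hn : 1 ≤ n) (hDF : Graded D F n)
    {φ₁ φ₂ : Finset W} (h₁ : φ₁ ∈ F) (h₂ : φ₂ ∈ F) :
    ∃ D' F', SolvExt D F D' F' ∧ Graded D' F' n ∧ ∃ φ ∈ F', ∀ (π : Type) [AddCommGroup π]
      (a : Finset W → π), (∀ σ ∉ F', a σ = 0) → (∀ τ ∈ D', τ ∉ D → cob a τ = 0) →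
      a φ = (-1 : ℤ) ^ n • (a φ₂ - a φ₁) := by
  obtain ⟨x, hx, hxU⟩ := exists_seq_above ((D ∪ F).biUnion id)
  replace hxU : ∀ s, s ∈ D ∨ s ∈ F → ∀ u ∈ s, ∀ j, u < x j := fun s hs u hu j =>
    hxU u (Finset.mem_biUnion.2 ⟨s, Finset.mem_union.2 hs, hu⟩) j
  have hxs : ∀ s, s ∈ D ∨ s ∈ F → ∀ j, x j ∉ s := fun s hs j h => (hxU s hs _ h j).false
  obtain ⟨e, he, heφ, hex⟩ := exists_seqWindow_eq (hDF.2 φ₁ h₁) hx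
    fun v hv => hxU _ (Or.inr h₁) v hv 0
  obtain ⟨f, hf, hfφ, hfx⟩ := exists_seqWindow_eq (hDF.2 φ₂ h₂)
    (hx.comp (g := x) (f := fun j => j + 1) fun i j h => by simpa using h)
    fun v hv => hxU _ (Or.inr h₂) v hv 1
  simp only [Function.comp_apply] at hfx
  have hfn : f n < x 0 := hxU _ (Or.inr h₂) _
    (by rw [← hfφ, hf.apply_mem_seqWindow]; lia) 0
  have hfx0 : ∀ i, f i ≠ x 0 := by
    intro i h
    obtain hi | hi := le_or_gt i n
    · exact ((hf.monotone hi).trans_lt hfn).ne h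
    · obtain ⟨j, rfl⟩ := Nat.exists_eq_add_of_le (Nat.succ_le_of_lt hi)
      have := hx.injective ((hfx j).symm.trans h)
      lia
  have hfy : ∀ i ≤ n + n, f i < x (n + 1) := by
    intro i hi
    refine (hf.monotone hi).trans_lt ?_
    rw [show n + n = n + 1 + (n - 1) by lia, hfx]
    exact hx (by lia)
  have hA₁ := attachSeq_upper (D := D) (F := F) (n := n) he fun s hs j => hex j ▸ hxs s hs j
  have hE₁ := hA₁.solvExt
  have hG₁ := hA₁.graded hDF fun k _ => card_seqWindow he k (n + 2)
  have hR₁ := fun (π : Type) [AddCommGroup π] (a : Finset W → π) => attachSeq_upper_relation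
    (D := D) (F := F) (n := n) he (fun s hs j => hex j ▸ hxs s hs j) (a := a)
  have hyw : ∀ k < n + 1, x (n + 1) ∉ seqWindow e k (n + 2) := by
    intro k hk h
    rw [← hex, he.apply_mem_seqWindow] at h
    lia
  have hP₁ : ∀ s, s ∈ attachD D (fun k => seqWindow e k (n + 2)) (n + 1) ∨
      s ∈ attachF F (fun k => seqWindow e k (n + 2)) e (n + 1) → x (n + 1) ∉ s := by
    rintro s (hs | hs)
    · obtain hs | ⟨k, hk, rfl⟩ := mem_attachD.1 hs
      exacts [hxs s (Or.inl hs) _, hyw k hk]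
    · obtain hs | ⟨k, hk, rfl⟩ := mem_attachF.1 hs
      exacts [hxs s (Or.inr hs) _, fun h => hyw k hk (Finset.mem_of_mem_erase h)]
  have hQ₁ : ∀ k, 1 ≤ k → k ≤ n →
      seqWindow f k (n + 1) ∉ attachF F (fun k => seqWindow e k (n + 2)) e (n + 1) := by
    intro k hk hkn h
    obtain h | ⟨j, hj, h⟩ := mem_attachF.1 h
    · have hm : f (n + 1 + (k - 1)) ∈ seqWindow f k (n + 1) := by
        rw [hf.apply_mem_seqWindow]; lia
      rw [hfx] at hm
      exact hxs _ (Or.inr h) _ hm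
    · have hm : e (n + 1 + 0) ∈ seqWindow f k (n + 1) := by
        rw [← h, seqWindow_erase_first he, he.apply_mem_seqWindow]; lia
      rw [hex] at hm
      obtain ⟨i, -, -, hi⟩ := mem_seqWindow.1 hm
      exact hfx0 i hi
  generalize attachD D (fun k => seqWindow e k (n + 2)) (n + 1) = D₁ at *
  generalize hF₁ : attachF F (fun k => seqWindow e k (n + 2)) e (n + 1) = F₁ at *
  have hA₂ := attachSeq_lower hf hfy hP₁
  have hE₂ := hA₂.solvExt
  have hcard : ∀ k < n + 1, (insert (x (n + 1)) (seqWindow f k (n + 1))).card = n + 2 := by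
    intro k hk
    rw [Finset.card_insert_of_notMem, card_seqWindow hf]
    intro h
    obtain ⟨i, -, hi, h⟩ := mem_seqWindow.1 h
    exact (hfy i (by lia)).ne h
  have hG₂ := hA₂.graded hG₁ hcard
  have hR₂ := fun (π : Type) [AddCommGroup π] (a : Finset W → π) =>
    attachSeq_lower_relation hn hf hfy hP₁ hQ₁ (a := a)
  have hx0 : ∀ k, x 0 ∉ insert (x (n + 1)) (seqWindow f k (n + 1)) := by
    intro k h
    rw [Finset.mem_insert, mem_seqWindow] at h
    obtain h | ⟨i, -, -, h⟩ := h
    · have := hx.injective h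
      lia
    · exact hfx0 i h
  have hP₂ : ∀ s, s ∈ attachD D₁ (fun k => insert (x (n + 1)) (seqWindow f k (n + 1))) (n + 1) ∨
      s ∈ attachF F₁ (fun k => insert (x (n + 1)) (seqWindow f k (n + 1))) f (n + 1) →
      x 0 ∈ s → x (n + 1) ∉ s := by
    rintro s (hs | hs) h0
    · obtain hs | ⟨k, hk, rfl⟩ := mem_attachD.1 hs
      exacts [hP₁ s (Or.inl hs), (hx0 k h0).elim]
    · obtain hs | ⟨k, hk, rfl⟩ := mem_attachF.1 hs
      exacts [hP₁ s (Or.inr hs), (hx0 k (Finset.mem_of_mem_erase h0)).elim]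
  have hlast : seqWindow e (n + 1) (n + 1) ∈ F₁ := by
    rw [← hF₁]
    refine mem_attachF.2 (Or.inr ⟨n, by lia, ?_⟩)
    rw [seqWindow_erase_first he]
  have hlast₂ : insert (x (n + 1)) (seqWindow f (n + 1) n) ∈
      attachF F₁ (fun k => insert (x (n + 1)) (seqWindow f k (n + 1))) f (n + 1) :=
    mem_attachF.2 (Or.inr ⟨n, by lia, lower_erase_first hf hfy le_rfl⟩)
  generalize attachD D₁ (fun k => insert (x (n + 1)) (seqWindow f k (n + 1))) (n + 1) = D₂ at *
  generalize attachF F₁ (fun k => insert (x (n + 1)) (seqWindow f k (n + 1))) f (n + 1) = F₂ at *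
  have hm : ∀ i ≤ n + 1, x i ∈ seqWindow x 0 (n + 2) := fun i hi => by
    rw [hx.apply_mem_seqWindow]; lia
  have hne : ∀ i j, i ≠ j → x i ≠ x j := fun i j h h' => h (hx.injective h')
  have hme : ∀ i ≤ n + 1, ∀ u, x i ≠ u → x i ∈ (seqWindow x 0 (n + 2)).erase u :=
    fun i hi u hu => Finset.mem_erase.2 ⟨hu, hm i hi⟩
  have h0φ := hme 0 (by lia) (x 1) (hne _ _ (by lia))
  have hyφ := hme (n + 1) le_rfl (x 1) (hne _ _ (by lia))
  have hE₃ := SolvExt.step (D := D₂) (F := F₂) (hm 1 (by lia))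
    (fun h => hP₂ _ (Or.inr h) h0φ hyφ) (fun ρ hρ h => hP₂ _ (Or.inl hρ) (h h0φ) (h hyφ))
  have hτ : seqWindow x 0 (n + 2) ∉ D₂ := fun h =>
    hP₂ _ (Or.inl h) (hm 0 (by lia)) (hm (n + 1) le_rfl)
  refine ⟨_, _, hE₁.trans (hE₂.trans hE₃), hG₂.insert (hm 1 (by lia)) (card_seqWindow hx 0 _), _,
    Finset.mem_insert_self _ _, fun π _ a ha hc => ?_⟩
  obtain ⟨a₂, ha₂, ha₂a, hc₂⟩ := hE₃.exists_restrict ha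
  obtain ⟨a₁, ha₁, ha₁a, hc₁⟩ := hE₂.exists_restrict ha₂
  have r₁ := hR₁ π a₁ ha₁ fun ρ hρ hρ' => by
    rw [hc₁ ρ hρ, hc₂ ρ (hE₂.subD hρ), hc ρ (hE₃.subD (hE₂.subD hρ)) hρ']
  have r₂ := hR₂ π a₂ ha₂ fun ρ hρ hρ' => by
    rw [hc₂ ρ hρ, hc ρ (hE₃.subD hρ) fun h => hρ' (hE₁.subD h)]
  have hφ₁ := hE₁.subF h₁
  have hφ₂ := hE₂.subF (hE₁.subF h₂)
  rw [heφ, ha₁a _ hφ₁, ha₁a _ hlast, ha₂a _ (hE₂.subF hφ₁), ha₂a _ (hE₂.subF hlast)] at r₁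
  rw [hfφ, ha₂a _ hφ₂, ha₂a _ hlast₂] at r₂
  have hY₁ : (seqWindow x 0 (n + 2)).erase (x (n + 1)) = seqWindow e (n + 1) (n + 1) := by
    have := seqWindow_erase_last hx 0 (n + 1)
    rw [zero_add] at this
    rw [this]
    exact seqWindow_congr fun i _ => by rw [hex, zero_add]
  have hY₂ : (seqWindow x 0 (n + 2)).erase (x 0) = insert (x (n + 1)) (seqWindow f (n + 1) n) := by
    have hw : seqWindow f (n + 1) n = seqWindow x 1 n := seqWindow_congr fun i _ => by
      rw [hfx, add_comm]
    rw [seqWindow_erase_first hx, hw, zero_add, ← seqWindow_erase_last hx 1 n, add_comm 1 n,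
      Finset.insert_erase]
    rw [hx.apply_mem_seqWindow]
    lia
  have key := hc _ (Finset.mem_insert_self _ _) fun h => hτ (hE₂.subD (hE₁.subD h))
  have hsub : ({x 0, x 1, x (n + 1)} : Finset W) ⊆ seqWindow x 0 (n + 2) := by
    simp only [Finset.insert_subset_iff, Finset.singleton_subset_iff]
    exact ⟨hm 0 (by lia), hm 1 (by lia), hm _ le_rfl⟩
  rw [cob, ← Finset.sum_subset hsub, Finset.sum_insert, Finset.sum_pair (hne _ _ (by lia))] at key
  · have hr := fun i hi => rankIn_seqWindow hx (i := i) (k := 0) (m := n + 2) hi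
    simp only [rankIn, Nat.sub_zero] at hr
    rw [hr 0 (by lia), hr 1 (by lia), hr (n + 1) (by lia), hY₁, hY₂, r₁, r₂, pow_zero, one_smul,
      pow_one, neg_one_smul, pow_succ, mul_neg_one, neg_smul] at key
    rw [smul_sub, ← sub_eq_zero, ← neg_eq_zero, ← key]
    abel
  · simp only [Finset.mem_insert, Finset.mem_singleton, not_or]
    exact ⟨hne _ _ (by lia), hne _ _ (by lia)⟩
  · intro u hu hu'
    simp only [Finset.mem_insert, Finset.mem_singleton, not_or] at hu'
    have hu0 := hme 0 (by lia) u (Ne.symm hu'.1)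
    have huy := hme (n + 1) le_rfl u (Ne.symm hu'.2.2)
    rw [ha, smul_zero]
    intro h
    obtain h | h := Finset.mem_insert.1 h
    · exact hu'.2.1 (Finset.erase_injOn _ hu (hm 1 (by lia)) h)
    · exact hP₂ _ (Or.inr h) hu0 huy

theorem exists_difference [NoMaxOrder W] [Nonempty W] (hn : 1 ≤ n) (hDF : Graded D F n)
    {φ₁ φ₂ : Finset W} (h₁ : φ₁ ∈ F) (h₂ : φ₂ ∈ F) :
    ∃ D' F', SolvExt D F D' F' ∧ Graded D' F' n ∧ ∃ φ ∈ F', ∀ (π : Type) [AddCommGroup π]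
      (a : Finset W → π), (∀ σ ∉ F', a σ = 0) → (∀ τ ∈ D', τ ∉ D → cob a τ = 0) →
      a φ = a φ₁ - a φ₂ := by
  obtain hp | hp := n.even_or_odd
  · obtain ⟨D', F', hE, hG, φ, hφ, h⟩ := exists_signed_difference hn hDF h₂ h₁
    exact ⟨D', F', hE, hG, φ, hφ, fun π _ a ha hc => by
      rw [h π a ha hc, hp.neg_one_pow, one_smul]⟩
  · obtain ⟨D', F', hE, hG, φ, hφ, h⟩ := exists_signed_difference hn hDF h₁ h₂
    exact ⟨D', F', hE, hG, φ, hφ, fun π _ a ha hc => by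
      rw [h π a ha hc, hp.neg_one_pow, neg_one_smul, neg_sub]⟩

end Difference

section Represent
variable {W : Type} [LinearOrder W] {D F D' F' D'' F'' : Finset (Finset W)} {n : ℕ}

/-- In every solution over `(D', F')`, the value at `φ` is the combination `z` of the values on
the unknowns `F` of the initial system. -/
def Represents (D F D' F' : Finset (Finset W)) (φ : Finset W) (z : Finset W → ℤ) : Prop :=
  φ ∈ F' ∧ ∀ (π : Type) [AddCommGroup π] (a : Finset W → π), (∀ σ ∉ F', a σ = 0) →
    (∀ τ ∈ D', τ ∉ D → cob a τ = 0) → a φ = ∑ σ ∈ F, z σ • a σ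

theorem Represents.mono {φ : Finset W} {z : Finset W → ℤ} (h : Represents D F D' F' φ z)
    (hF : F ⊆ F') (hE : SolvExt D' F' D'' F'') : Represents D F D'' F'' φ z := by
  refine ⟨hE.subF h.1, fun π _ a ha hc => ?_⟩
  obtain ⟨a', ha', haa, hc'⟩ := hE.exists_restrict ha
  rw [← haa φ h.1, h.2 π a' ha' fun τ hτ hτ' => by rw [hc' τ hτ, hc τ (hE.subD hτ) hτ']]
  exact Finset.sum_congr rfl fun σ hσ => by rw [haa σ (hF hσ)]

/-- The combinations represented after some further extension of any given extension. -/
def Representable (D F : Finset (Finset W)) (n : ℕ) (z : Finset W → ℤ) : Prop :=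
  ∀ D' F', SolvExt D F D' F' → Graded D' F' n → ∃ D'' F'', SolvExt D' F' D'' F'' ∧
    Graded D'' F'' n ∧ ∃ φ, Represents D F D'' F'' φ z

theorem representable_single {σ : Finset W} (hσ : σ ∈ F) :
    Representable D F n (Pi.single σ 1) := by
  refine fun D' F' hE hG => ⟨D', F', SolvExt.refl _ _, hG, σ, hE.subF hσ, fun π _ a _ _ => ?_⟩
  rw [Finset.sum_eq_single_of_mem σ hσ, Pi.single_eq_same, one_smul]
  intro ρ _ hρ
  rw [Pi.single_eq_of_ne hρ, zero_smul]

theorem Representable.sub [NoMaxOrder W] [Nonempty W] (hn : 1 ≤ n) {z₁ z₂ : Finset W → ℤ}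
    (h₁ : Representable D F n z₁) (h₂ : Representable D F n z₂) :
    Representable D F n (z₁ - z₂) := by
  intro D₀ F₀ hE₀ hG₀
  obtain ⟨D₁, F₁, hE₁, hG₁, φ₁, hφ₁⟩ := h₁ D₀ F₀ hE₀ hG₀
  obtain ⟨D₂, F₂, hE₂, hG₂, φ₂, hφ₂⟩ := h₂ D₁ F₁ (hE₀.trans hE₁) hG₁
  have hφ₁' := hφ₁.mono (hE₀.trans hE₁).subF hE₂
  obtain ⟨D₃, F₃, hE₃, hG₃, φ, hφ, h⟩ := exists_difference hn hG₂ hφ₁'.1 hφ₂.1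
  have hE := hE₀.trans (hE₁.trans hE₂)
  refine ⟨D₃, F₃, hE₁.trans (hE₂.trans hE₃), hG₃, φ, hφ, fun π _ a ha hc => ?_⟩
  rw [h π a ha fun τ hτ hτ' => hc τ hτ fun hD => hτ' (hE.subD hD),
    (hφ₁'.mono hE.subF hE₃).2 π a ha hc, (hφ₂.mono hE.subF hE₃).2 π a ha hc,
    ← Finset.sum_sub_distrib]
  exact Finset.sum_congr rfl fun σ _ => by rw [Pi.sub_apply, sub_smul]

theorem representable [NoMaxOrder W] [Nonempty W] (hn : 1 ≤ n) (hF : F.Nonempty)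
    (z : Finset W → ℤ) : Representable D F n z := by
  obtain ⟨σ₀, hσ₀⟩ := hF
  have h0 : Representable D F n 0 := by
    simpa using (representable_single (D := D) (n := n) hσ₀).sub hn (representable_single hσ₀)
  let H : AddSubgroup (Finset W → ℤ) := AddSubgroup.ofSub {z | Representable D F n z}
    ⟨0, h0⟩ fun z₁ h₁ z₂ h₂ => by
      rw [← sub_eq_add_neg]
      exact Representable.sub hn h₁ h₂
  have hz : ∑ σ ∈ F, z σ • (Pi.single σ 1 : Finset W → ℤ) ∈ H :=
    sum_mem fun σ hσ => zsmul_mem (show _ ∈ H from representable_single hσ) _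
  intro D' F' hE hG
  obtain ⟨D'', F'', hE', hG', φ, hφ, h⟩ := (show Representable D F n _ from hz) D' F' hE hG
  refine ⟨D'', F'', hE', hG', φ, hφ, fun π _ a ha hc => ?_⟩
  rw [h π a ha hc]
  refine Finset.sum_congr rfl fun σ hσ => ?_
  congr 1
  rw [Finset.sum_apply, Finset.sum_eq_single_of_mem σ hσ]
  · simp
  · intro ρ _ hρ
    simp [Pi.single_eq_of_ne hρ.symm]

theorem exists_represents_family [NoMaxOrder W] [Nonempty W] (hn : 1 ≤ n) (hF : F.Nonempty)
    (hG : Graded D F n) (z : Finset W → Finset W → ℤ) (S : Finset (Finset W)) :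
    ∃ D' F', SolvExt D F D' F' ∧ Graded D' F' n ∧
      ∀ σ ∈ S, ∃ φ, Represents D F D' F' φ (z σ) := by
  induction S using Finset.induction_on with
  | empty => exact ⟨D, F, SolvExt.refl _ _, hG, by simp⟩
  | insert σ S _ ih =>
    obtain ⟨D', F', hE, hG', h⟩ := ih
    obtain ⟨D'', F'', hE', hG'', hφ⟩ := representable hn hF (z σ) D' F' hE hG'
    refine ⟨D'', F'', hE.trans hE', hG'', fun ρ hρ => ?_⟩
    obtain rfl | hρ := Finset.mem_insert.1 hρ
    · exact hφ
    · obtain ⟨φ, hφ⟩ := h ρ hρ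
      exact ⟨φ, hφ.mono hE.subF hE'⟩

/-- Disjoint from any finite family there are injectively indexed sets of given size. -/
theorem exists_fresh_family [NoMaxOrder W] [Nonempty W] (D F : Finset (Finset W)) (n : ℕ) :
    ∃ φ : Finset W → Finset W, Set.InjOn φ D ∧ ∀ τ, (φ τ).card = n + 1 ∧ φ τ ∉ F := by
  obtain ⟨x, hx, hxU⟩ := exists_seq_above (F.biUnion id)
  obtain ⟨i, hi⟩ := Set.countable_iff_exists_injOn.1 D.countable_toSet
  have hm : ∀ k, x k ∈ seqWindow x k (n + 1) := fun k => by rw [hx.apply_mem_seqWindow]; lia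
  refine ⟨fun τ => seqWindow x (i τ) (n + 1), fun τ hτ ρ hρ h => hi hτ hρ ?_,
    fun τ => ⟨card_seqWindow hx _ _, fun h => ?_⟩⟩
  · beta_reduce at h
    have h1 := hm (i τ)
    have h2 := hm (i ρ)
    rw [h, hx.apply_mem_seqWindow] at h1
    rw [← h, hx.apply_mem_seqWindow] at h2
    lia
  · exact (hxU _ (Finset.mem_biUnion.2 ⟨_, h, hm _⟩) _).false

theorem exists_bijective_system [NoMaxOrder W] [Nonempty W] (hn : 1 ≤ n) (hG : Graded D F n)
    (hF : F.Nonempty) (hfacet : ∀ τ ∈ D, ∀ v ∈ τ, τ.erase v ∈ F) {f : Finset W → Finset W → ℤ}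
    (hf : ∀ τ ∈ D, ∀ ρ ∈ D, cob (f τ) ρ = if τ = ρ then 1 else 0) :
    ∃ D' F', D ⊆ D' ∧ Graded D' F' n ∧
      (∀ (π : Type) [AddCommGroup π] (a : Finset W → π), (∀ σ ∉ F', a σ = 0) →
        (∀ τ ∈ D', cob a τ = 0) → ∀ σ, a σ = 0) ∧
      ∀ (π : Type) [AddCommGroup π] (b : Finset W → π), ∃ a : Finset W → π,
        (∀ σ ∉ F', a σ = 0) ∧ ∀ τ ∈ D', cob a τ = b τ := by
  classical
  obtain ⟨φ, hinj, hφ⟩ := exists_fresh_family D F n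
  let z : Finset W → Finset W → ℤ := fun σ =>
    Pi.single σ 1 - ∑ τ ∈ D, f τ σ • (Pi.single (φ τ) 1 : Finset W → ℤ)
  have hG₁ : Graded D (F ∪ D.image φ) n := ⟨hG.1, fun σ hσ => by
    obtain hσ | hσ := Finset.mem_union.1 hσ
    · exact hG.2 σ hσ
    · obtain ⟨τ, -, rfl⟩ := Finset.mem_image.1 hσ
      exact (hφ τ).1⟩
  have hφF : ∀ τ ∈ D, φ τ ∈ F ∪ D.image φ := fun τ hτ =>
    Finset.mem_union_right _ (Finset.mem_image_of_mem _ hτ)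
  obtain ⟨D', F', hE, hG', hrep⟩ := exists_represents_family hn
    (hF.mono Finset.subset_union_left) hG₁ z F
  have hsingle : ∀ {π : Type} [AddCommGroup π] (a : Finset W → π) (ρ : Finset W),
      ρ ∈ F ∪ D.image φ →
      ∑ σ ∈ F ∪ D.image φ, (Pi.single ρ 1 : Finset W → ℤ) σ • a σ = a ρ := by
    intro π _ a ρ hρ
    rw [Finset.sum_eq_single_of_mem ρ hρ, Pi.single_eq_same, one_smul]
    intro σ _ hσ
    rw [Pi.single_eq_of_ne hσ, zero_smul]
  have hz : ∀ {π : Type} [AddCommGroup π] (a : Finset W → π), ∀ σ ∈ F,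
      ∑ ρ ∈ F ∪ D.image φ, z σ ρ • a ρ = a σ - ∑ τ ∈ D, f τ σ • a (φ τ) := by
    intro π _ a σ hσ
    simp only [z, Pi.sub_apply, sub_smul, Finset.sum_sub_distrib, Finset.sum_apply, Pi.smul_apply,
      Finset.sum_smul, smul_assoc]
    rw [hsingle a σ (Finset.mem_union_left _ hσ), Finset.sum_comm]
    congr 1
    refine Finset.sum_congr rfl fun τ hτ => ?_
    rw [← Finset.smul_sum, hsingle a _ (hφF τ hτ)]
  have hcob : ∀ {π : Type} [AddCommGroup π] (c : Finset W → π), ∀ ρ ∈ D,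
      cob (fun σ => ∑ τ ∈ D, f τ σ • c τ) ρ = c ρ := by
    intro π _ c ρ hρ
    rw [cob_sum_smul, Finset.sum_eq_single_of_mem ρ hρ, hf ρ hρ ρ hρ, if_pos rfl, one_smul]
    intro τ hτ hne
    rw [hf τ hτ ρ hρ, if_neg hne, zero_smul]
  choose! ψ hψ using hrep
  refine ⟨D', F'.filter fun ρ => ∀ σ ∈ F, ρ ≠ ψ σ, hE.subD, ⟨hG'.1, fun σ hσ =>
    hG'.2 σ (Finset.mem_filter.1 hσ).1⟩, fun π _ a ha hc => ?_, fun π _ b => ?_⟩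
  · have ha' : ∀ σ ∉ F', a σ = 0 := fun σ hσ => ha σ fun h => hσ (Finset.mem_filter.1 h).1
    have hrel : ∀ σ ∈ F, a σ = ∑ τ ∈ D, f τ σ • a (φ τ) := by
      intro σ hσ
      have h := (hψ σ hσ).2 π a ha' fun τ hτ _ => hc τ hτ
      rw [ha (ψ σ) fun h => (Finset.mem_filter.1 h).2 σ hσ rfl, hz a σ hσ] at h
      exact sub_eq_zero.1 h.symm
    have hφ0 : ∀ τ ∈ D, a (φ τ) = 0 := by
      intro τ hτ
      rw [← hcob (fun τ => a (φ τ)) τ hτ, ← hc τ (hE.subD hτ)]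
      exact cob_congr fun v hv => (hrel _ (hfacet τ hτ v hv)).symm
    refine hE.unique π a ha' (fun σ hσ => ?_) fun τ hτ _ => hc τ hτ
    obtain hσ | hσ := Finset.mem_union.1 hσ
    · rw [hrel σ hσ]
      exact Finset.sum_eq_zero fun τ hτ => by rw [hφ0 τ hτ, smul_zero]
    · obtain ⟨τ, hτ, rfl⟩ := Finset.mem_image.1 hσ
      exact hφ0 τ hτ
  · obtain ⟨a₀, h0, h0F, h0c⟩ := hE.exist π (fun _ => 0) b
    let c : Finset W → π := fun τ => b τ + cob (fun σ => a₀ (ψ σ)) τ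
    obtain ⟨a₁, h1, h1F, h1c⟩ := hE.exist π (fun ρ =>
      if ρ ∈ F then ∑ τ ∈ D, f τ ρ • c τ - a₀ (ψ ρ)
      else ∑ τ ∈ D, if φ τ = ρ then c τ else 0) fun _ => 0
    have h1σ : ∀ σ ∈ F, a₁ σ = ∑ τ ∈ D, f τ σ • c τ - a₀ (ψ σ) := fun σ hσ => by
      rw [h1F σ (Finset.mem_union_left _ hσ), if_pos hσ]
    have h1φ : ∀ τ ∈ D, a₁ (φ τ) = c τ := fun τ hτ => by
      rw [h1F _ (hφF τ hτ), if_neg (hφ τ).2, Finset.sum_eq_single_of_mem τ hτ, if_pos rfl]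
      intro ρ hρ hne
      exact if_neg fun h => hne (hinj hρ hτ h)
    refine ⟨fun σ => a₀ σ + a₁ σ, fun σ hσ => ?_, fun τ hτ => ?_⟩
    · by_cases hσF : σ ∈ F'
      · rw [Finset.mem_filter, not_and] at hσ
        have h := hσ hσF
        push Not at h
        obtain ⟨ρ, hρ, rfl⟩ := h
        beta_reduce
        have hsum : ∑ τ ∈ D, f τ ρ • a₁ (φ τ) = ∑ τ ∈ D, f τ ρ • c τ :=
          Finset.sum_congr rfl fun τ hτ => by rw [h1φ τ hτ]
        rw [(hψ ρ hρ).2 π a₁ h1 h1c, hz a₁ ρ hρ, h1σ ρ hρ, hsum]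
        abel
      · beta_reduce
        rw [h0 σ hσF, h1 σ hσF, add_zero]
    · rw [cob_add]
      by_cases hD : τ ∈ D
      · have e0 : cob a₀ τ = cob (fun _ => 0) τ := cob_congr fun v hv =>
          h0F _ (Finset.mem_union_left _ (hfacet τ hD v hv))
        have e1 : cob a₁ τ = cob (fun σ => ∑ τ ∈ D, f τ σ • c τ - a₀ (ψ σ)) τ :=
          cob_congr fun v hv => h1σ _ (hfacet τ hD v hv)
        rw [e0, e1, cob_zero, cob_sub, hcob c τ hD, zero_add, add_sub_cancel_right]
      · rw [h0c τ hτ hD, h1c τ hτ hD, add_zero]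

end Represent

section Thicken
variable {W : Type} [LinearOrder W] {D F : Finset (Finset W)} {n : ℕ}

/-- The cone with apex `e` on the `n`-skeleton of the simplex on `U`, with the `n`-simplices in `F`
left out. -/
def skeletonCone (U : Finset W) (e : W) (F : Finset (Finset W)) (n : ℕ)
    (hF : ∀ σ ∈ F, σ.card = n + 1) : ASC W where
  faces := {s | s.Nonempty ∧ s ⊆ insert e U ∧ (s.erase e).card ≤ n + 1 ∧ s.erase e ∉ F}
  nonempty_of_mem := fun _ h => h.1
  down_closed := fun s t hs hts ht => by
    have hsub : t.erase e ⊆ s.erase e := Finset.erase_subset_erase e hts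
    refine ⟨ht, hts.trans hs.2.1, (Finset.card_le_card hsub).trans hs.2.2.1, fun h => hs.2.2.2 ?_⟩
    rwa [← Finset.eq_of_subset_of_card_le hsub (by rw [hF _ h]; exact hs.2.2.1)]

/-- Adding to a complex a family of simplices whose facets it contains. -/
def ASC.addSimplices (A : ASC W) (F : Finset (Finset W)) (hne : ∀ σ ∈ F, σ.Nonempty)
    (hF : ∀ σ ∈ F, ∀ v ∈ σ, (σ.erase v).Nonempty → σ.erase v ∈ A.faces) : ASC W where
  faces := {s | s ∈ A.faces ∨ s ∈ F}
  nonempty_of_mem := fun s h => h.elim (fun h => A.nonempty_of_mem h) (hne s)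
  down_closed := fun s t hs hts ht => by
    obtain hs | hs := hs
    · exact Or.inl (A.down_closed hs hts ht)
    · obtain rfl | hne := eq_or_ne t s
      · exact Or.inr hs
      · obtain ⟨v, hv, hvt⟩ := Finset.exists_of_ssubset (hts.ssubset_of_ne hne)
        have hsub : t ⊆ s.erase v := Finset.subset_erase.2 ⟨hts, hvt⟩
        exact Or.inl (A.down_closed (hF s hs v hv (ht.mono hsub)) hsub ht)

theorem exists_contractible_of_bijective (hn : 2 ≤ n) (hG : Graded D F n)
    (hunique : ∀ (π : Type) [AddCommGroup π] (a : Finset W → π), (∀ σ ∉ F, a σ = 0) →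
      (∀ τ ∈ D, cob a τ = 0) → ∀ σ, a σ = 0)
    (hexist : ∀ (π : Type) [AddCommGroup π] (b : Finset W → π), ∃ a : Finset W → π,
      (∀ σ ∉ F, a σ = 0) ∧ ∀ τ ∈ D, cob a τ = b τ)
    {U : Finset W} (hDU : ∀ τ ∈ D, τ ⊆ U) (hFU : ∀ σ ∈ F, σ ⊆ U) {e : W} (he : e ∉ U) :
    ∃ C : ASC W, C.faces.Finite ∧ (∀ s ∈ C.faces, s.card ≤ n + 2) ∧
      ContractibleSpace (realization C) ∧ (∀ s ∈ D, s ∈ C.faces) ∧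
      ∀ s : Finset W, s.Nonempty → s ⊆ U → s.card ≤ n + 1 → s ∈ C.faces := by
  have herase : ∀ s ⊆ U, s.erase e = s := fun s hs =>
    Finset.erase_eq_of_notMem fun h => he (hs h)
  let A := skeletonCone U e F n hG.2
  have hA : ∀ s : Finset W, s ∈ A.faces ↔ s.Nonempty ∧ s ⊆ insert e U ∧
      (s.erase e).card ≤ n + 1 ∧ s.erase e ∉ F := fun s => Iff.rfl
  have hFA : ∀ σ ∈ F, σ ∉ A.faces := fun σ hσ h =>
    h.2.2.2 (by rwa [herase σ (hFU σ hσ)])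
  have hUA : ∀ s : Finset W, s.Nonempty → s ⊆ U → s.card ≤ n + 1 → s ∉ F → s ∈ A.faces :=
    fun s hne hs hc hF => ⟨hne, hs.trans (Finset.subset_insert _ _), by rwa [herase s hs],
      by rwa [herase s hs]⟩
  have hbd₁ : ∀ σ ∈ F, ∀ v ∈ σ, σ.erase v ∈ A.faces := fun σ hσ v hv => by
    have hc := Finset.card_erase_of_mem hv
    rw [hG.2 σ hσ] at hc
    refine hUA _ (Finset.card_pos.1 (by lia)) ((Finset.erase_subset _ _).trans (hFU σ hσ))
      (by lia) fun h => ?_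
    have := hG.2 _ h
    lia
  let B := A.addSimplices F (fun σ hσ => Finset.card_pos.1 (by rw [hG.2 σ hσ]; lia))
    fun σ hσ v hv _ => hbd₁ σ hσ v hv
  have hB : ∀ s : Finset W, s ∈ B.faces ↔ s ∈ A.faces ∨ s ∈ F := fun s => Iff.rfl
  have hUB : ∀ s : Finset W, s.Nonempty → s ⊆ U → s.card ≤ n + 1 → s ∈ B.faces :=
    fun s hne hs hc => (em (s ∈ F)).elim Or.inr fun h => Or.inl (hUA s hne hs hc h)
  have hbd₂ : ∀ τ ∈ D, ∀ v ∈ τ, τ.erase v ∈ B.faces := fun τ hτ v hv => by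
    have hc := Finset.card_erase_of_mem hv
    rw [hG.1 τ hτ] at hc
    exact hUB _ (Finset.card_pos.1 (by lia)) ((Finset.erase_subset _ _).trans (hDU τ hτ)) (by lia)
  let C := B.addSimplices D (fun τ hτ => Finset.card_pos.1 (by rw [hG.1 τ hτ]; lia))
    fun τ hτ v hv _ => hbd₂ τ hτ v hv
  have hC : ∀ s : Finset W, s ∈ C.faces ↔ s ∈ B.faces ∨ s ∈ D := fun s => Iff.rfl
  have hDB : ∀ τ ∈ D, τ ∉ B.faces := fun τ hτ h => by
    have hc := hG.1 τ hτ
    obtain h | h := h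
    · have := h.2.2.1
      rw [herase τ (hDU τ hτ)] at this
      lia
    · have := hG.2 τ h
      lia
  have hsub : C.faces ⊆ ↑(insert e U).powerset := fun s hs => by
    rw [Finset.mem_coe, Finset.mem_powerset]
    obtain (hs | hs) | hs := hs
    · exact hs.2.1
    · exact (hFU s hs).trans (Finset.subset_insert _ _)
    · exact (hDU s hs).trans (Finset.subset_insert _ _)
  have hF' : ∀ σ, ¬ (σ ∈ B.faces ∧ σ ∉ A.faces) ↔ σ ∉ F := fun σ => by
    rw [hB]
    exact not_congr ⟨fun h => h.1.resolve_left h.2, fun h => ⟨Or.inr h, hFA σ h⟩⟩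
  have hfin : C.faces.Finite := (Finset.finite_toSet _).subset hsub
  have hT : TwoLayer A B C n :=
    { finite := hfin
      sub₁ := fun s hs => Or.inl hs
      sub₂ := fun s hs => Or.inl hs
      card₁ := fun σ hσ h => hG.2 σ (hσ.resolve_left h)
      card₂ := fun τ hτ h => hG.1 τ (hτ.resolve_left h)
      bd₁ := fun σ hσ h => hbd₁ σ (hσ.resolve_left h)
      bd₂ := fun τ hτ h => hbd₂ τ (hτ.resolve_left h)
      unique := fun π _ a ha hc => hunique π a (fun σ hσ => ha σ ((hF' σ).2 hσ))
        fun τ hτ => hc τ (Or.inr hτ) (hDB τ hτ)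
      exist := fun π _ b => by
        obtain ⟨a, ha, hc⟩ := hexist π b
        exact ⟨a, fun σ hσ => ha σ ((hF' σ).1 hσ), fun τ hτ h => hc τ (hτ.resolve_left h)⟩ }
  have hempty : ∅ ∉ F := fun h => by
    have := hG.2 _ h
    rw [Finset.card_empty] at this
    lia
  refine ⟨C, hfin, fun s hs => ?_, hT.contractibleSpace hn (e := e) ?_ fun s hs => ?_,
    fun s hs => Or.inr hs, fun s hne hs hc => Or.inl (hUB s hne hs hc)⟩
  · obtain (hs | hs) | hs := hs
    · have := hs.2.2.1
      have := Finset.pred_card_le_card_erase (s := s) (a := e)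
      lia
    · rw [hG.2 s hs]
      lia
    · rw [hG.1 s hs]
  · refine ⟨Finset.singleton_nonempty e, by simp, ?_, ?_⟩ <;>
      rw [Finset.erase_singleton]
    exacts [by simp, hempty]
  · refine ⟨Finset.insert_nonempty _ _, Finset.insert_subset (Finset.mem_insert_self _ _) hs.2.1, ?_⟩
    rw [Finset.erase_insert_eq_erase]
    exact hs.2.2

end Thicken

section Embed

theorem cob_map {V W : Type} [LinearOrder V] [LinearOrder W] {π : Type*} [AddCommGroup π]
    (i : V ↪ W) (hi : StrictMono i) (a : Finset W → π) (τ : Finset V) :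
    cob a (τ.map i) = cob (fun s => a (s.map i)) τ := by
  rw [cob, cob, Finset.sum_map]
  refine Finset.sum_congr rfl fun v _ => ?_
  rw [Finset.map_erase, Finset.filter_map, Finset.card_map]
  simp only [Function.comp_def, hi.lt_iff_lt]

theorem embedsInContractible_of_topCohomVanishes {V : Type} [LinearOrder V] {K : ASC V} {n : ℕ}
    (hn : 2 ≤ n) (hfin : K.faces.Finite) (hcard : ∀ s ∈ K.faces, s.card ≤ n + 2)
    (htop : ∃ s ∈ K.faces, s.card = n + 2) (h : topCohomVanishes K (n + 1)) :
    EmbedsInContractible K (n + 1) := by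
  classical
  let i : V ↪ V ⊕ₗ ℕ := ⟨fun v => toLex (Sum.inl v), fun _ _ h => Sum.inl_injective h⟩
  have hi : StrictMono i := Sum.Lex.inl_strictMono
  let D := (hfin.toFinset.filter fun s => s.card = n + 2).image (Finset.map i)
  let F := (hfin.toFinset.filter fun s => s.card = n + 1).image (Finset.map i)
  have hD : ∀ s ∈ K.faces, s.card = n + 2 → s.map i ∈ D := fun s hs hc =>
    Finset.mem_image_of_mem _ (Finset.mem_filter.2 ⟨hfin.mem_toFinset.2 hs, hc⟩)
  have hD' : ∀ τ ∈ D, ∃ s ∈ K.faces, s.card = n + 2 ∧ s.map i = τ := fun τ hτ => by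
    obtain ⟨s, hs, rfl⟩ := Finset.mem_image.1 hτ
    obtain ⟨hs, hc⟩ := Finset.mem_filter.1 hs
    exact ⟨s, hfin.mem_toFinset.1 hs, hc, rfl⟩
  have hG : Graded D F n := ⟨fun τ hτ => by
    obtain ⟨s, -, hc, rfl⟩ := hD' τ hτ
    rw [Finset.card_map, hc], fun σ hσ => by
    obtain ⟨s, hs, rfl⟩ := Finset.mem_image.1 hσ
    rw [Finset.card_map, (Finset.mem_filter.1 hs).2]⟩
  have hfacet : ∀ τ ∈ D, ∀ v ∈ τ, τ.erase v ∈ F := fun τ hτ v hv => by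
    obtain ⟨s, hs, hc, rfl⟩ := hD' τ hτ
    obtain ⟨u, hu, rfl⟩ := Finset.mem_map.1 hv
    have hc' := Finset.card_erase_of_mem hu
    rw [hc] at hc'
    rw [← Finset.map_erase]
    exact Finset.mem_image_of_mem _ (Finset.mem_filter.2 ⟨hfin.mem_toFinset.2
      (K.down_closed hs (Finset.erase_subset _ _) (Finset.card_pos.1 (by lia))), by lia⟩)
  have hF : F.Nonempty := by
    obtain ⟨s, hs, hc⟩ := htop
    obtain ⟨v, hv⟩ := K.nonempty_of_mem hs
    exact ⟨_, hfacet _ (hD s hs hc) (i v) (Finset.mem_map_of_mem i hv)⟩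
  choose a ha using fun τ : Finset (V ⊕ₗ ℕ) =>
    exists_cob_of_topCohomVanishes (Nat.succ_ne_zero n) h fun s => if τ = s.map i then 1 else 0
  obtain ⟨D', F', hDD, hG', hunique, hexist⟩ := exists_bijective_system (by lia) hG hF hfacet
    (f := fun τ σ => a τ (σ.preimage i i.injective.injOn)) fun τ _ ρ hρ => by
      obtain ⟨s, hs, hc, rfl⟩ := hD' ρ hρ
      rw [cob_map i hi]
      refine (cob_congr fun v _ => ?_).trans ((ha τ s hs hc).trans (by congr))
      rw [Finset.preimage_map]
  let U := (D' ∪ F' ∪ hfin.toFinset.image (Finset.map i)).biUnion id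
  have hU : ∀ s, s ∈ D' ∨ s ∈ F' ∨ s ∈ hfin.toFinset.image (Finset.map i) → s ⊆ U := fun s hs =>
    Finset.subset_biUnion_of_mem id (by rwa [Finset.mem_union, Finset.mem_union, or_assoc])
  obtain ⟨x, -, hx⟩ := exists_seq_above U
  obtain ⟨C, hCfin, hCcard, hCc, hCD, hCs⟩ := exists_contractible_of_bijective hn hG' hunique hexist
    (fun τ hτ => hU τ (Or.inl hτ)) (fun σ hσ => hU σ (Or.inr (Or.inl hσ)))
    fun h => (hx (x 0) h 0).false
  refine ⟨_, C, i, hCcard, hCfin, hCc, fun s hs => ?_⟩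
  obtain hc | hc := (hcard s hs).eq_or_lt
  · exact hCD _ (hDD (hD s hs hc))
  · exact hCs _ ((K.nonempty_of_mem hs).map)
      (hU _ (Or.inr (Or.inr (Finset.mem_image_of_mem _ (hfin.mem_toFinset.2 hs)))))
      (by rw [Finset.card_map]; lia)

end Embed

/-- a finite connected simplicial complex `K` of dimension
`d ≠ 2` embeds as a subcomplex of a finite contractible simplicial complex of
the same dimension `d` if and only if `H^d(K; ℤ) = 0`. -/
theorem stmt15 {V : Type} [LinearOrder V] (K : ASC V) (d : ℕ) (hd2 : d ≠ 2)
    (hfin : K.faces.Finite)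
    (hconn : ConnectedSpace (realization K))
    (hdim : (∀ s ∈ K.faces, s.card ≤ d + 1) ∧ ∃ s ∈ K.faces, s.card = d + 1) :
    EmbedsInContractible K d ↔ topCohomVanishes K d := by
  obtain ⟨hcard, s, hs, hsc⟩ := hdim
  obtain rfl | hd0 := eq_or_ne d 0
  · have h := embeds_and_topCohomVanishes_of_dim_zero K hfin hconn hcard
    exact iff_of_true h.1 h.2
  refine ⟨topCohomVanishes_of_embedsInContractible hd0 ⟨s, hs⟩, fun h => ?_⟩
  obtain rfl | hd1 := eq_or_ne d 1
  · exact embeds_of_dim_one K hfin hconn hcard h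
  · obtain ⟨n, rfl⟩ := Nat.exists_eq_succ_of_ne_zero hd0
    exact embedsInContractible_of_topCohomVanishes (by lia) hfin hcard ⟨s, hs, hsc⟩ h
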